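/- arXiv:1504.01154 — 4 statements merged into one kernel-verified Lean document; each statement's English description precedes it below -/
import Mathlib

section
/- Let π : 𝕊² → 𝕊² be a branched covering of degree d with finite branch set F and ramification numbers e. Then the preimage π⁻¹(F) is finite and ∑_{y ∈ π⁻¹(F)} (e(y) − 1) = 2d − 2 (the Riemann–Hurwitz condition). -/
/-- The 2-sphere, as a topological space. -/
abbrev Sphere2 : Type := ↥(Metric.sphere (0 : EuclideanSpace ℝ (Fin 3)) 1)

/-- The open unit disc in `ℂ`. -/
abbrev unitDisc : Set ℂ := Metric.ball (0 : ℂ) 1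

/-- `π : 𝕊² → 𝕊²` is a branched covering of degree `d` with finite branch set `F`
and ramification numbers `e`. -/
structure IsBranchedCovering (d : ℕ) (π : Sphere2 → Sphere2) (F : Set Sphere2)
    (e : Sphere2 → ℕ) : Prop where
  continuous : Continuous π
  finiteBranch : F.Finite
  covering : IsCoveringMap fun x : ((π ⁻¹' F)ᶜ : Set Sphere2) =>
    (⟨π x.1, x.2⟩ : (Fᶜ : Set Sphere2))
  fiber_card : ∀ x : Sphere2, x ∉ F → Nat.card ↥(π ⁻¹' {x}) = d
  ram_eq_one : ∀ y : Sphere2, π y ∉ F → e y = 1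
  ram : ∀ y : Sphere2, π y ∈ F → 1 ≤ e y ∧
    ∃ (U V : Set Sphere2) (_hUo : IsOpen U) (_hVo : IsOpen V) (hyU : y ∈ U)
      (hyV : π y ∈ V) (hmaps : Set.MapsTo π U V)
      (h : ↥U ≃ₜ ↥unitDisc) (g : ↥V ≃ₜ ↥unitDisc),
      (h ⟨y, hyU⟩ : ℂ) = 0 ∧ (g ⟨π y, hyV⟩ : ℂ) = 0 ∧
      ∀ z (hz : z ∈ U), (g ⟨π z, hmaps hz⟩ : ℂ) = (h ⟨z, hz⟩ : ℂ) ^ (e y)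

section

open Set Function Topology

section MayerVietoris

variable {X : Type*} [TopologicalSpace X]

/-- `U` is the disjoint union of `k` simply connected open sets. -/
def HasSimplyConnectedPieces (k : ℕ) (U : Set X) : Prop :=
  ∃ P : Fin k → Set X, (∀ i, IsOpen (P i)) ∧ Pairwise (Disjoint on P) ∧ ⋃ i, P i = U ∧
    ∀ i, IsSimplyConnected (P i)

/-- A disjoint union of open sets is homeomorphic to their topological sum. -/
theorem exists_homeomorph_sigma_of_isOpen {ι : Type*} {P : ι → Set X} {U : Set X}
    (ho : ∀ i, IsOpen (P i)) (hd : Pairwise (Disjoint on P)) (hU : ⋃ i, P i = U) :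
    ∃ Φ : (Σ i, P i) ≃ₜ U, ∀ i (x : P i), (Φ ⟨i, x⟩ : X) = x := by
  have hmem : ∀ i, P i ⊆ U := fun i => hU ▸ subset_iUnion P i
  let f : (Σ i, P i) → U := fun s => ⟨s.2.1, hmem s.1 s.2.2⟩
  have hc : Continuous f := by
    refine continuous_sigma fun i => ?_
    exact Continuous.subtype_mk continuous_subtype_val _
  have hopen : IsOpenMap f := by
    refine isOpenMap_sigma.2 fun i => ?_
    exact (ho i).isOpenMap_inclusion (hmem i)
  have hb : Bijective f := by
    constructor
    · rintro ⟨i, x, hx⟩ ⟨j, y, hy⟩ h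
      obtain rfl : x = y := congrArg Subtype.val h
      obtain rfl : i = j := by
        by_contra hij
        exact disjoint_left.1 (hd hij) hx hy
      rfl
    · rintro ⟨x, hx⟩
      rw [← hU] at hx
      obtain ⟨i, hi⟩ := mem_iUnion.1 hx
      exact ⟨⟨i, x, hi⟩, rfl⟩
  exact ⟨(Equiv.ofBijective f hb).toHomeomorphOfContinuousOpen hc hopen, fun _ _ => rfl⟩

theorem HasSimplyConnectedPieces.nonempty_linearEquiv {k : ℕ} {U : Set X}
    (h : HasSimplyConnectedPieces k U) : Nonempty (C(U, ℤ) ≃ₗ[ℤ] (Fin k → ℤ)) := by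
  obtain ⟨P, ho, hd, hU, hs⟩ := h
  obtain ⟨Φ, -⟩ := exists_homeomorph_sigma_of_isOpen ho hd hU
  have hP : ∀ i, PathConnectedSpace (P i) := fun i =>
    have := (hs i).simplyConnectedSpace
    inferInstance
  let x : ∀ i, P i := fun i => (hP i).nonempty.some
  let ev : C(U, ℤ) →+ (Fin k → ℤ) :=
    { toFun := fun f i => f (Φ ⟨i, x i⟩)
      map_zero' := rfl
      map_add' := fun _ _ => rfl }
  refine ⟨LinearEquiv.ofBijective ev.toIntLinearMap ⟨fun f g hfg => ?_, fun c => ?_⟩⟩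
  · ext u
    obtain ⟨⟨i, y⟩, rfl⟩ := Φ.surjective u
    have key : ∀ f : C(U, ℤ), f (Φ ⟨i, y⟩) = f (Φ ⟨i, x i⟩) := fun f =>
      PreconnectedSpace.constant (f := fun z : P i => f (Φ ⟨i, z⟩)) inferInstance
        (f.continuous.comp (Φ.continuous.comp continuous_sigmaMk))
    rw [key f, key g]
    exact congrFun hfg i
  · refine ⟨(ContinuousMap.sigma fun i => ContinuousMap.const (P i) (c i)).comp
      (Φ.symm : C(U, Σ i, P i)), ?_⟩
    ext i
    change ContinuousMap.sigma (fun i => ContinuousMap.const (P i) (c i))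
      (Φ.symm (Φ ⟨i, x i⟩)) = c i
    simp

theorem HasSimplyConnectedPieces.exists_real_lift [LocallyPathConnectedSpace X] {k : ℕ} {U : Set X}
    (h : HasSimplyConnectedPieces k U) (f : C(U, UnitAddCircle)) :
    ∃ F : C(U, ℝ), ∀ x, (F x : UnitAddCircle) = f x := by
  obtain ⟨P, ho, hd, hU, hs⟩ := h
  obtain ⟨Φ, -⟩ := exists_homeomorph_sigma_of_isOpen ho hd hU
  have hlift : ∀ i, ∃ F : C(P i, ℝ), ∀ z, (F z : UnitAddCircle) = f (Φ ⟨i, z⟩) := by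
    intro i
    have := (hs i).simplyConnectedSpace
    have := (ho i).locallyPathConnectedSpace
    obtain ⟨z₀⟩ : Nonempty (P i) := (hs i).nonempty.to_subtype
    obtain ⟨t, ht⟩ := QuotientAddGroup.mk_surjective (f (Φ ⟨i, z₀⟩))
    obtain ⟨F, ⟨-, hF⟩, -⟩ := (AddCircle.isCoveringMap_coe (1 : ℝ)).existsUnique_continuousMap_lifts
      (f.comp ((Φ : C(Σ i, P i, U)).comp ⟨Sigma.mk i, continuous_sigmaMk⟩)) z₀ t ht
    exact ⟨F, congrFun hF⟩
  choose F hF using hlift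
  refine ⟨(ContinuousMap.sigma F).comp (Φ.symm : C(U, Σ i, P i)), fun x => ?_⟩
  obtain ⟨⟨i, z⟩, rfl⟩ := Φ.surjective x
  simpa using hF i z

/-- The inclusion of real-valued functions, modulo integers, into circle-valued functions. -/
noncomputable def realToCircle (X : Type*) [TopologicalSpace X] :
    C(X, ℝ) →ₗ[ℤ] C(X, UnitAddCircle) :=
  AddMonoidHom.toIntLinearMap
    { toFun := fun f => ⟨fun x => (f x : UnitAddCircle),
        (AddCircle.continuous_mk' 1).comp f.continuous⟩
      map_zero' := by ext; simp
      map_add' := fun _ _ => rfl }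

/-- The first integral cohomology group, as circle-valued functions up to homotopy. -/
abbrev CircleCohomology (X : Type*) [TopologicalSpace X] : Type _ :=
  C(X, UnitAddCircle) ⧸ LinearMap.range (realToCircle X)

/-- The difference of restrictions to an intersection. -/
def restrictSub (U V : Set X) : C(U, ℤ) × C(V, ℤ) →ₗ[ℤ] C(↥(U ∩ V), ℤ) :=
  AddMonoidHom.toIntLinearMap
    { toFun := fun w => w.1.comp ⟨inclusion inter_subset_left, by fun_prop⟩ -
        w.2.comp ⟨inclusion inter_subset_right, by fun_prop⟩
      map_zero' := by ext; simp
      map_add' := fun f g => by ext; simp; ring }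

@[simp]
theorem restrictSub_apply (U V : Set X) (w : C(U, ℤ) × C(V, ℤ)) (x : X) (hx : x ∈ U ∩ V) :
    restrictSub U V w ⟨x, hx⟩ = w.1 ⟨x, hx.1⟩ - w.2 ⟨x, hx.2⟩ := rfl

theorem continuous_of_continuousOn_union {Y : Type*} [TopologicalSpace Y] {U V : Set X}
    (hU : IsOpen U) (hV : IsOpen V) (hUV : U ∪ V = univ) {f : X → Y} (h₁ : ContinuousOn f U)
    (h₂ : ContinuousOn f V) : Continuous f := by
  rw [← continuousOn_univ, ← hUV]
  exact h₁.union_of_isOpen h₂ hU hV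

theorem exists_glue {Y : Type*} [TopologicalSpace Y] {U V : Set X} (hU : IsOpen U)
    (hV : IsOpen V) (hUV : U ∪ V = univ) {f g : X → Y} (hf : ContinuousOn f U)
    (hg : ContinuousOn g V) (hfg : ∀ x ∈ U ∩ V, f x = g x) :
    ∃ F : C(X, Y), EqOn F f U ∧ EqOn F g V := by
  classical
  have h₁ : EqOn (U.piecewise f g) f U := piecewise_eqOn U f g
  have h₂ : EqOn (U.piecewise f g) g V := fun x hx => by
    by_cases h : x ∈ U
    · rw [h₁ h, hfg x ⟨h, hx⟩]
    · exact piecewise_eqOn_compl U f g h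
  exact ⟨⟨_, continuous_of_continuousOn_union hU hV hUV (hf.congr h₁) (hg.congr h₂)⟩, h₁, h₂⟩

open Classical in
/-- Extension by zero. -/
noncomputable def zeroExtension {R : Type*} [Zero R] [TopologicalSpace R] {U : Set X}
    (f : C(U, R)) (x : X) : R :=
  if h : x ∈ U then f ⟨x, h⟩ else 0

theorem zeroExtension_of_mem {R : Type*} [Zero R] [TopologicalSpace R] {U : Set X}
    (f : C(U, R)) {x : X} (h : x ∈ U) : zeroExtension f x = f ⟨x, h⟩ := dif_pos h

theorem continuousOn_zeroExtension {R : Type*} [Zero R] [TopologicalSpace R] {U : Set X}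
    (f : C(U, R)) : ContinuousOn (zeroExtension f) U := by
  rw [continuousOn_iff_continuous_domRestrict]
  convert f.continuous using 1
  ext x
  exact zeroExtension_of_mem f x.2

/-- Continuous functions on `X` restrict to pairs of functions which agree on the overlap. -/
theorem nonempty_ker_restrictSub_equiv {U V : Set X} (hU : IsOpen U) (hV : IsOpen V)
    (hUV : U ∪ V = univ) :
    Nonempty (C(X, ℤ) ≃ₗ[ℤ] LinearMap.ker (restrictSub U V)) := by
  let r : C(X, ℤ) →+ C(U, ℤ) × C(V, ℤ) :=
    { toFun := fun f => (f.restrict U, f.restrict V)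
      map_zero' := rfl
      map_add' := fun _ _ => rfl }
  have hr : ∀ f, r.toIntLinearMap f ∈ LinearMap.ker (restrictSub U V) := by
    intro f
    rw [LinearMap.mem_ker]
    ext ⟨x, hx⟩
    exact sub_self (f x)
  refine ⟨LinearEquiv.ofBijective (r.toIntLinearMap.codRestrict _ hr) ⟨fun f g hfg => ?_, ?_⟩⟩
  · have h' := congrArg Subtype.val hfg
    ext x
    rcases (hUV ▸ mem_univ x : x ∈ U ∪ V) with hx | hx
    · exact DFunLike.congr_fun (congrArg Prod.fst h') ⟨x, hx⟩
    · exact DFunLike.congr_fun (congrArg Prod.snd h') ⟨x, hx⟩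
  · rintro ⟨⟨u, v⟩, huv⟩
    have hagree : ∀ x (hxU : x ∈ U) (hxV : x ∈ V), u ⟨x, hxU⟩ = v ⟨x, hxV⟩ := fun x hxU hxV =>
      sub_eq_zero.1 (DFunLike.congr_fun (LinearMap.mem_ker.1 huv) ⟨x, hxU, hxV⟩)
    obtain ⟨g, gU, gV⟩ := exists_glue hU hV hUV (continuousOn_zeroExtension u)
      (continuousOn_zeroExtension v) fun x hx => by
        rw [zeroExtension_of_mem u hx.1, zeroExtension_of_mem v hx.2, hagree]
    refine ⟨g, Subtype.ext (Prod.ext ?_ ?_)⟩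
    · ext x; exact (gU x.2).trans (zeroExtension_of_mem u x.2)
    · ext x; exact (gV x.2).trans (zeroExtension_of_mem v x.2)

theorem zeroExtension_add {R : Type*} [AddZeroClass R] [TopologicalSpace R] [ContinuousAdd R]
    {U : Set X} (f g : C(U, R)) (x : X) :
    zeroExtension (f + g) x = zeroExtension f x + zeroExtension g x := by
  unfold zeroExtension
  split_ifs <;> simp

theorem continuousOn_cast_zeroExtension {U : Set X} (c : C(U, ℤ)) :
    ContinuousOn (fun x => ((zeroExtension c x : ℤ) : ℝ)) U :=
  (continuous_of_discreteTopology (f := ((↑) : ℤ → ℝ))).comp_continuousOn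
    (continuousOn_zeroExtension c)

theorem continuousOn_mul_zeroExtension {U V : Set X} (hU : IsOpen U) (hV : IsOpen V)
    {ψ : X → ℝ} (hψ : Continuous ψ) (h : ∀ x ∉ V, ∀ᶠ y in 𝓝 x, ψ y = 0) (c : C(↥(U ∩ V), ℤ)) :
    ContinuousOn (fun x => ψ x * zeroExtension c x) U := by
  intro x hx
  refine ContinuousAt.continuousWithinAt ?_
  by_cases hxV : x ∈ V
  · exact hψ.continuousAt.mul
      ((continuousOn_cast_zeroExtension c).continuousAt ((hU.inter hV).mem_nhds ⟨hx, hxV⟩))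
  · refine (continuousAt_const (y := (0 : ℝ))).congr ?_
    filter_upwards [h x hxV] with y hy
    simp [hy]

theorem exists_int_lift {U : Set X} {g : X → ℝ} (hg : ContinuousOn g U)
    (hint : ∀ x ∈ U, (g x : UnitAddCircle) = 0) :
    ∃ u : C(U, ℤ), ∀ x : U, (u x : ℝ) = g x := by
  have : ∀ x : U, ∃ n : ℤ, (n : ℝ) = g x := by
    intro x
    obtain ⟨n, hn⟩ := (AddCircle.coe_eq_zero_iff (1 : ℝ)).1 (hint x x.2)
    exact ⟨n, by simpa using hn⟩
  choose u hu using this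
  refine ⟨⟨u, ?_⟩, hu⟩
  rw [Int.isClosedEmbedding_coe_real.isInducing.continuous_iff]
  convert continuousOn_iff_continuous_domRestrict.1 hg using 1
  ext x
  exact hu x

theorem UnitAddCircle.coe_intCast (n : ℤ) : ((n : ℝ) : UnitAddCircle) = 0 :=
  (AddCircle.coe_eq_zero_iff (1 : ℝ)).2 ⟨n, by simp⟩

/-- A two-set partition of unity which is locally constant near the complements of the sets. -/
theorem exists_partition [NormalSpace X] {U V : Set X} (hU : IsOpen U) (hV : IsOpen V)
    (hUV : U ∪ V = univ) :
    ∃ φ : X → ℝ, Continuous φ ∧ (∀ x ∉ V, ∀ᶠ y in 𝓝 x, φ y = 0) ∧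
      ∀ x ∉ U, ∀ᶠ y in 𝓝 x, 1 - φ y = 0 := by
  have hdisj : Disjoint Vᶜ Uᶜ := by
    rw [disjoint_compl_left_iff_subset]
    intro x hx
    exact ((hUV ▸ mem_univ x : x ∈ U ∪ V)).resolve_left hx
  obtain ⟨ψ, h0, h1, -⟩ := exists_continuous_zero_one_of_isClosed hV.isClosed_compl
    hU.isClosed_compl hdisj
  refine ⟨fun x => max 0 (min 1 (3 * ψ x - 1)), by fun_prop, fun x hx => ?_, fun x hx => ?_⟩
  · have : ∀ᶠ y in 𝓝 x, ψ y < 1 / 3 :=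
      ψ.continuous.continuousAt.eventually_lt_const (by rw [h0 hx]; norm_num)
    filter_upwards [this] with y hy
    exact max_eq_left ((min_le_right _ _).trans (by linarith))
  · have : ∀ᶠ y in 𝓝 x, 2 / 3 < ψ y :=
      ψ.continuous.continuousAt.eventually_const_lt (by rw [h1 hx]; norm_num)
    filter_upwards [this] with y hy
    rw [min_eq_left (by linarith)]
    norm_num

/-- The Mayer–Vietoris sequence identifies the circle cohomology with the cokernel
of the restriction map, if circle-valued functions on `U` and `V` have real lifts. -/
theorem nonempty_circleCohomology_equiv [NormalSpace X] {U V : Set X} (hU : IsOpen U)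
    (hV : IsOpen V) (hUV : U ∪ V = univ)
    (liftU : ∀ f : C(U, UnitAddCircle), ∃ F : C(U, ℝ), ∀ x, (F x : UnitAddCircle) = f x)
    (liftV : ∀ f : C(V, UnitAddCircle), ∃ F : C(V, ℝ), ∀ x, (F x : UnitAddCircle) = f x) :
    Nonempty ((C(↥(U ∩ V), ℤ) ⧸ LinearMap.range (restrictSub U V)) ≃ₗ[ℤ] CircleCohomology X) := by
  obtain ⟨φ, hφ, hφV, hφU⟩ := exists_partition hU hV hUV
  have memUV : ∀ x, x ∈ U ∨ x ∈ V := fun x => (hUV ▸ mem_univ x : x ∈ U ∪ V)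
  have contU := fun c => continuousOn_mul_zeroExtension hU hV hφ hφV c
  have contV : ∀ c : C(↥(U ∩ V), ℤ), ContinuousOn (fun x => (1 - φ x) * zeroExtension c x) V := by
    intro c x hx
    by_cases hxU : x ∈ U
    · exact ((continuous_const.sub hφ).continuousAt.mul
        ((continuousOn_cast_zeroExtension c).continuousAt
          ((hU.inter hV).mem_nhds ⟨hxU, hx⟩))).continuousWithinAt
    · refine ((continuousAt_const (y := (0 : ℝ))).congr ?_).continuousWithinAt
      filter_upwards [hφU x hxU] with y hy
      simp [hy]
  have circ : ∀ (c : C(↥(U ∩ V), ℤ)) x, ((φ x * zeroExtension c x : ℝ) : UnitAddCircle) =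
      ((-((1 - φ x) * zeroExtension c x) : ℝ) : UnitAddCircle) := by
    intro c x
    rw [← sub_eq_zero, ← AddCircle.coe_sub]
    convert UnitAddCircle.coe_intCast (zeroExtension c x) using 2
    ring
  have hcont : ∀ c : C(↥(U ∩ V), ℤ),
      Continuous fun x => ((φ x * zeroExtension c x : ℝ) : UnitAddCircle) := by
    intro c
    refine continuous_of_continuousOn_union hU hV hUV
      ((AddCircle.continuous_mk' 1).comp_continuousOn (contU c)) ?_
    simp_rw [circ]
    exact (AddCircle.continuous_mk' 1).comp_continuousOn (contV c).neg
  let δ : C(↥(U ∩ V), ℤ) →+ C(X, UnitAddCircle) :=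
    { toFun := fun c => ⟨_, hcont c⟩
      map_zero' := by ext x; simp [zeroExtension]
      map_add' := fun c c' => by
        ext x
        simp [zeroExtension_add, mul_add] }
  let D := (LinearMap.range (realToCircle X)).mkQ ∘ₗ δ.toIntLinearMap
  have hker : LinearMap.ker D = LinearMap.range (restrictSub U V) := by
    ext c
    rw [LinearMap.mem_ker, LinearMap.comp_apply, Submodule.mkQ_apply,
      Submodule.Quotient.mk_eq_zero, LinearMap.mem_range, LinearMap.mem_range]
    constructor
    · rintro ⟨F, hF⟩
      have hF' : ∀ x, ((F x : ℝ) : UnitAddCircle) =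
          ((φ x * zeroExtension c x : ℝ) : UnitAddCircle) :=
        DFunLike.congr_fun hF
      obtain ⟨u, hu⟩ := exists_int_lift
        (g := fun x => φ x * zeroExtension c x - F x) ((contU c).sub F.continuous.continuousOn)
        (fun x _ => by rw [AddCircle.coe_sub, hF', sub_self])
      obtain ⟨v, hv⟩ := exists_int_lift
        (g := fun x => -((1 - φ x) * zeroExtension c x) - F x)
        ((contV c).neg.sub F.continuous.continuousOn)
        (fun x _ => by rw [AddCircle.coe_sub, hF', circ, sub_self])
      refine ⟨(u, v), ?_⟩
      ext ⟨x, hx⟩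
      rw [restrictSub_apply]
      have h1 := hu ⟨x, hx.1⟩
      have h2 := hv ⟨x, hx.2⟩
      simp only [zeroExtension_of_mem c hx] at h1 h2
      rify
      linarith
    · rintro ⟨⟨u, v⟩, rfl⟩
      obtain ⟨c, hc⟩ : ∃ c, c = restrictSub U V (u, v) := ⟨_, rfl⟩
      rw [← hc]
      let gU : X → ℝ := fun x => φ x * zeroExtension c x - zeroExtension u x
      let gV : X → ℝ := fun x => -((1 - φ x) * zeroExtension c x) - zeroExtension v x
      have hgU : ContinuousOn gU U := (contU c).sub (continuousOn_cast_zeroExtension u)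
      have hgV : ContinuousOn gV V := (contV c).neg.sub (continuousOn_cast_zeroExtension v)
      have hagree : ∀ x ∈ U ∩ V, gU x = gV x := by
        intro x hx
        have hcx : c ⟨x, hx⟩ = u ⟨x, hx.1⟩ - v ⟨x, hx.2⟩ := by rw [hc, restrictSub_apply]
        simp only [gU, gV, zeroExtension_of_mem u hx.1, zeroExtension_of_mem v hx.2,
          zeroExtension_of_mem c hx, hcx]
        push_cast
        ring
      obtain ⟨g, hgU', hgV'⟩ := exists_glue hU hV hUV hgU hgV hagree
      refine ⟨g, ?_⟩
      ext x
      change ((g x : ℝ) : UnitAddCircle) = ((φ x * zeroExtension c x : ℝ) : UnitAddCircle)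
      rcases memUV x with h | h
      · rw [hgU' h]
        simp [gU, UnitAddCircle.coe_intCast]
      · rw [hgV' h, circ]
        simp [gV, UnitAddCircle.coe_intCast]
  have hsurj : Surjective D := by
    intro q
    obtain ⟨f, rfl⟩ := Submodule.mkQ_surjective _ q
    obtain ⟨a, ha⟩ := liftU (f.restrict U)
    obtain ⟨b, hb⟩ := liftV (f.restrict V)
    have hab : ContinuousOn (fun x => zeroExtension a x - zeroExtension b x) (U ∩ V) :=
      ((continuousOn_zeroExtension a).mono inter_subset_left).sub
        ((continuousOn_zeroExtension b).mono inter_subset_right)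
    obtain ⟨c, hc⟩ := exists_int_lift hab (fun x hx => by
      rw [zeroExtension_of_mem a hx.1, zeroExtension_of_mem b hx.2, AddCircle.coe_sub, ha, hb]
      simp)
    refine ⟨c, ?_⟩
    rw [LinearMap.comp_apply, ← sub_eq_zero, ← map_sub, Submodule.mkQ_apply,
      Submodule.Quotient.mk_eq_zero]
    let gU : X → ℝ := fun x => φ x * zeroExtension c x - zeroExtension a x
    let gV : X → ℝ := fun x => -((1 - φ x) * zeroExtension c x) - zeroExtension b x
    have hgU : ContinuousOn gU U := (contU c).sub (continuousOn_zeroExtension a)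
    have hgV : ContinuousOn gV V := (contV c).neg.sub (continuousOn_zeroExtension b)
    have hagree : ∀ x ∈ U ∩ V, gU x = gV x := by
      intro x hx
      have := hc ⟨x, hx⟩
      simp only [gU, gV, zeroExtension_of_mem c hx]
      dsimp only at this
      linear_combination this
    obtain ⟨g, hgU', hgV'⟩ := exists_glue hU hV hUV hgU hgV hagree
    refine ⟨g, ?_⟩
    ext x
    change ((g x : ℝ) : UnitAddCircle) = ((φ x * zeroExtension c x : ℝ) : UnitAddCircle) - f x
    rcases memUV x with h | h
    · rw [hgU' h]
      simp [gU, zeroExtension_of_mem a h, ha]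
    · rw [hgV' h, circ]
      simp [gV, zeroExtension_of_mem b h, hb]
  exact ⟨(Submodule.quotEquivOfEq _ _ hker.symm).trans (D.quotKerEquivOfSurjective hsurj)⟩

/-- `X` is covered by two open sets made of `a` and `b` simply connected pieces, with an
intersection made of `c` simply connected pieces. -/
def HasTwoSetCover (X : Type*) [TopologicalSpace X] (a b c : ℕ) : Prop :=
  ∃ U V : Set X, U ∪ V = univ ∧ HasSimplyConnectedPieces a U ∧ HasSimplyConnectedPieces b V ∧
    HasSimplyConnectedPieces c (U ∩ V)

theorem HasSimplyConnectedPieces.isOpen {k : ℕ} {U : Set X} (h : HasSimplyConnectedPieces k U) :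
    IsOpen U := by
  obtain ⟨P, ho, -, rfl, -⟩ := h
  exact isOpen_iUnion ho

/-- The Euler characteristic can be computed from any cover by two unions of simply
connected pieces. -/
theorem HasTwoSetCover.finrank_sub_finrank [NormalSpace X] [LocallyPathConnectedSpace X]
    {a b c : ℕ} (h : HasTwoSetCover X a b c) :
    (Module.finrank ℤ C(X, ℤ) : ℤ) - Module.finrank ℤ (CircleCohomology X) = a + b - c := by
  obtain ⟨U, V, hUV, hU, hV, hW⟩ := h
  obtain ⟨eker⟩ := nonempty_ker_restrictSub_equiv hU.isOpen hV.isOpen hUV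
  obtain ⟨ecoker⟩ := nonempty_circleCohomology_equiv hU.isOpen hV.isOpen hUV
    hU.exists_real_lift hV.exists_real_lift
  obtain ⟨eU⟩ := hU.nonempty_linearEquiv
  obtain ⟨eV⟩ := hV.nonempty_linearEquiv
  obtain ⟨eW⟩ := hW.nonempty_linearEquiv
  have := Module.Finite.equiv eU.symm
  have := Module.Finite.equiv eV.symm
  have := Module.Finite.equiv eW.symm
  have := Module.Free.of_equiv eU.symm
  have := Module.Free.of_equiv eV.symm
  have h1 := (restrictSub U V).ker.finrank_quotient_add_finrank
  have h2 := (LinearMap.range (restrictSub U V)).finrank_quotient_add_finrank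
  rw [(restrictSub U V).quotKerEquivRange.finrank_eq, Module.finrank_prod, eU.finrank_eq,
    eV.finrank_eq, ← eker.finrank_eq] at h1
  rw [ecoker.finrank_eq, eW.finrank_eq] at h2
  simp only [Module.finrank_fintype_fun_eq_card, Fintype.card_fin] at h1 h2
  lia

end MayerVietoris

section Pieces

variable {X E : Type*} [TopologicalSpace X] [TopologicalSpace E]

theorem HasSimplyConnectedPieces.of_finite {ι : Type*} [Finite ι] {U : Set X} (P : ι → Set X)
    (ho : ∀ i, IsOpen (P i)) (hd : Pairwise (Disjoint on P)) (hU : ⋃ i, P i = U)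
    (hs : ∀ i, IsSimplyConnected (P i)) : HasSimplyConnectedPieces (Nat.card ι) U := by
  let e := (Finite.equivFin ι).symm
  refine ⟨P ∘ e, fun i => ho _, fun i j hij => hd (e.injective.ne hij), ?_, fun i => hs _⟩
  rw [← hU]
  exact e.surjective.iUnion_comp P

theorem HasSimplyConnectedPieces.of_isSimplyConnected {U : Set X} (ho : IsOpen U)
    (hs : IsSimplyConnected U) : HasSimplyConnectedPieces 1 U :=
  ⟨fun _ => U, fun _ => ho, fun i j hij => (hij (Subsingleton.elim i j)).elim, iUnion_const U,
    fun _ => hs⟩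

theorem HasSimplyConnectedPieces.preimage_isEmbedding {k : ℕ} {U : Set X}
    (h : HasSimplyConnectedPieces k U) {f : E → X} (hf : IsEmbedding f) (hU : U ⊆ range f) :
    HasSimplyConnectedPieces k (f ⁻¹' U) := by
  obtain ⟨P, ho, hd, rfl, hs⟩ := h
  refine ⟨fun i => f ⁻¹' P i, fun i => (ho i).preimage hf.continuous,
    fun i j hij => (hd hij).preimage f, preimage_iUnion.symm, fun i => ?_⟩
  rw [← hf.isSimplyConnected_image,
    image_preimage_eq_of_subset ((subset_iUnion P i).trans hU)]
  exact hs i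

/-- Over a simply connected open set, a covering map is a disjoint union of sections. -/
theorem IsCoveringMap.exists_sheets [LocallyPathConnectedSpace X] {p : E → X}
    (hp : IsCoveringMap p) {P : Set X} (ho : IsOpen P) (hs : IsSimplyConnected P) {x₀ : X}
    (hx₀ : x₀ ∈ P) :
    ∃ Q : p ⁻¹' {x₀} → Set E, (∀ i, IsOpen (Q i)) ∧ Pairwise (Disjoint on Q) ∧
      ⋃ i, Q i = p ⁻¹' P ∧ ∀ i, IsSimplyConnected (Q i) := by
  have := hs.simplyConnectedSpace
  have := ho.locallyPathConnectedSpace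
  let ι : C(P, X) := ⟨Subtype.val, continuous_subtype_val⟩
  have hsec : ∀ i : p ⁻¹' {x₀}, ∃ s : C(P, E), s ⟨x₀, hx₀⟩ = i ∧ p ∘ s = ι := fun i =>
    (hp.existsUnique_continuousMap_lifts ι ⟨x₀, hx₀⟩ i i.2).exists
  choose s hs₀ hsp using hsec
  have hps : ∀ i z, p (s i z) = z := fun i => congrFun (hsp i)
  have hemb : ∀ i, IsOpenEmbedding (s i) := fun i =>
    hp.isLocalHomeomorph.isOpenEmbedding_of_comp
      (by rw [hsp i]; exact ho.isOpenEmbedding_subtypeVal) (s i).continuous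
  refine ⟨fun i => range (s i), fun i => (hemb i).isOpen_range, fun i j hij => ?_, ?_, fun i => ?_⟩
  · refine disjoint_left.2 ?_
    rintro _ ⟨z, rfl⟩ ⟨w, hw⟩
    obtain rfl : w = z := Subtype.ext (by rw [← hps j w, hw, hps])
    have heq := hp.eq_of_comp_eq (s j).continuous (s i).continuous (by rw [hsp, hsp]) w hw
    exact hij (Subtype.ext (by rw [← hs₀ i, ← hs₀ j, heq]))
  · ext y
    simp only [mem_iUnion, mem_range, mem_preimage]
    constructor
    · rintro ⟨i, z, rfl⟩
      rw [hps]
      exact z.2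
    · intro hy
      obtain ⟨t, ⟨ht, htp⟩, -⟩ := hp.existsUnique_continuousMap_lifts ι ⟨p y, hy⟩ y rfl
      have ht₀ : p (t ⟨x₀, hx₀⟩) = x₀ := congrFun htp _
      have heq := hp.eq_of_comp_eq (s ⟨_, ht₀⟩).continuous t.continuous (by rw [hsp, htp])
        ⟨x₀, hx₀⟩ (hs₀ _)
      exact ⟨⟨_, ht₀⟩, ⟨p y, hy⟩, by rw [heq, ht]⟩
  · change IsSimplyConnected (range (s i))
    rw [← image_univ, (hemb i).isEmbedding.isSimplyConnected_image]
    exact (Homeomorph.Set.univ P).toHomotopyEquiv.simplyConnectedSpace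

theorem HasSimplyConnectedPieces.preimage_covering [LocallyPathConnectedSpace X] {k d : ℕ}
    {U : Set X} (h : HasSimplyConnectedPieces k U) {p : E → X} (hp : IsCoveringMap p)
    (hfin : ∀ x, Finite (p ⁻¹' {x})) (hcard : ∀ x, Nat.card (p ⁻¹' {x}) = d) :
    HasSimplyConnectedPieces (k * d) (p ⁻¹' U) := by
  obtain ⟨P, ho, hd, rfl, hs⟩ := h
  choose x hx using fun i => (hs i).nonempty
  choose Q hQo hQd hQU hQs using fun i => hp.exists_sheets (ho i) (hs i) (hx i)
  have hsub : ∀ i j, Q i j ⊆ p ⁻¹' P i := fun i j => hQU i ▸ subset_iUnion (Q i) j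
  have hk := HasSimplyConnectedPieces.of_finite (ι := Σ i, p ⁻¹' {x i}) (U := p ⁻¹' ⋃ i, P i)
    (fun s => Q s.1 s.2) (fun s => hQo _ _) ?_ ?_ (fun s => hQs _ _)
  · simpa [Nat.card_sigma, hcard] using hk
  · rintro ⟨i, y⟩ ⟨j, z⟩ hne
    by_cases hij : i = j
    · subst hij
      exact hQd i fun hyz : y = z => hne (by rw [hyz])
    · exact ((hd hij).preimage p).mono (hsub i y) (hsub j z)
  · rw [iUnion_sigma, preimage_iUnion]
    exact iUnion_congr hQU

theorem HasTwoSetCover.of_covering [LocallyPathConnectedSpace X] {a b c d : ℕ}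
    (h : HasTwoSetCover X a b c) {p : E → X} (hp : IsCoveringMap p)
    (hfin : ∀ x, Finite (p ⁻¹' {x})) (hcard : ∀ x, Nat.card (p ⁻¹' {x}) = d) :
    HasTwoSetCover E (a * d) (b * d) (c * d) := by
  obtain ⟨U, V, hUV, hU, hV, hW⟩ := h
  exact ⟨p ⁻¹' U, p ⁻¹' V, by rw [← preimage_union, hUV, preimage_univ],
    hU.preimage_covering hp hfin hcard, hV.preimage_covering hp hfin hcard,
    hW.preimage_covering hp hfin hcard⟩

end Pieces

section Plane

/-- The complement of the downward closed rays from the points of `S`. -/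
def aboveSlits (S : Set (ℝ × ℝ)) : Set (ℝ × ℝ) := {z | ∀ s ∈ S, z.1 = s.1 → s.2 < z.2}

/-- The complement of the upward closed rays from the points of `S`. -/
def belowSlits (S : Set (ℝ × ℝ)) : Set (ℝ × ℝ) := {z | ∀ s ∈ S, z.1 = s.1 → z.2 < s.2}

theorem isOpen_aboveSlits {S : Set (ℝ × ℝ)} (hS : S.Finite) : IsOpen (aboveSlits S) := by
  have : aboveSlits S = ⋂ s ∈ S, ({z | z.1 ≠ s.1} ∪ {z | s.2 < z.2}) := by
    ext z
    simp [aboveSlits, or_iff_not_imp_left]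
  rw [this]
  exact hS.isOpen_biInter fun s _ =>
    (isOpen_ne_fun continuous_fst continuous_const).union
      (isOpen_lt continuous_const continuous_snd)

theorem isSimplyConnected_of_convex {S : Set (ℝ × ℝ)} (hc : Convex ℝ S) (hne : S.Nonempty) :
    IsSimplyConnected S := by
  have := hc.contractibleSpace hne
  exact SimplyConnectedSpace.ofContractible S

theorem isSimplyConnected_aboveSlits {S : Set (ℝ × ℝ)} (hS : S.Finite) :
    IsSimplyConnected (aboveSlits S) := by
  obtain ⟨M, hM⟩ : ∃ M : ℝ, ∀ s ∈ S, s.2 < M := by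
    obtain ⟨M, hM⟩ := (hS.image Prod.snd).bddAbove
    exact ⟨M + 1, fun s hs => (hM (mem_image_of_mem _ hs)).trans_lt (lt_add_one M)⟩
  have hhigh : ∀ z : ℝ × ℝ, M ≤ z.2 → z ∈ aboveSlits S := fun z hz s hs _ => (hM s hs).trans_le hz
  have hup : ∀ z ∈ aboveSlits S, ∀ w : ℝ × ℝ, w.1 = z.1 → z.2 ≤ w.2 → w ∈ aboveSlits S :=
    fun z hz w h1 h2 s hs h => (hz s hs (h1 ▸ h)).trans_le h2
  let lift : C(aboveSlits S, aboveSlits S) :=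
    ⟨fun z => ⟨(z.1.1, max z.1.2 M), hup z z.2 _ rfl (le_max_left _ _)⟩, by fun_prop⟩
  let H₁ : (ContinuousMap.id (aboveSlits S)).Homotopy lift :=
    { toFun := fun q => ⟨(q.2.1.1, (1 - (q.1 : ℝ)) * q.2.1.2 + q.1 * max q.2.1.2 M),
        hup q.2 q.2.2 _ rfl (by
          nlinarith [le_max_left q.2.1.2 M, q.1.2.1])⟩
      continuous_toFun := by fun_prop
      map_zero_left := fun z => by ext <;> simp
      map_one_left := fun z => by ext <;> simp [lift] }
  let H₂ : lift.Homotopy (ContinuousMap.const _ ⟨(0, M), hhigh _ le_rfl⟩) :=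
    { toFun := fun q => ⟨((1 - (q.1 : ℝ)) * q.2.1.1, (1 - (q.1 : ℝ)) * max q.2.1.2 M + q.1 * M),
        hhigh _ (by
          nlinarith [le_max_right q.2.1.2 M, q.1.2.2])⟩
      continuous_toFun := by fun_prop
      map_zero_left := fun z => by ext <;> simp [lift]
      map_one_left := fun z => by ext <;> simp }
  have : ContractibleSpace (aboveSlits S) :=
    (contractible_iff_id_nullhomotopic _).2 ⟨_, ⟨H₁.trans H₂⟩⟩
  exact SimplyConnectedSpace.ofContractible _

/-- Reflection of the plane in the horizontal axis. -/
def planeReflection : ℝ × ℝ ≃ₜ ℝ × ℝ := (Homeomorph.refl ℝ).prodCongr (Homeomorph.neg ℝ)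

theorem belowSlits_eq (S : Set (ℝ × ℝ)) :
    belowSlits S = planeReflection ⁻¹' aboveSlits (planeReflection '' S) := by
  ext z
  simp only [belowSlits, aboveSlits, mem_ofPred_eq, mem_preimage, forall_mem_image]
  exact forall₂_congr fun s _ => imp_congr_right fun _ => neg_lt_neg_iff.symm

theorem isOpen_belowSlits {S : Set (ℝ × ℝ)} (hS : S.Finite) : IsOpen (belowSlits S) := by
  rw [belowSlits_eq]
  exact (isOpen_aboveSlits (hS.image _)).preimage planeReflection.continuous

theorem isSimplyConnected_belowSlits {S : Set (ℝ × ℝ)} (hS : S.Finite) :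
    IsSimplyConnected (belowSlits S) := by
  rw [belowSlits_eq, Homeomorph.isSimplyConnected_preimage]
  exact isSimplyConnected_aboveSlits (hS.image _)

theorem exists_card_filter_lt_eq (A : Finset ℝ) : ∀ c, (∀ a ∈ A, a < c) → ∀ k ≤ A.card,
    ∃ x < c, x ∉ A ∧ (A.filter (· < x)).card = k := by
  classical
  induction A using Finset.induction_on_max with
  | empty => exact fun c _ k hk => ⟨c - 1, by linarith, by simp, by simpa [eq_comm] using hk⟩
  | insert a A ha ih =>
    intro c hc k hk
    have haA : a ∉ A := fun h => lt_irrefl _ (ha a h)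
    rw [Finset.card_insert_of_notMem haA] at hk
    rcases hk.lt_or_eq with hk | rfl
    · obtain ⟨x, hxa, hxA, hcard⟩ := ih a ha k (Nat.lt_succ_iff.1 hk)
      refine ⟨x, hxa.trans (hc a (Finset.mem_insert_self _ _)), ?_, ?_⟩
      · simp [hxA, hxa.ne]
      · rw [Finset.filter_insert, if_neg hxa.not_gt, hcard]
    · obtain ⟨x, hax, hxc⟩ := exists_between (hc a (Finset.mem_insert_self _ _))
      have hlt : ∀ b ∈ insert a A, b < x := by
        intro b hb
        rcases Finset.mem_insert.1 hb with rfl | hb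
        · exact hax
        · exact (ha b hb).trans hax
      refine ⟨x, hxc, fun hx => lt_irrefl _ (hlt x hx), ?_⟩
      rw [Finset.filter_true_of_mem hlt, Finset.card_insert_of_notMem haA]

theorem hasSimplyConnectedPieces_strips (A : Finset ℝ) :
    HasSimplyConnectedPieces (A.card + 1) {z : ℝ × ℝ | z.1 ∉ A} := by
  classical
  let count : ℝ → ℕ := fun x => (A.filter (· < x)).card
  have hmono : Monotone count := fun x y hxy => by
    refine Finset.card_le_card fun a ha => ?_
    simp only [Finset.mem_filter] at ha ⊢
    exact ⟨ha.1, ha.2.trans_le hxy⟩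
  let T : Fin (A.card + 1) → Set ℝ := fun k => {x | x ∉ A ∧ count x = k}
  have hord : ∀ k, OrdConnected (T k) := by
    refine fun k => ⟨fun x hx y hy t ht => ?_⟩
    have hcount : count t = k :=
      le_antisymm ((hmono ht.2).trans_eq hy.2) (hx.2.symm.trans_le (hmono ht.1))
    refine ⟨fun htA => ?_, hcount⟩
    have hty : t < y := ht.2.lt_of_ne fun h => hy.1 (h ▸ htA)
    have hlt : count t < count y := by
      refine Finset.card_lt_card (Finset.ssubset_iff_of_subset (fun a ha => ?_) |>.2 ⟨t, ?_, ?_⟩)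
      · simp only [Finset.mem_filter] at ha ⊢
        exact ⟨ha.1, ha.2.trans hty⟩
      · simp [htA, hty]
      · simp
    exact hlt.ne (hcount.trans hy.2.symm)
  have hTo : ∀ k, IsOpen (T k) := by
    intro k
    rw [isOpen_iff_mem_nhds]
    intro x hx
    have hev : ∀ᶠ y in 𝓝 x, ∀ a ∈ A, y ≠ a ∧ (a < y ↔ a < x) := by
      rw [Filter.eventually_all_finset]
      intro a ha
      rcases lt_or_gt_of_ne fun h : x = a => hx.1 (h ▸ ha) with h | h
      · filter_upwards [gt_mem_nhds h] with y hy
        exact ⟨hy.ne, by simp [hy.not_gt, h.not_gt]⟩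
      · filter_upwards [lt_mem_nhds h] with y hy
        exact ⟨hy.ne', by simp [hy, h]⟩
    filter_upwards [hev] with y hy
    refine ⟨fun hyA => (hy y hyA).1 rfl, ?_⟩
    rw [← hx.2]
    exact congrArg Finset.card (Finset.filter_congr fun a ha => (hy a ha).2)
  obtain ⟨c, hc⟩ : ∃ c, ∀ a ∈ A, a < c := by
    obtain ⟨M, hM⟩ := A.bddAbove
    exact ⟨M + 1, fun a ha => (hM ha).trans_lt (lt_add_one M)⟩
  refine ⟨fun k => T k ×ˢ univ, fun k => (hTo k).prod isOpen_univ, fun i j hij => ?_, ?_,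
    fun k => isSimplyConnected_of_convex ((hord k).convex.prod convex_univ) ?_⟩
  · refine disjoint_left.2 fun z hz hz' => hij (Fin.ext ?_)
    rw [← hz.1.2, ← hz'.1.2]
  · ext z
    simp only [mem_iUnion, mem_prod, mem_univ, and_true, mem_ofPred_eq]
    exact ⟨fun ⟨_, h⟩ => h.1, fun h =>
      ⟨⟨count z.1, Nat.lt_succ_of_le (Finset.card_filter_le _ _)⟩, h, rfl⟩⟩
  · obtain ⟨x, -, hxA, hx⟩ := exists_card_filter_lt_eq A c hc k (Nat.lt_succ_iff.1 k.2)
    exact ⟨(x, 0), ⟨hxA, hx⟩, mem_univ _⟩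

/-- The complement in the plane of a finite set of points with distinct abscissas is covered by
two simply connected slit planes which meet in vertical strips. -/
theorem hasTwoSetCover_of_isEmbedding_plane {E : Type*} [TopologicalSpace E] {S : Set (ℝ × ℝ)}
    (hS : S.Finite) (hinj : InjOn Prod.fst S) {f : E → ℝ × ℝ} (hf : IsEmbedding f)
    (hrange : range f = Sᶜ) : HasTwoSetCover E 1 1 (S.ncard + 1) := by
  classical
  have hA : aboveSlits S ⊆ range f := hrange ▸ fun z hz hzS => lt_irrefl _ (hz z hzS rfl)
  have hB : belowSlits S ⊆ range f := hrange ▸ fun z hz hzS => lt_irrefl _ (hz z hzS rfl)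
  have hinter : aboveSlits S ∩ belowSlits S = {z | z.1 ∉ (hS.image Prod.fst).toFinset} := by
    ext z
    simp only [Finite.mem_toFinset, mem_image, not_exists, not_and, mem_ofPred_eq, mem_inter_iff]
    exact ⟨fun h s hs hsz => lt_asymm (h.1 s hs hsz.symm) (h.2 s hs hsz.symm),
      fun h => ⟨fun s hs hsz => (h s hs hsz.symm).elim, fun s hs hsz => (h s hs hsz.symm).elim⟩⟩
  refine ⟨f ⁻¹' aboveSlits S, f ⁻¹' belowSlits S, ?_,
    (HasSimplyConnectedPieces.of_isSimplyConnected (isOpen_aboveSlits hS)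
      (isSimplyConnected_aboveSlits hS)).preimage_isEmbedding hf hA,
    (HasSimplyConnectedPieces.of_isSimplyConnected (isOpen_belowSlits hS)
      (isSimplyConnected_belowSlits hS)).preimage_isEmbedding hf hB, ?_⟩
  · rw [← preimage_union, preimage_eq_univ_iff, hrange]
    intro z hz
    by_contra hcon
    simp only [aboveSlits, belowSlits, mem_union, mem_ofPred_eq, not_or, not_forall, not_lt] at hcon
    obtain ⟨⟨s, hs, hsz, hle⟩, ⟨t, ht, htz, hge⟩⟩ := hcon
    obtain rfl : s = t := hinj hs ht (hsz.symm.trans htz)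
    exact hz (Prod.ext hsz (le_antisymm hle hge) ▸ hs)
  · have hcard : S.ncard = (hS.image Prod.fst).toFinset.card := by
      rw [← ncard_eq_toFinset_card _ (hS.image Prod.fst), hinj.ncard_image]
    rw [← preimage_inter, hinter, hcard]
    exact (hasSimplyConnectedPieces_strips _).preimage_isEmbedding hf
      (hinter ▸ inter_subset_left.trans hA)

end Plane

section Sphere

/-- A shear of the Euclidean plane, in product coordinates. -/
noncomputable def planeShear (t : ℝ) : EuclideanSpace ℝ (Fin 2) ≃ₜ ℝ × ℝ where
  toFun x := (x 0 + t * x 1, x 1)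
  invFun y := !₂[y.1 - t * y.2, y.2]
  left_inv x := by ext i; fin_cases i <;> simp
  right_inv y := by ext <;> simp
  continuous_toFun := by fun_prop
  continuous_invFun := by fun_prop

theorem exists_injOn_fst_planeShear {S : Set (EuclideanSpace ℝ (Fin 2))} (hS : S.Finite) :
    ∃ t, InjOn (fun x => (planeShear t x).1) S := by
  obtain ⟨t, ht⟩ := ((hS.prod hS).image
    fun z => -(z.1 0 - z.2 0) / (z.1 1 - z.2 1)).exists_notMem
  refine ⟨t, fun p hp q hq hpq => ?_⟩
  have h : p 0 + t * p 1 = q 0 + t * q 1 := hpq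
  have h1 : p 1 = q 1 := by
    by_contra hne
    refine ht ⟨(p, q), ⟨hp, hq⟩, ?_⟩
    rw [div_eq_iff (sub_ne_zero.2 hne)]
    linear_combination -h
  ext i
  fin_cases i
  · simpa [h1] using h
  · exact h1

/-- A sphere with at least one puncture is covered by two simply connected open sets whose
intersection has as many pieces as there are punctures. -/
theorem hasTwoSetCover_sphere_compl {S : Set Sphere2} (hS : S.Finite) (hne : S.Nonempty) :
    HasTwoSetCover ↥(Sᶜ) 1 1 S.ncard := by
  obtain ⟨v, hv⟩ := hne
  have : Fact (Module.finrank ℝ (EuclideanSpace ℝ (Fin 3)) = 2 + 1) := ⟨by simp⟩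
  obtain ⟨e, hsource, htarget⟩ :
      ∃ e : OpenPartialHomeomorph Sphere2 (EuclideanSpace ℝ (Fin 2)),
        e.source = {v}ᶜ ∧ e.target = univ :=
    ⟨stereographic' 2 v, stereographic'_source v, stereographic'_target v⟩
  have hsub : Sᶜ ⊆ e.source := hsource ▸ fun x hx hxv => hx (by rwa [mem_singleton_iff.1 hxv])
  have hsub' : S \ {v} ⊆ e.source := hsource ▸ fun x hx => hx.2
  obtain ⟨t, ht⟩ := exists_injOn_fst_planeShear (hS.sdiff.image e : (e '' (S \ {v})).Finite)
  let f : ↥(Sᶜ) → ℝ × ℝ := fun x => planeShear t (e x)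
  have hf : IsEmbedding f := (planeShear t).isEmbedding.comp
    (e.isOpenEmbedding_restrict.isEmbedding.comp (IsEmbedding.inclusion hsub))
  have hrange : range f = (planeShear t '' (e '' (S \ {v})))ᶜ := by
    ext z
    obtain ⟨w, rfl⟩ := (planeShear t).surjective z
    obtain ⟨x, hx, rfl⟩ := e.surjOn (htarget ▸ mem_univ w : w ∈ e.target)
    rw [mem_compl_iff, (planeShear t).injective.mem_set_image,
      e.injOn.mem_image_iff hsub' hx]
    constructor
    · rintro ⟨y, hy⟩ hxS
      have := e.injOn (hsub y.2) hx ((planeShear t).injective hy)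
      exact y.2 (this ▸ hxS.1)
    · intro hxS
      exact ⟨⟨x, fun h => hxS ⟨h, by rwa [hsource] at hx⟩⟩, rfl⟩
  have hcard : (planeShear t '' (e '' (S \ {v}))).ncard + 1 = S.ncard := by
    rw [ncard_image_of_injective _ (planeShear t).injective,
      (e.injOn.mono hsub').ncard_image, ncard_sdiff_singleton_add_one hv hS]
  rw [← hcard]
  refine hasTwoSetCover_of_isEmbedding_plane ((hS.sdiff.image e).image _) ?_ hf hrange
  rintro _ ⟨x, hx, rfl⟩ _ ⟨y, hy, rfl⟩ hxy
  rw [ht hx hy hxy]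

end Sphere

section Fibers

theorem ncard_setOf_pow_eq {n : ℕ} (hn : n ≠ 0) {a : ℂ} (ha : a ≠ 0) :
    {w : ℂ | w ^ n = a}.ncard = n := by
  classical
  have hζ := Complex.isPrimitiveRoot_exp n hn
  obtain ⟨b, hb⟩ := IsAlgClosed.exists_pow_nat_eq a (Nat.pos_of_ne_zero hn)
  have hroots : {w : ℂ | w ^ n = a} = ((Polynomial.nthRoots n a).toFinset : Set ℂ) := by
    ext w
    simp [Polynomial.mem_nthRoots (Nat.pos_of_ne_zero hn)]
  rw [hroots, ncard_coe_finset, Multiset.toFinset_card_of_nodup (hζ.nthRoots_nodup ha),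
    hζ.card_nthRoots, if_pos ⟨b, hb⟩]

theorem nontrivial_sphere2 : Nontrivial Sphere2 := by
  have hne : (Metric.sphere (0 : EuclideanSpace ℝ (Fin 3)) 1).Nonempty :=
    NormedSpace.sphere_nonempty.2 zero_le_one
  obtain ⟨x, hx⟩ := hne
  refine ⟨⟨x, hx⟩, -⟨x, hx⟩, fun h => ?_⟩
  exact ne_neg_of_mem_unit_sphere ℝ (⟨x, hx⟩ : Sphere2) h

theorem one_lt_rank_euclideanSpace_three : 1 < Module.rank ℝ (EuclideanSpace ℝ (Fin 3)) := by
  rw [rank_eq_card_basis (EuclideanSpace.basisFun (Fin 3) ℝ).toBasis]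
  norm_num

theorem connectedSpace_sphere2 : ConnectedSpace Sphere2 :=
  isConnected_iff_connectedSpace.1
    (isConnected_sphere one_lt_rank_euclideanSpace_three 0 zero_le_one)

theorem nhdsNE_neBot_sphere2 (p : Sphere2) : (𝓝[≠] p).NeBot := by
  have := nontrivial_sphere2
  have := connectedSpace_sphere2
  infer_instance

variable {d : ℕ} {π : Sphere2 → Sphere2} {F : Set Sphere2} {e : Sphere2 → ℕ}

/-- Near a point `y` over the branch set, `y` is the only point of its fiber, and the
nearby fibers have `e y` points. -/
theorem IsBranchedCovering.exists_isOpen_ncard_eq (hbc : IsBranchedCovering d π F e) {y : Sphere2}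
    (hy : π y ∈ F) {N : Set Sphere2} (hN : IsOpen N) (hyN : y ∈ N) :
    ∃ M ⊆ N, IsOpen M ∧ y ∈ M ∧ M ∩ π ⁻¹' {π y} = {y} ∧
      ∀ᶠ q in 𝓝 (π y), q ≠ π y → (M ∩ π ⁻¹' {q}).ncard = e y := by
  obtain ⟨he, U, V, hUo, hVo, hyU, hyV, hmaps, h, g, h0, g0, hpow⟩ := hbc.ram y hy
  have he0 : e y ≠ 0 := Nat.one_le_iff_ne_zero.1 he
  let φ : unitDisc → Sphere2 := fun w => h.symm w
  have hφ : IsOpenEmbedding φ := hUo.isOpenEmbedding_subtypeVal.comp h.symm.isOpenEmbedding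
  let o : unitDisc := ⟨0, Metric.mem_ball_self one_pos⟩
  have hφo : φ o = y := by
    have : h ⟨y, hyU⟩ = o := Subtype.ext h0
    simp only [φ, ← this, h.symm_apply_apply]
  have hπφ : ∀ w q (hq : q ∈ V), π (φ w) = q ↔ (w : ℂ) ^ e y = g ⟨q, hq⟩ := by
    intro w q hq
    have hw := hpow (φ w) (h.symm w).2
    rw [show (⟨φ w, (h.symm w).2⟩ : U) = h.symm w from rfl, h.apply_symm_apply] at hw
    rw [← hw]
    exact ⟨fun h => by simp only [h], fun h => congrArg Subtype.val (g.injective (Subtype.ext h))⟩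
  obtain ⟨r, hr, hrN⟩ : ∃ r > 0, Metric.ball o r ⊆ φ ⁻¹' N :=
    Metric.isOpen_iff.1 (hN.preimage hφ.continuous) o (by rwa [mem_preimage, hφo])
  have hball : ∀ w : unitDisc, w ∈ Metric.ball o r ↔ ‖(w : ℂ)‖ < r := fun w => by
    rw [Metric.mem_ball, Subtype.dist_eq, dist_zero_right]
  have hinter : ∀ q (hq : q ∈ V), ‖(g ⟨q, hq⟩ : ℂ)‖ < r ^ e y →
      φ '' Metric.ball o r ∩ π ⁻¹' {q} =
        φ '' (Subtype.val ⁻¹' {w : ℂ | w ^ e y = g ⟨q, hq⟩}) := by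
    intro q hq hqr
    ext z
    constructor
    · rintro ⟨⟨w, -, rfl⟩, hw⟩
      exact ⟨w, (hπφ w q hq).1 hw, rfl⟩
    · rintro ⟨w, hw, rfl⟩
      refine ⟨⟨w, (hball w).2 ?_, rfl⟩, (hπφ w q hq).2 hw⟩
      refine lt_of_pow_lt_pow_left₀ (e y) hr.le ?_
      rwa [← norm_pow, show (w : ℂ) ^ e y = g ⟨q, hq⟩ from hw]
  refine ⟨φ '' Metric.ball o r, image_subset_iff.2 hrN, hφ.isOpenMap _ Metric.isOpen_ball,
    ⟨o, Metric.mem_ball_self hr, hφo⟩, ?_, ?_⟩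
  · rw [hinter _ hyV (by rw [g0, norm_zero]; positivity), g0]
    have hzero : (Subtype.val ⁻¹' {w : ℂ | w ^ e y = 0} : Set unitDisc) = {o} := by
      ext w
      rw [mem_singleton_iff, Subtype.ext_iff]
      exact pow_eq_zero_iff he0
    rw [hzero, image_singleton, hφo]
  · have hopen : IsOpen (Subtype.val '' {v : V | ‖(g v : ℂ)‖ < r ^ e y}) :=
      hVo.isOpenMap_subtype_val _ (isOpen_lt (by fun_prop) continuous_const)
    filter_upwards [hopen.mem_nhds ⟨⟨π y, hyV⟩, by
      change ‖(g ⟨π y, hyV⟩ : ℂ)‖ < r ^ e y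
      rw [g0, norm_zero]
      positivity, rfl⟩]
    rintro _ ⟨⟨q, hq⟩, hqr, rfl⟩ hne
    have hg : (g ⟨q, hq⟩ : ℂ) ≠ 0 := fun h => hne <| by
      have := g.injective (Subtype.ext (h.trans g0.symm))
      exact congrArg Subtype.val this
    rw [hinter q hq hqr, ncard_image_of_injective _ hφ.injective,
      ncard_preimage_of_injective_subset_range Subtype.val_injective, ncard_setOf_pow_eq he0 hg]
    intro w hw
    have hw' : w ^ e y = g ⟨q, hq⟩ := hw
    have hlt : ‖w ^ e y‖ < 1 := hw' ▸ mem_ball_zero_iff.1 (g ⟨q, hq⟩).2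
    rw [norm_pow] at hlt
    exact ⟨⟨w, mem_ball_zero_iff.2 ((pow_lt_one_iff_of_nonneg (norm_nonneg w) he0).1 hlt)⟩, rfl⟩

theorem IsBranchedCovering.isCoveringMapOn (hbc : IsBranchedCovering d π F e) :
    IsCoveringMapOn π Fᶜ := by
  have hF : IsOpen Fᶜ := hbc.finiteBranch.isClosed.isOpen_compl
  exact .of_isCoveringMap_restrictPreimage _ hF (hF.preimage hbc.continuous) hbc.covering

theorem IsBranchedCovering.finite_fiber (hbc : IsBranchedCovering d π F e) (p : Sphere2) :
    (π ⁻¹' {p}).Finite := by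
  have : CompactSpace (π ⁻¹' {p}) :=
    isCompact_iff_compactSpace.1 (isClosed_singleton.preimage hbc.continuous).isCompact
  have : DiscreteTopology (π ⁻¹' {p}) := by
    by_cases hp : p ∈ F
    · refine discreteTopology_subtype_iff'.2 fun y hy => ?_
      obtain rfl : π y = p := hy
      obtain ⟨M, -, hM, -, hMy, -⟩ := hbc.exists_isOpen_ncard_eq hp isOpen_univ (mem_univ y)
      exact ⟨M, hM, hMy⟩
    · exact (hbc.isCoveringMapOn p hp).discreteTopology_fiber
  exact finite_of_compact_of_discrete

theorem IsBranchedCovering.card_fiber (hbc : IsBranchedCovering d π F e) {p : Sphere2}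
    (hp : p ∉ F) : (hbc.finite_fiber p).toFinset.card = d := by
  rw [← ncard_eq_toFinset_card _ (hbc.finite_fiber p), ← Nat.card_coe_set_eq, hbc.fiber_card p hp]

/-- The ramification numbers along each fiber sum to the degree. -/
theorem IsBranchedCovering.sum_fiber (hbc : IsBranchedCovering d π F e) (p : Sphere2) :
    ∑ y ∈ (hbc.finite_fiber p).toFinset, e y = d := by
  classical
  by_cases hp : p ∈ F
  swap
  · rw [Finset.sum_congr rfl fun y hy => hbc.ram_eq_one y ?_, ← Finset.card_eq_sum_ones,
      hbc.card_fiber hp]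
    rwa [(hbc.finite_fiber p).mem_toFinset.1 hy]
  obtain ⟨N, hN, hdisj⟩ := (hbc.finite_fiber p).t2_separation
  have hloc : ∀ y, ∃ M, π y = p → M ⊆ N y ∧ IsOpen M ∧ y ∈ M ∧
      ∀ᶠ q in 𝓝 p, q ≠ p → (M ∩ π ⁻¹' {q}).ncard = e y := by
    intro y
    by_cases hy : π y = p
    · subst hy
      obtain ⟨M, hMN, hM, hyM, -, hcard⟩ := hbc.exists_isOpen_ncard_eq hp (hN y).2 (hN y).1
      exact ⟨M, fun _ => ⟨hMN, hM, hyM, hcard⟩⟩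
    · exact ⟨∅, fun h => (hy h).elim⟩
  choose M hM using hloc
  have hcover : ∀ᶠ q in 𝓝 p, ∀ z ∈ π ⁻¹' {q}, z ∈ ⋃ y ∈ π ⁻¹' {p}, M y :=
    hbc.continuous.isClosedMap.eventually_nhds_fiber p fun y hy =>
      Filter.mem_of_superset ((hM y hy).2.1.mem_nhds (hM y hy).2.2.1)
        (subset_biUnion_of_mem (u := M) hy)
  have hcard : ∀ᶠ q in 𝓝 p, ∀ y ∈ π ⁻¹' {p}, q ≠ p → (M y ∩ π ⁻¹' {q}).ncard = e y :=
    (Filter.eventually_all_finite (hbc.finite_fiber p)).2 fun y hy => (hM y hy).2.2.2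
  have hF : ∀ᶠ q in 𝓝 p, q ∉ F \ {p} :=
    hbc.finiteBranch.sdiff.isClosed.isOpen_compl.mem_nhds fun h => h.2 rfl
  have := nhdsNE_neBot_sphere2 p
  obtain ⟨q, ⟨hqcover, hqcard, hqF⟩, hqp⟩ :=
    (((hcover.and (hcard.and hF)).filter_mono nhdsWithin_le_nhds).and
      (self_mem_nhdsWithin : {p}ᶜ ∈ 𝓝[≠] p)).exists
  have hqF' : q ∉ F := fun h => hqF ⟨h, hqp⟩
  have hunion : (hbc.finite_fiber q).toFinset = (hbc.finite_fiber p).toFinset.biUnion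
      fun y => (hbc.finite_fiber q).toFinset.filter (· ∈ M y) := by
    ext z
    simp only [Finset.mem_biUnion, Finset.mem_filter, Finite.mem_toFinset]
    refine ⟨fun hz => ?_, fun ⟨_, _, hz, _⟩ => hz⟩
    obtain ⟨y, hy, hzy⟩ := mem_iUnion₂.1 (hqcover z hz)
    exact ⟨y, hy, hz, hzy⟩
  refine Eq.trans ?_ (hbc.card_fiber hqF')
  rw [hunion, Finset.card_biUnion]
  · refine Finset.sum_congr rfl fun y hy => ?_
    rw [← hqcard y ((hbc.finite_fiber p).mem_toFinset.1 hy) hqp, ← ncard_coe_finset]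
    congr 1
    ext z
    simp [and_comm]
  · intro y hy z hz hyz
    rw [Finite.coe_toFinset] at hy hz
    refine Finset.disjoint_left.2 fun w hw hw' => ?_
    simp only [Finset.mem_filter] at hw hw'
    exact disjoint_left.1 (hdisj hy hz hyz) ((hM y hy).1 hw.2) ((hM z hz).1 hw'.2)

end Fibers

section EulerCharacteristic

variable {d : ℕ} {π : Sphere2 → Sphere2} {F : Set Sphere2} {e : Sphere2 → ℕ}

theorem locallyPathConnectedSpace_sphere2 : LocallyPathConnectedSpace Sphere2 := by
  have : Fact (Module.finrank ℝ (EuclideanSpace ℝ (Fin 3)) = 2 + 1) := ⟨by simp⟩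
  exact ChartedSpace.locallyPathConnectedSpace (EuclideanSpace ℝ (Fin 2)) Sphere2

theorem IsBranchedCovering.finite_preimage (hbc : IsBranchedCovering d π F e) {S : Set Sphere2}
    (hS : S.Finite) : (π ⁻¹' S).Finite :=
  hS.preimage' fun p _ => hbc.finite_fiber p

/-- Multiplicativity of the Euler characteristic away from the branch set. -/
theorem IsBranchedCovering.two_sub_ncard_preimage (hbc : IsBranchedCovering d π F e)
    {S : Set Sphere2} (hS : S.Finite) (hFS : F ⊆ S) (hne : (π ⁻¹' S).Nonempty) :
    (2 : ℤ) - (π ⁻¹' S).ncard = 2 * d - S.ncard * d := by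
  have := locallyPathConnectedSpace_sphere2
  have hopen : IsOpen Sᶜ := hS.isClosed.isOpen_compl
  have hcov : IsCoveringMap (Sᶜ.restrictPreimage π) :=
    (hbc.isCoveringMapOn.mono (compl_subset_compl.2 hFS)).isCoveringMap_restrictPreimage
  have : LocallyPathConnectedSpace ↥(Sᶜ) := hopen.locallyPathConnectedSpace
  have : LocallyPathConnectedSpace ↥(π ⁻¹' Sᶜ) :=
    (hopen.preimage hbc.continuous).locallyPathConnectedSpace
  have himage : ∀ x : ↥(Sᶜ), Subtype.val '' (Sᶜ.restrictPreimage π ⁻¹' {x}) = π ⁻¹' {x.1} :=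
    fun x => by rw [image_val_preimage_restrictPreimage, image_singleton]
  have hdown : HasTwoSetCover ↥(Sᶜ) 1 1 S.ncard :=
    hasTwoSetCover_sphere_compl hS (hne.elim fun y hy => ⟨π y, hy⟩)
  have hup : HasTwoSetCover ↥(π ⁻¹' Sᶜ) 1 1 (π ⁻¹' S).ncard :=
    hasTwoSetCover_sphere_compl (hbc.finite_preimage hS) hne
  have hlift := hdown.of_covering (d := d) hcov
    (fun x => Finite.of_finite_image ((himage x).symm ▸ hbc.finite_fiber x)
      Subtype.val_injective.injOn)
    (fun x => by
      rw [← Nat.card_image_of_injective Subtype.val_injective, himage,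
        hbc.fiber_card x fun h => x.2 (hFS h)])
  have heq := hup.finrank_sub_finrank.symm.trans hlift.finrank_sub_finrank
  push_cast at heq
  linarith

end EulerCharacteristic

end

/-- Riemann–Hurwitz: for a degree `d` branched covering with branch set `F`,
the preimage `π⁻¹(F)` is finite and `∑_{y ∈ π⁻¹(F)} (e(y) - 1) = 2d - 2`. -/
theorem riemann_hurwitz_condition (d : ℕ) (π : Sphere2 → Sphere2) (F : Set Sphere2)
    (e : Sphere2 → ℕ) (hbc : IsBranchedCovering d π F e) :
    ∃ hfin : (π ⁻¹' F).Finite,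
      hfin.toFinset.sum (fun y => (e y : ℤ) - 1) = 2 * d - 2 := by
  classical
  obtain ⟨x₀⟩ : Nonempty Sphere2 := nontrivial_sphere2.to_nonempty
  have hS : (insert (π x₀) F).Finite := hbc.finiteBranch.insert _
  have hFS : F ⊆ insert (π x₀) F := Set.subset_insert _ _
  have hpre := hbc.finite_preimage hS
  refine ⟨hbc.finite_preimage hbc.finiteBranch, ?_⟩
  have hsum : ∑ y ∈ hpre.toFinset, e y = (insert (π x₀) F).ncard * d := by
    rw [← Finset.sum_fiberwise_of_maps_to (g := π) (t := hS.toFinset)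
      fun y hy => hS.mem_toFinset.2 (hpre.mem_toFinset.1 hy)]
    rw [Finset.sum_congr rfl fun p hp => ?_, Finset.sum_const, smul_eq_mul,
      ← Set.ncard_eq_toFinset_card _ hS]
    rw [← hbc.sum_fiber p]
    refine Finset.sum_congr (Finset.ext fun y => ?_) fun _ _ => rfl
    simp only [Finset.mem_filter, Set.Finite.mem_toFinset, Set.mem_preimage, Set.mem_singleton_iff]
    exact ⟨fun h => h.2, fun h => ⟨h ▸ hS.mem_toFinset.1 hp, h⟩⟩
  have hχ := hbc.two_sub_ncard_preimage hS hFS ⟨x₀, Set.mem_insert _ _⟩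
  rw [Finset.sum_subset (Set.Finite.toFinset_mono (Set.preimage_mono hFS)
    (ht := hpre)) fun y _ hy => ?_, Finset.sum_sub_distrib, Finset.sum_const, nsmul_one,
    ← Nat.cast_sum, hsum, ← Set.ncard_eq_toFinset_card _ hpre]
  · push_cast
    linarith
  · rw [hbc.ram_eq_one y fun h => hy ((Set.Finite.mem_toFinset _).2 h)]
    simp
end

section
/- Let U₁, …, U_n (n ≥ 1) be pairwise disjoint nonempty open subsets of the 2-sphere 𝕊², each connected, simply connected and different from 𝕊². Then the complement 𝕊² ∖ (U₁ ∪ ⋯ ∪ U_n) is nonempty and connected. -/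
open Set

/-- There is no continuous branch of `log (z - c)` on any circle centred at `c`. -/
theorem not_exists_continuous_log_on_circle {L : ℂ → ℂ} (hL : Continuous L) {c : ℂ} {r : ℝ}
    (hr : 0 < r) : ¬ ∀ z, ‖z - c‖ = r → Complex.exp (L z) = z - c := by
  intro h
  let k : ℝ → ℂ := fun t ↦ L (c + r * Complex.exp (t * Complex.I)) - t * Complex.I
  have hk : Continuous k := by fun_prop
  have hexp (t : ℝ) : Complex.exp (k t) = r := by
    have hz := h (c + r * Complex.exp (t * Complex.I)) (by
      simp [Complex.norm_exp_ofReal_mul_I, abs_of_pos hr])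
    simp only [k, Complex.exp_sub, hz, add_sub_cancel_left]
    exact mul_div_cancel_right₀ _ (Complex.exp_ne_zero _)
  have hint (t : ℝ) : ∃ n : ℤ, (k t).im - (k 0).im = n * (2 * Real.pi) := by
    obtain ⟨n, hn⟩ := Complex.exp_eq_exp_iff_exists_int.1 ((hexp t).trans (hexp 0).symm)
    exact ⟨n, by rw [hn]; simp⟩
  have hend : (k (2 * Real.pi)).im - (k 0).im = -(2 * Real.pi) := by simp [k]
  have hpi := Real.pi_pos
  obtain ⟨t, -, ht⟩ : -Real.pi ∈ (fun t ↦ (k t).im - (k 0).im) '' Icc 0 (2 * Real.pi) := by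
    apply intermediate_value_Icc' (by positivity) (by fun_prop)
    constructor
    · rw [hend]; linarith
    · simpa using hpi.le
  obtain ⟨n, hn⟩ := hint t
  have hn' : (n : ℝ) * 2 = -1 := by
    apply mul_right_cancel₀ hpi.ne'
    simp only at ht
    linarith
  have : n * 2 = -1 := by exact_mod_cast hn'
  omega

/-- A nonvanishing continuous function on the plane cannot coincide with `z - c` on a circle
centred at `c`. -/
theorem not_eq_sub_on_circle_of_forall_ne_zero {G : ℂ → ℂ} (hG : Continuous G)
    (hG₀ : ∀ z, G z ≠ 0) {c : ℂ} {r : ℝ} (hr : 0 < r) : ¬ ∀ z, ‖z - c‖ = r → G z = z - c := by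
  intro h
  have hsc : IsSimplyConnected (univ : Set ℂ) :=
    (Homeomorph.Set.univ ℂ).toHomotopyEquiv.simplyConnectedSpace
  obtain ⟨L, hL, hLG⟩ := Complex.exists_continuousOn_eqOn_exp_comp hsc isOpen_univ
    hG.continuousOn (by simpa using hG₀)
  exact not_exists_continuous_log_on_circle (continuousOn_univ.1 hL) hr
    fun z hz ↦ (hLG (mem_univ z)).trans (h z hz)

/-- If a continuous function `φ` on the plane satisfies `φ c = 0` and `φ > 2 / 3` on a circle
centred at `c`, then `z - c` has no continuous logarithm on an open set containing
`{z | 1 / 3 ≤ φ z ≤ 2 / 3}`. -/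
theorem not_exists_continuousOn_log_sub {φ : ℂ → ℝ} (hφ : Continuous φ) {c : ℂ} {r : ℝ}
    (hr : 0 < r) (hc : φ c = 0) (hφr : ∀ z, ‖z - c‖ = r → 2 / 3 < φ z) {W : Set ℂ}
    (hW : IsOpen W) (hφW : φ ⁻¹' Icc (1 / 3) (2 / 3) ⊆ W) {f : ℂ → ℂ} (hf : ContinuousOn f W) :
    ¬ ∀ z ∈ W, Complex.exp (f z) = z - c := by
  classical
  intro hexp
  let ψ : ℂ → ℝ := fun z ↦ max 0 (min 1 (3 * φ z - 1))
  have hψ : Continuous ψ := by fun_prop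
  let G : ℂ → ℂ := fun z ↦
    if φ z < 1 / 3 then 1 else if 2 / 3 < φ z then z - c else Complex.exp (ψ z * f z)
  have hlow {z : ℂ} (h : φ z < 1 / 3) : G z = 1 := by simp only [G, if_pos h]
  have hhigh {z : ℂ} (h : 2 / 3 < φ z) : G z = z - c := by
    simp only [G, if_pos h, if_neg (show ¬ φ z < 1 / 3 by linarith)]
  have hmid {z : ℂ} (h : z ∈ W) : G z = Complex.exp (ψ z * f z) := by
    by_cases h₁ : φ z < 1 / 3
    · have : ψ z = 0 := max_eq_left ((min_le_right _ _).trans (by linarith))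
      simp [hlow h₁, this]
    by_cases h₂ : 2 / 3 < φ z
    · have : ψ z = 1 := by
        simp only [ψ]
        rw [min_eq_left (by linarith), max_eq_right zero_le_one]
      simp [hhigh h₂, this, hexp z h]
    · simp only [G, if_neg h₁, if_neg h₂]
  have hG : Continuous G := by
    rw [continuous_iff_continuousAt]
    intro z
    by_cases h₁ : φ z < 1 / 3
    · refine (continuousAt_const (y := (1 : ℂ))).congr ?_
      filter_upwards [hφ.continuousAt.eventually_lt continuousAt_const h₁] with w hw
      exact (hlow hw).symm
    by_cases h₂ : 2 / 3 < φ z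
    · refine (show ContinuousAt (fun w ↦ w - c) z by fun_prop).congr ?_
      filter_upwards [continuousAt_const.eventually_lt hφ.continuousAt h₂] with w hw
      exact (hhigh hw).symm
    · have hz : z ∈ W := hφW ⟨not_lt.1 h₁, not_lt.1 h₂⟩
      have hfz : ContinuousAt f z := hf.continuousAt (hW.mem_nhds hz)
      refine (show ContinuousAt (fun w ↦ Complex.exp (ψ w * f w)) z by fun_prop).congr ?_
      filter_upwards [hW.mem_nhds hz] with w hw
      exact (hmid hw).symm
  have hG₀ (z : ℂ) : G z ≠ 0 := by
    by_cases h₁ : φ z < 1 / 3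
    · simp [hlow h₁]
    by_cases h₂ : 2 / 3 < φ z
    · rw [hhigh h₂, sub_ne_zero]
      rintro rfl
      linarith
    · rw [hmid (hφW ⟨not_lt.1 h₁, not_lt.1 h₂⟩)]
      exact Complex.exp_ne_zero _
  exact not_eq_sub_on_circle_of_forall_ne_zero hG hG₀ hr fun z hz ↦ hhigh (hφr z hz)

namespace Sphere2

instance : Fact (Module.finrank ℝ (EuclideanSpace ℝ (Fin 3)) = 2 + 1) := ⟨by simp⟩

instance : LocallyPathConnectedSpace Sphere2 :=
  ChartedSpace.locallyPathConnectedSpace (EuclideanSpace ℝ (Fin 2)) Sphere2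

instance : PreconnectedSpace Sphere2 :=
  Subtype.preconnectedSpace <| isPreconnected_sphere (by simp [← Module.finrank_eq_rank]) _ _

/-- Stereographic projection from a point of the sphere, as a map to the complex plane. -/
theorem exists_openPartialHomeomorph_complex (b : Sphere2) :
    ∃ e : OpenPartialHomeomorph Sphere2 ℂ, e.source = {b}ᶜ ∧ e.target = univ :=
  ⟨(stereographic' 2 b).trans
    Complex.orthonormalBasisOneI.repr.symm.toHomeomorph.toOpenPartialHomeomorph,
    by simp, by simp⟩

/-- If every nonvanishing continuous function on an open subset of the sphere has a continuous
logarithm, then the complement of this set is preconnected. -/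
theorem isPreconnected_compl_of_exists_log {W : Set Sphere2} (hW : IsOpen W)
    (hlog : ∀ g : Sphere2 → ℂ, ContinuousOn g W → (∀ x ∈ W, g x ≠ 0) →
      ∃ f : Sphere2 → ℂ, ContinuousOn f W ∧ ∀ x ∈ W, Complex.exp (f x) = g x) :
    IsPreconnected Wᶜ := by
  rw [isPreconnected_closed_iff]
  rintro s t hs ht hst ⟨a, haW, has⟩ ⟨b, hbW, hbt⟩
  by_contra hempty
  have hdisj : Disjoint (Wᶜ ∩ s) (Wᶜ ∩ t) := by
    rw [disjoint_iff_inter_eq_empty, ← inter_inter_distrib_left]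
    exact not_nonempty_iff_eq_empty.1 hempty
  obtain ⟨φ, hφs, hφt, -⟩ := exists_continuous_zero_one_of_isClosed
    (hW.isClosed_compl.inter hs) (hW.isClosed_compl.inter ht) hdisj
  have hφa : φ a = 0 := hφs ⟨haW, has⟩
  have hφb : φ b = 1 := hφt ⟨hbW, hbt⟩
  have hab : a ≠ b := by rintro rfl; norm_num [hφa] at hφb
  obtain ⟨e, hsource, htarget⟩ := exists_openPartialHomeomorph_complex b
  have hae : a ∈ e.source := by simpa [hsource] using hab
  have hWe : W ⊆ e.source := fun x hx ↦ by
    rw [hsource]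
    rintro rfl
    exact hbW hx
  have hsymm : Continuous e.symm := by
    rw [← continuousOn_univ, ← htarget]
    exact e.continuousOn_symm
  have hright (z : ℂ) : e (e.symm z) = z := e.right_inv (by simp [htarget])
  obtain ⟨f, hf, hfexp⟩ := hlog (fun x ↦ e x - e a)
    ((e.continuousOn.mono hWe).sub continuousOn_const) (fun x hx ↦ by
      rw [sub_ne_zero]
      intro h
      exact haW (e.injOn (hWe hx) hae h ▸ hx))
  have hcompact : IsCompact (e '' {x | φ x ≤ 2 / 3}) := by
    refine (isClosed_le φ.continuous continuous_const).isCompact.image_of_continuousOn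
      (e.continuousOn.mono fun x hx ↦ ?_)
    rw [hsource]
    rintro rfl
    norm_num [hφb] at hx
  obtain ⟨r, hr, hball⟩ := hcompact.isBounded.subset_ball_lt 0 (e a)
  refine not_exists_continuousOn_log_sub (φ := φ ∘ e.symm) (c := e a) (W := e.symm ⁻¹' W)
    (f := f ∘ e.symm) (φ.continuous.comp hsymm) hr (by simp [e.left_inv hae, hφa]) ?_
    (hW.preimage hsymm) ?_ (hf.comp hsymm.continuousOn fun _ h ↦ h) ?_
  · intro z hz
    by_contra! hle
    have := hball ⟨e.symm z, hle, hright z⟩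
    rw [mem_ball_iff_norm, hz] at this
    exact this.false
  · rintro z ⟨h₁, h₂⟩
    by_contra hzW
    simp only [Function.comp_apply] at h₁ h₂
    rcases hst hzW with h | h
    · norm_num [show φ (e.symm z) = 0 from hφs ⟨hzW, h⟩] at h₁
    · norm_num [show φ (e.symm z) = 1 from hφt ⟨hzW, h⟩] at h₂
  · intro z hz
    simpa only [Function.comp_apply, hright] using hfexp _ hz

end Sphere2

/-- A nonvanishing continuous function on a union of pairwise disjoint simply connected open sets
has a continuous logarithm. -/
theorem exists_continuousOn_log_iUnion {X ι : Type*} [TopologicalSpace X]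
    [LocallyPathConnectedSpace X] {U : ι → Set X} (hopen : ∀ i, IsOpen (U i))
    (hsc : ∀ i, IsSimplyConnected (U i)) (hdisj : Pairwise (fun i j ↦ Disjoint (U i) (U j)))
    {g : X → ℂ} (hg : ContinuousOn g (⋃ i, U i)) (hg₀ : ∀ x ∈ ⋃ i, U i, g x ≠ 0) :
    ∃ f : X → ℂ, ContinuousOn f (⋃ i, U i) ∧ ∀ x ∈ ⋃ i, U i, Complex.exp (f x) = g x := by
  classical
  choose f hf hfexp using fun i ↦ Complex.exists_continuousOn_eqOn_exp_comp (hsc i) (hopen i)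
    (hg.mono (subset_iUnion U i)) (by
      rintro ⟨x, hx, h⟩
      exact hg₀ x (mem_iUnion_of_mem i hx) h)
  let F : X → ℂ := fun x ↦ if h : ∃ i, x ∈ U i then f h.choose x else 0
  have hF (i : ι) : EqOn F (f i) (U i) := by
    intro x hx
    have h : ∃ i, x ∈ U i := ⟨i, hx⟩
    have hi : h.choose = i := by
      by_contra hne
      exact disjoint_left.1 (hdisj hne) h.choose_spec hx
    simp only [F, dif_pos h, hi]
  refine ⟨F, ContinuousOn.iUnion_of_isOpen (fun i ↦ (hf i).congr (hF i)) hopen, fun x hx ↦ ?_⟩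
  obtain ⟨i, hi⟩ := mem_iUnion.1 hx
  rw [hF i hi]
  exact hfexp i hi

/-- In a preconnected space, pairwise disjoint nonempty open proper subsets do not cover. -/
theorem nonempty_compl_iUnion_of_isOpen {X ι : Type*} [TopologicalSpace X] [PreconnectedSpace X]
    [Nonempty ι] {U : ι → Set X} (hopen : ∀ i, IsOpen (U i)) (hne : ∀ i, (U i).Nonempty)
    (hproper : ∀ i, U i ≠ univ) (hdisj : Pairwise (fun i j ↦ Disjoint (U i) (U j))) :
    ((⋃ i, U i)ᶜ).Nonempty := by
  rw [nonempty_compl]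
  intro hcover
  obtain ⟨i⟩ := ‹Nonempty ι›
  have hcompl : (U i)ᶜ = ⋃ j, ⋃ _ : j ≠ i, U j := by
    ext x
    simp only [mem_compl_iff, mem_iUnion, exists_prop]
    constructor
    · intro hx
      obtain ⟨j, hj⟩ := mem_iUnion.1 (hcover ▸ mem_univ x)
      exact ⟨j, fun h ↦ hx (h ▸ hj), hj⟩
    · rintro ⟨j, hji, hj⟩
      exact disjoint_left.1 (hdisj hji) hj
  have hclosed : IsClosed (U i) := by
    rw [← isOpen_compl_iff, hcompl]
    exact isOpen_iUnion fun j ↦ isOpen_iUnion fun _ ↦ hopen j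
  exact hproper i (IsClopen.eq_univ ⟨hclosed, hopen i⟩ (hne i))

/-- The complement of a finite union of pairwise disjoint, nonempty, open, connected,
simply connected proper subsets of the 2-sphere is nonempty and connected. -/
theorem compl_union_simplyConnected_isConnected (n : ℕ) (hn : 1 ≤ n)
    (U : Fin n → Set Sphere2)
    (hopen : ∀ i, IsOpen (U i)) (hne : ∀ i, (U i).Nonempty)
    (hconn : ∀ i, IsConnected (U i)) (hsc : ∀ i, SimplyConnectedSpace ↥(U i))
    (hproper : ∀ i, U i ≠ Set.univ)
    (hdisj : Pairwise (fun i j => Disjoint (U i) (U j))) :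
    IsConnected ((⋃ i, U i)ᶜ) := by
  have : Nonempty (Fin n) := ⟨⟨0, hn⟩⟩
  exact ⟨nonempty_compl_iUnion_of_isOpen hopen hne hproper hdisj,
    Sphere2.isPreconnected_compl_of_exists_log (isOpen_iUnion hopen) fun _ hg hg₀ ↦
      exists_continuousOn_log_iUnion hopen hsc hdisj hg hg₀⟩
end

section
/- Let π : 𝕊² → 𝕊² be a branched covering of degree d with finite branch set F and ramification numbers e, and let U ⊆ 𝕊² be an open simply connected subset with U ≠ 𝕊² that contains at most one critical value of π. Then the preimage π⁻¹(𝕊² ∖ U) is nonempty and connected. -/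
open Set Filter Topology Metric ComplexConjugate

/-- The automorphism of the unit disc taking `a` to `0`. -/
noncomputable def discShift (a w : ℂ) : ℂ := (w - a) / (1 - conj a * w)

lemma discShift_denom_ne_zero {a w : ℂ} (ha : ‖a‖ < 1) (hw : ‖w‖ < 1) :
    1 - conj a * w ≠ 0 := by
  intro h
  have h1 : ‖conj a * w‖ = 1 := by rw [← sub_eq_zero.mp h, norm_one]
  rw [norm_mul, RCLike.norm_conj] at h1
  nlinarith [norm_nonneg a, norm_nonneg w]

lemma one_sub_norm_sq_discShift {a w : ℂ} (ha : ‖a‖ < 1) (hw : ‖w‖ < 1) :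
    1 - ‖discShift a w‖ ^ 2 =
      (1 - ‖a‖ ^ 2) * (1 - ‖w‖ ^ 2) / ‖1 - conj a * w‖ ^ 2 := by
  have h0 : ‖1 - conj a * w‖ ^ 2 ≠ 0 :=
    pow_ne_zero _ (norm_ne_zero_iff.mpr (discShift_denom_ne_zero ha hw))
  rw [discShift, norm_div, div_pow, eq_div_iff h0, sub_mul, div_mul_cancel₀ _ h0]
  simp only [← Complex.normSq_eq_norm_sq, Complex.normSq_apply]
  simp
  ring

lemma norm_discShift_lt_one {a w : ℂ} (ha : ‖a‖ < 1) (hw : ‖w‖ < 1) :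
    ‖discShift a w‖ < 1 := by
  have h := one_sub_norm_sq_discShift ha hw
  have h0 : 0 < ‖1 - conj a * w‖ := norm_pos_iff.mpr (discShift_denom_ne_zero ha hw)
  have : 0 < (1 - ‖a‖ ^ 2) * (1 - ‖w‖ ^ 2) / ‖1 - conj a * w‖ ^ 2 := by
    have h1 : 0 < 1 - ‖a‖ ^ 2 := by nlinarith [norm_nonneg a]
    have h2 : 0 < 1 - ‖w‖ ^ 2 := by nlinarith [norm_nonneg w]
    positivity
  nlinarith [norm_nonneg (discShift a w)]

lemma one_sub_norm_sq_discShift_ge {a w : ℂ} (ha : ‖a‖ < 1) (hw : ‖w‖ < 1) :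
    (1 - ‖a‖ ^ 2) * (1 - ‖w‖ ^ 2) / 4 ≤ 1 - ‖discShift a w‖ ^ 2 := by
  rw [one_sub_norm_sq_discShift ha hw]
  have h0 : 0 < ‖1 - conj a * w‖ := norm_pos_iff.mpr (discShift_denom_ne_zero ha hw)
  have h1 : 0 < 1 - ‖a‖ ^ 2 := by nlinarith [norm_nonneg a]
  have h2 : 0 < 1 - ‖w‖ ^ 2 := by nlinarith [norm_nonneg w]
  have h3 : ‖1 - conj a * w‖ ≤ 2 := by
    refine (norm_sub_le _ _).trans ?_
    rw [norm_one, norm_mul, RCLike.norm_conj]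
    nlinarith [norm_nonneg a, norm_nonneg w]
  gcongr
  nlinarith

lemma discShift_neg_discShift {a w : ℂ} (ha : ‖a‖ < 1) (hw : ‖w‖ < 1) :
    discShift (-a) (discShift a w) = w := by
  have h0 := discShift_denom_ne_zero ha hw
  have h1 : 1 - conj a * a ≠ 0 := discShift_denom_ne_zero ha ha
  have h2 : 1 - conj (-a) * discShift a w ≠ 0 :=
    discShift_denom_ne_zero (by simpa using ha) (norm_discShift_lt_one ha hw)
  rw [discShift, div_eq_iff h2, discShift, map_neg]
  generalize conj a = k at *
  have h0' : 1 - w * k ≠ 0 := by rwa [mul_comm]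
  field_simp
  ring

lemma discShift_discShift_neg {a w : ℂ} (ha : ‖a‖ < 1) (hw : ‖w‖ < 1) :
    discShift a (discShift (-a) w) = w := by
  simpa using discShift_neg_discShift (a := -a) (by simpa using ha) hw

@[simp] lemma discShift_self (a : ℂ) : discShift a a = 0 := by simp [discShift]

@[simp] lemma discShift_zero_right (a : ℂ) : discShift a 0 = -a := by simp [discShift]

lemma injOn_discShift {a : ℂ} (ha : ‖a‖ < 1) : InjOn (discShift a) (ball 0 1) := by
  intro x hx y hy h
  rw [mem_ball_zero_iff] at hx hy
  rw [← discShift_neg_discShift ha hx, h, discShift_neg_discShift ha hy]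

lemma differentiableOn_discShift {a : ℂ} (ha : ‖a‖ < 1) :
    DifferentiableOn ℂ (discShift a) (ball 0 1) := by
  unfold discShift
  refine DifferentiableOn.div (by fun_prop) (by fun_prop) fun w hw ↦ ?_
  exact discShift_denom_ne_zero ha (by simpa using hw)

/-- Explicit form of the degree two Blaschke product obtained by conjugating the squaring map. -/
lemma discShift_sq_discShift {c w : ℂ} (hc : ‖c‖ < 1) (hw : ‖w‖ < 1) :
    discShift (c ^ 2) (discShift (-c) w ^ 2) =
      w * discShift (-(2 * c / (1 + conj c * c))) w := by
  have hc' : ‖-c‖ < 1 := by simpa using hc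
  have h0 : 1 + conj c * w ≠ 0 := by simpa using discShift_denom_ne_zero hc' hw
  have h1 : 1 - conj c * c ≠ 0 := discShift_denom_ne_zero hc hc
  have h2 : 1 + conj c * c ≠ 0 := by simpa using discShift_denom_ne_zero hc' hc
  have hm : ‖discShift (-c) w ^ 2‖ < 1 := by
    rw [norm_pow]
    exact pow_lt_one₀ (norm_nonneg _) (norm_discShift_lt_one hc' hw) two_ne_zero
  have hcc : ‖c ^ 2‖ < 1 := by
    rw [norm_pow]; exact pow_lt_one₀ (norm_nonneg _) hc two_ne_zero
  have h3 := discShift_denom_ne_zero hcc hm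
  have h4 : 1 + conj c * c + 2 * conj c * w ≠ 0 := by
    intro h
    apply h3
    have : discShift (-c) w = (w + c) / (1 + conj c * w) := by simp [discShift]
    rw [this, map_pow]
    field_simp
    linear_combination (1 - conj c * c) * h
  have e1 : discShift (-(2 * c / (1 + conj c * c))) w =
      (w * (1 + conj c * c) + 2 * c) / (1 + conj c * c + 2 * conj c * w) := by
    have hden : 1 - conj (-(2 * c / (1 + conj c * c))) * w =
        (1 + conj c * c + 2 * conj c * w) / (1 + conj c * c) := by
      have : 1 + c * conj c ≠ 0 := by rwa [mul_comm c]
      simp only [map_neg, map_div₀, map_mul, map_add, map_one, Complex.conj_conj,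
        map_ofNat]
      field_simp
      ring
    rw [discShift, hden, div_div_eq_mul_div, sub_neg_eq_add, add_mul, div_mul_cancel₀ _ h2]
  rw [e1, discShift, div_eq_iff h3]
  have : discShift (-c) w = (w + c) / (1 + conj c * w) := by simp [discShift]
  rw [this, map_pow]
  generalize conj c = k at *
  have h0' : 1 + w * k ≠ 0 := by rwa [mul_comm]
  rw [mul_div_assoc', div_mul_eq_mul_div, eq_div_iff h4]
  field_simp
  ring

/-- A uniform contraction estimate for the Blaschke products of `discShift_sq_discShift`. -/
lemma norm_discShift_sq_discShift_le {c w : ℂ} {s : ℝ} (hs : s < 1) (hc : ‖c‖ ^ 2 ≤ s)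
    (hw : ‖w‖ ≤ s) :
    ‖discShift (c ^ 2) (discShift (-c) w ^ 2)‖ ≤
      ‖w‖ * √(1 - (1 - s) ^ 2 * (1 - s ^ 2) / 16) := by
  have hc1 : ‖c‖ < 1 := by nlinarith [norm_nonneg c]
  have hs0 : 0 ≤ s := (norm_nonneg w).trans hw
  have hw1 : ‖w‖ < 1 := hw.trans_lt hs
  set b : ℂ := 2 * c / (1 + conj c * c) with hb
  have hcc : (1 + conj c * c : ℂ) = ((1 + ‖c‖ ^ 2 : ℝ) : ℂ) := by
    push_cast; rw [Complex.conj_mul']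
  have hnb : ‖b‖ = 2 * ‖c‖ / (1 + ‖c‖ ^ 2) := by
    rw [hb, hcc, norm_div, norm_mul, Complex.norm_real, Complex.norm_ofNat,
      Real.norm_of_nonneg (by positivity)]
  have hb2 : (1 - s) ^ 2 / 4 ≤ 1 - ‖b‖ ^ 2 := by
    have : 1 - ‖b‖ ^ 2 = (1 - ‖c‖ ^ 2) ^ 2 / (1 + ‖c‖ ^ 2) ^ 2 := by
      rw [hnb]; field_simp; ring
    rw [this]
    have h1 : 0 ≤ 1 - s := by linarith
    have h2 : 1 + ‖c‖ ^ 2 ≤ 2 := by linarith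
    gcongr
    nlinarith [norm_nonneg c]
  have hb1 : ‖b‖ < 1 := by
    have : 0 < (1 - s) ^ 2 / 4 := by have : 0 < 1 - s := by linarith
                                     positivity
    nlinarith [norm_nonneg b]
  rw [discShift_sq_discShift hc1 hw1, norm_mul]
  gcongr
  apply Real.le_sqrt_of_sq_le
  have := one_sub_norm_sq_discShift_ge (a := -b) (by simpa using hb1) hw1
  rw [norm_neg] at this
  have h5 : (1 - s) ^ 2 / 4 * (1 - s ^ 2) ≤ (1 - ‖b‖ ^ 2) * (1 - ‖w‖ ^ 2) := by
    gcongr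
    · nlinarith
    · nlinarith [norm_nonneg b]
  linarith

/-- Injective holomorphic maps from `U` to the open unit disc that vanish at `p`. -/
structure IsUnivalentToDisc (U : Set ℂ) (p : ℂ) (f : ℂ → ℂ) : Prop where
  differentiableOn : DifferentiableOn ℂ f U
  injOn : InjOn f U
  mapsTo : MapsTo f U (ball 0 1)
  map_base : f p = 0

/-- A continuous square root of a nonvanishing holomorphic function is holomorphic. -/
lemma DifferentiableOn.of_sq_eq {U : Set ℂ} (hU : IsOpen U) {g F : ℂ → ℂ}
    (hF : DifferentiableOn ℂ F U) (hg : ContinuousOn g U) (hgF : ∀ z ∈ U, g z ^ 2 = F z)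
    (hF0 : ∀ z ∈ U, F z ≠ 0) : DifferentiableOn ℂ g U := by
  intro z hz
  have hg0 : ∀ w ∈ U, g w ≠ 0 := fun w hw h ↦ hF0 w hw (by rw [← hgF w hw, h]; simp)
  have hd := (hF.differentiableAt (hU.mem_nhds hz)).hasDerivAt
  have hc : ContinuousAt g z := hg.continuousAt (hU.mem_nhds hz)
  have hsum : Tendsto (fun w ↦ g w + g z) (𝓝[≠] z) (𝓝 (g z + g z)) :=
    (hc.tendsto.mono_left nhdsWithin_le_nhds).add_const _
  have h2 : g z + g z ≠ 0 := by
    rw [← two_mul]; exact mul_ne_zero two_ne_zero (hg0 z hz)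
  have hlim := (hasDerivAt_iff_tendsto_slope.mp hd).div hsum h2
  refine (hasDerivAt_iff_tendsto_slope.mpr (hlim.congr' ?_)).differentiableAt.differentiableWithinAt
  filter_upwards [hsum.eventually_ne h2, nhdsWithin_le_nhds (hU.mem_nhds hz),
    self_mem_nhdsWithin] with w hw hwU hwz
  have hwz' : w - z ≠ 0 := sub_ne_zero.mpr hwz
  simp only [Pi.div_apply, slope_def_field, ← hgF w hwU, ← hgF z hz]
  field_simp
  ring

/-- An injective holomorphic function on a connected open set is an open embedding. -/
lemma DifferentiableOn.exists_openPartialHomeomorph {U : Set ℂ} (hU : IsOpen U)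
    (hUc : IsPreconnected U) {f : ℂ → ℂ} (hf : DifferentiableOn ℂ f U) (hinj : InjOn f U) :
    ∃ Φ : OpenPartialHomeomorph ℂ ℂ, Φ.source = U ∧ Φ.target = f '' U ∧ ⇑Φ = f := by
  have hopen : ∀ s ⊆ U, IsOpen s → IsOpen (f '' s) := by
    rcases (hf.analyticOnNhd hU).is_constant_or_isOpen hUc with ⟨w, hw⟩ | h
    · rcases U.eq_empty_or_nonempty with rfl | ⟨z, hz⟩
      · intro s hs _
        simp [subset_empty_iff.mp hs]
      · exfalso
        obtain ⟨y, hyU, hyz⟩ : ∃ y ∈ U, y ≠ z := by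
          have : (𝓝[≠] z).NeBot := inferInstance
          obtain ⟨y, hy, hyz⟩ := ((eventually_nhdsWithin_of_eventually_nhds
            (hU.mem_nhds hz)).and self_mem_nhdsWithin).exists (f := 𝓝[≠] z)
          exact ⟨y, hy, hyz⟩
        exact hyz (hinj hyU hz ((hw y hyU).trans (hw z hz).symm))
    · exact h
  refine ⟨OpenPartialHomeomorph.ofContinuousOpenRestrict (hinj.toPartialEquiv f U)
    hf.continuousOn ?_ hU, rfl, rfl, rfl⟩
  intro s hs
  have := hopen (Subtype.val '' s) (by rintro _ ⟨x, _, rfl⟩; exact x.2)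
    (hU.isOpenMap_subtype_val s hs)
  rwa [image_image] at this

/-- The square root step in the construction of the Riemann map. -/
lemma IsUnivalentToDisc.exists_improved {U : Set ℂ} (hU : IsOpen U) (hUs : IsSimplyConnected U)
    {p : ℂ} (hp : p ∈ U) {f : ℂ → ℂ} (hf : IsUnivalentToDisc U p f) {r s : ℝ}
    (hr0 : 0 < r) (hs0 : 0 < s) (hs : s < 1) (hr : ball 0 r ⊆ f '' U) {q : ℝ}
    (hq : q = √(1 - (1 - s) ^ 2 * (1 - s ^ 2) / 16)) (hq0 : 0 < q) :
    ∃ k, IsUnivalentToDisc U p k ∧ ball 0 (min s (r / q)) ⊆ k '' U := by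
  by_cases hsf : ball 0 s ⊆ f '' U
  · exact ⟨f, hf, (ball_subset_ball (min_le_left _ _)).trans hsf⟩
  obtain ⟨a, has, ha⟩ := not_subset.mp hsf
  rw [mem_ball_zero_iff] at has
  have ha1 : ‖a‖ < 1 := has.trans hs
  have hfn : ∀ z ∈ U, ‖f z‖ < 1 := fun z hz ↦ by simpa using hf.mapsTo hz
  have hFd : DifferentiableOn ℂ (fun z ↦ discShift a (f z)) U :=
    (differentiableOn_discShift ha1).comp hf.differentiableOn hf.mapsTo
  have hF0 : ∀ z ∈ U, discShift a (f z) ≠ 0 := by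
    intro z hz h
    refine ha ⟨z, hz, injOn_discShift ha1 (hf.mapsTo hz) (by simpa using ha1) ?_⟩
    rw [h, discShift_self]
  obtain ⟨g, hgc, hg⟩ := Complex.exists_continuousOn_pow_eq hUs hU hFd.continuousOn
    (by rintro ⟨z, hz, h⟩; exact hF0 z hz h) two_ne_zero
  have hgd : DifferentiableOn ℂ g U := hFd.of_sq_eq hU hgc (fun z _ ↦ hg z) hF0
  have hgn : ∀ z ∈ U, ‖g z‖ < 1 := by
    intro z hz
    have h1 := norm_discShift_lt_one ha1 (hfn z hz)
    rw [← hg z, norm_pow] at h1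
    nlinarith [norm_nonneg (g z)]
  have hgm : MapsTo g U (ball 0 1) := fun z hz ↦ by simpa using hgn z hz
  have hginj : InjOn g U := by
    intro x hx y hy hxy
    refine hf.injOn hx hy (injOn_discShift ha1 (hf.mapsTo hx) (hf.mapsTo hy) ?_)
    rw [← hg x, ← hg y, hxy]
  set c := g p with hc
  have hc1 : ‖c‖ < 1 := hgn p hp
  have hc1' : ‖-c‖ < 1 := by simpa using hc1
  have hc2 : c ^ 2 = -a := by rw [hc, hg p, hf.map_base, discShift_zero_right]
  have hk : IsUnivalentToDisc U p (fun z ↦ discShift c (g z)) :=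
    { differentiableOn := (differentiableOn_discShift hc1).comp hgd hgm
      injOn := (injOn_discShift hc1).comp hginj hgm
      mapsTo := fun z hz ↦ by simpa using norm_discShift_lt_one hc1 (hgn z hz)
      map_base := discShift_self c }
  refine ⟨_, hk, ?_⟩
  obtain ⟨Φ, hΦs, hΦt, hΦ⟩ := hf.differentiableOn.exists_openPartialHomeomorph hU
    hUs.isPathConnected.isConnected.isPreconnected hf.injOn
  set B := ball (0 : ℂ) (min s (r / q)) with hB
  let ψ : ℂ → ℂ := fun w ↦ discShift (c ^ 2) (discShift (-c) w ^ 2)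
  have hBs : ∀ w ∈ B, ‖w‖ < s := fun w hw ↦ by
    rw [hB, mem_ball_zero_iff] at hw; exact hw.trans_le (min_le_left _ _)
  have hB1 : ∀ w ∈ B, ‖w‖ < 1 := fun w hw ↦ (hBs w hw).trans hs
  have hBball : B ⊆ ball 0 1 := fun w hw ↦ by simpa using hB1 w hw
  have hM1 : ∀ w ∈ B, ‖discShift (-c) w ^ 2‖ < 1 := fun w hw ↦ by
    rw [norm_pow]
    exact pow_lt_one₀ (norm_nonneg _) (norm_discShift_lt_one hc1' (hB1 w hw)) two_ne_zero
  have hcn : ‖c‖ ^ 2 = ‖a‖ := by rw [← norm_pow, hc2, norm_neg]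
  have hcc : ‖c ^ 2‖ < 1 := by rw [norm_pow, hcn]; exact ha1
  have hψ : MapsTo ψ B Φ.target := by
    intro w hw
    rw [hΦt]
    apply hr
    rw [mem_ball_zero_iff]
    have h1 := norm_discShift_sq_discShift_le hs (c := c) (by rw [hcn]; exact has.le)
      (hBs w hw).le
    rw [← hq] at h1
    rw [hB, mem_ball_zero_iff] at hw
    have h2 : ‖w‖ < r / q := hw.trans_le (min_le_right _ _)
    exact h1.trans_lt ((lt_div_iff₀ hq0).mp h2)
  have hMc : ContinuousOn (discShift (-c)) B :=
    (differentiableOn_discShift hc1').continuousOn.mono hBball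
  have hψc : ContinuousOn ψ B :=
    (differentiableOn_discShift hcc).continuousOn.comp (hMc.pow 2)
      fun w hw ↦ by simpa using hM1 w hw
  have hsymm : ∀ w ∈ B, Φ.symm (ψ w) ∈ U := fun w hw ↦ hΦs ▸ Φ.map_target (hψ hw)
  have hGc : ContinuousOn (fun w ↦ g (Φ.symm (ψ w))) B :=
    hgc.comp (Φ.continuousOn_symm.comp hψc hψ) hsymm
  have hfsymm : ∀ w ∈ B, f (Φ.symm (ψ w)) = ψ w := fun w hw ↦ by
    rw [← hΦ]; exact Φ.right_inv (hψ hw)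
  have hsq : ∀ w ∈ B, g (Φ.symm (ψ w)) ^ 2 = discShift (-c) w ^ 2 := by
    intro w hw
    rw [hg, hfsymm w hw]
    have h := discShift_neg_discShift hcc (hM1 w hw)
    rwa [hc2, neg_neg, ← hc2] at h
  have h0B : (0 : ℂ) ∈ B := by
    rw [hB]; exact mem_ball_self (by positivity)
  have hψ0 : ψ 0 = 0 := by simp [ψ]
  have hsymm0 : Φ.symm 0 = p := by
    rw [← hf.map_base, ← hΦ]; exact Φ.left_inv (hΦs ▸ hp)
  have heq : EqOn (fun w ↦ g (Φ.symm (ψ w))) (discShift (-c)) B := by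
    refine IsPreconnected.eq_of_sq_eq (convex_ball _ _).isPreconnected hGc hMc
      (fun w hw ↦ hsq w hw) (fun {w} hw h ↦ ?_) h0B ?_
    · have h1 := hsq w hw
      rw [h, hg] at h1
      exact hF0 _ (hsymm w hw) (by simpa using h1)
    · simp [hψ0, hsymm0, hc]
  intro w hw
  refine ⟨Φ.symm (ψ w), hsymm w hw, ?_⟩
  have h1 := heq hw
  simp only at h1 ⊢
  rw [h1, discShift_discShift_neg hc1 (hB1 w hw)]

lemma exists_isUnivalentToDisc {U : Set ℂ} (hU : IsOpen U) (hUs : IsSimplyConnected U)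
    (hne : U ≠ univ) {p : ℂ} (hp : p ∈ U) : ∃ f, IsUnivalentToDisc U p f := by
  obtain ⟨a, ha⟩ := (ne_univ_iff_exists_notMem U).mp hne
  have hF0 : ∀ z ∈ U, z - a ≠ 0 := fun z hz h ↦ ha (sub_eq_zero.mp h ▸ hz)
  obtain ⟨g, hgc, hg⟩ := Complex.exists_continuousOn_pow_eq (g := fun z ↦ z - a) hUs hU
    (by fun_prop) (by rintro ⟨z, hz, h⟩; exact hF0 z hz h) two_ne_zero
  have hgd : DifferentiableOn ℂ g U := DifferentiableOn.of_sq_eq (F := fun z ↦ z - a) hU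
    (by fun_prop) hgc (fun z _ ↦ hg z) hF0
  have hg0 : ∀ z ∈ U, g z ≠ 0 := fun z hz h ↦ hF0 z hz (by rw [← hg z, h]; simp)
  have hinj : ∀ x y, g x ^ 2 = g y ^ 2 → x = y := by
    intro x y h
    rw [hg, hg] at h
    exact sub_left_injective h
  have hginj : InjOn g U := fun x _ y _ h ↦ hinj x y (by rw [h])
  obtain ⟨Φ, hΦs, hΦt, hΦ⟩ := hgd.exists_openPartialHomeomorph hU
    hUs.isPathConnected.isConnected.isPreconnected hginj
  have hopen : IsOpen (g '' U) := hΦt ▸ Φ.open_target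
  obtain ⟨ε, hε0, hε⟩ := Metric.isOpen_iff.mp hopen (g p) (mem_image_of_mem g hp)
  have hfar : ∀ z ∈ U, ε ≤ ‖g z + g p‖ := by
    intro z hz
    by_contra! h
    obtain ⟨b, hb, hbz⟩ := hε (show -g z ∈ ball (g p) ε by
      rwa [mem_ball, dist_eq_norm, ← norm_neg, neg_sub, sub_neg_eq_add, add_comm])
    obtain rfl : b = z := hinj b z (by rw [hbz]; ring)
    exact hg0 b hb (self_eq_neg.mp hbz)
  have hne0 : ∀ z ∈ U, g z + g p ≠ 0 := fun z hz ↦ norm_pos_iff.mp (hε0.trans_le (hfar z hz))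
  let f : ℂ → ℂ := fun z ↦ (ε / 2 : ℂ) / (g z + g p)
  have hfn : ∀ z ∈ U, ‖f z‖ < 1 := by
    intro z hz
    have h1 := hfar z hz
    have h2 : ‖(ε / 2 : ℂ)‖ = ε / 2 := by simp [abs_of_pos hε0]
    rw [norm_div, h2, div_lt_one (hε0.trans_le h1)]
    linarith
  have hm : MapsTo f U (ball 0 1) := fun z hz ↦ by simpa using hfn z hz
  have hdf : DifferentiableOn ℂ f U :=
    (differentiableOn_const _).div (hgd.add_const _) hne0
  have hi : InjOn f U := by
    intro x hx y hy hxy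
    refine hginj hx hy ?_
    have hε' : (ε / 2 : ℂ) ≠ 0 := by simpa using hε0.ne'
    simp only [f] at hxy
    rw [div_eq_div_iff (hne0 x hx) (hne0 y hy)] at hxy
    exact (add_right_cancel (mul_left_cancel₀ hε' hxy)).symm
  have hp1 : ‖f p‖ < 1 := hfn p hp
  exact ⟨fun z ↦ discShift (f p) (f z),
    (differentiableOn_discShift hp1).comp hdf hm, (injOn_discShift hp1).comp hi hm,
    fun z hz ↦ by simpa using norm_discShift_lt_one hp1 (hfn z hz), discShift_self _⟩

/-- The images of univalent maps to the disc can be made to contain any smaller disc. -/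
lemma exists_isUnivalentToDisc_ball_subset {U : Set ℂ} (hU : IsOpen U)
    (hUs : IsSimplyConnected U) (hne : U ≠ univ) {p : ℂ} (hp : p ∈ U) {s : ℝ}
    (hs0 : 0 < s) (hs : s < 1) : ∃ f, IsUnivalentToDisc U p f ∧ ball 0 s ⊆ f '' U := by
  obtain ⟨f, hf⟩ := exists_isUnivalentToDisc hU hUs hne hp
  obtain ⟨Φ, hΦs, hΦt, hΦ⟩ := hf.differentiableOn.exists_openPartialHomeomorph hU
    hUs.isPathConnected.isConnected.isPreconnected hf.injOn
  have hopen : IsOpen (f '' U) := hΦt ▸ Φ.open_target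
  obtain ⟨r, hr0, hr⟩ := Metric.isOpen_iff.mp hopen 0 ⟨p, hp, hf.map_base⟩
  set q := √(1 - (1 - s) ^ 2 * (1 - s ^ 2) / 16) with hq
  have h1 : 0 < (1 - s) ^ 2 * (1 - s ^ 2) / 16 := by
    have h2 : 0 < 1 - s := by linarith
    have h3 : 0 < 1 - s ^ 2 := by nlinarith
    positivity
  have h2 : (1 - s) ^ 2 * (1 - s ^ 2) / 16 < 1 := by
    have h3 : (1 - s) ^ 2 ≤ 1 := by nlinarith
    have h4 : 1 - s ^ 2 ≤ 1 := by nlinarith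
    have h5 : 0 ≤ 1 - s ^ 2 := by nlinarith
    nlinarith [sq_nonneg (1 - s)]
  have hq0 : 0 < q := Real.sqrt_pos.mpr (by linarith)
  have hq1 : q < 1 := by
    rw [hq, Real.sqrt_lt' one_pos]; linarith
  have key : ∀ n : ℕ, ∃ k, IsUnivalentToDisc U p k ∧ ball 0 (min s (r / q ^ n)) ⊆ k '' U := by
    intro n
    induction n with
    | zero => exact ⟨f, hf, (ball_subset_ball (by simp)).trans hr⟩
    | succ n ih =>
      obtain ⟨k, hk, hkb⟩ := ih
      obtain ⟨k', hk', hkb'⟩ := hk.exists_improved hU hUs hp (by positivity) hs0 hs hkb hq hq0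
      refine ⟨k', hk', (ball_subset_ball ?_).trans hkb'⟩
      rw [pow_succ, ← div_div]
      refine le_min (min_le_left _ _) ?_
      rw [le_div_iff₀ hq0]
      refine le_min ?_ ?_
      · calc min s (r / q ^ n / q) * q ≤ s * 1 := by
              gcongr; exact min_le_left _ _
          _ = s := mul_one s
      · rw [← le_div_iff₀ hq0]; exact min_le_right _ _
  obtain ⟨n, hn⟩ := exists_pow_lt_of_lt_one (div_pos hr0 hs0) hq1
  obtain ⟨k, hk, hkb⟩ := key n
  refine ⟨k, hk, (ball_subset_ball (le_min le_rfl ?_)).trans hkb⟩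
  rw [le_div_iff₀ (by positivity), mul_comm]
  exact ((lt_div_iff₀ hs0).mp hn).le

/-- A Harnack type inequality for maps to the disc. -/
lemma IsUnivalentToDisc.one_sub_norm_sq_le {U : Set ℂ} {p : ℂ} {f : ℂ → ℂ}
    (hf : IsUnivalentToDisc U p f) {z w : ℂ} {R : ℝ} (hR : 0 < R) (hball : ball z R ⊆ U)
    (hw : dist w z ≤ 2 / 3 * R) : (1 - ‖f z‖ ^ 2) / 8 ≤ 1 - ‖f w‖ ^ 2 := by
  have hfn : ∀ x ∈ ball z R, ‖f x‖ < 1 := fun x hx ↦ by simpa using hf.mapsTo (hball hx)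
  have hz1 : ‖f z‖ < 1 := hfn z (mem_ball_self hR)
  have hwb : w ∈ ball z R := by rw [mem_ball]; linarith
  have hw1 : ‖f w‖ < 1 := hfn w hwb
  have hS := Complex.dist_le_div_mul_dist_of_mapsTo_ball (f := fun x ↦ discShift (f z) (f x))
    (c := z) (R₁ := R) (R₂ := 1) (z := w)
    ((differentiableOn_discShift hz1).comp (hf.differentiableOn.mono hball)
      (hf.mapsTo.mono_left hball))
    (fun x hx ↦ by simpa using (norm_discShift_lt_one hz1 (hfn x hx)).le) hwb
  simp only [discShift_self, dist_zero_right] at hS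
  have hm : ‖discShift (f z) (f w)‖ ≤ 2 / 3 := by
    refine hS.trans ?_
    rw [one_div, ← div_eq_inv_mul, div_le_iff₀ hR]
    exact hw
  have hge := one_sub_norm_sq_discShift_ge (a := -f z) (w := discShift (f z) (f w))
    (by simpa using hz1) (norm_discShift_lt_one hz1 hw1)
  rw [discShift_neg_discShift hz1 hw1, norm_neg] at hge
  have h1 : ‖discShift (f z) (f w)‖ ^ 2 ≤ 4 / 9 := by
    nlinarith [norm_nonneg (discShift (f z) (f w))]
  have h2 : 0 < 1 - ‖f z‖ ^ 2 := by nlinarith [norm_nonneg (f z)]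
  nlinarith

/-- On a compact set, normalised maps to the disc stay uniformly away from the boundary. -/
lemma exists_forall_isUnivalentToDisc_norm_lt {U : Set ℂ} (hU : IsOpen U)
    (hUc : IsPreconnected U) {p : ℂ} (hp : p ∈ U) {C : Set ℂ} (hC : IsCompact C) (hCU : C ⊆ U) :
    ∃ s, 0 < s ∧ s < 1 ∧ ∀ f, IsUnivalentToDisc U p f → ∀ z ∈ C, ‖f z‖ < s := by
  let G : Set ℂ := {z | ∃ ε : ℝ, 0 < ε ∧
    ∀ᶠ w in 𝓝 z, ∀ f, IsUnivalentToDisc U p f → ε ≤ 1 - ‖f w‖ ^ 2}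
  have step : ∀ z ∈ U, ∀ R > 0, ball z R ⊆ U → ∀ x ∈ ball z (R / 4), ∀ ε > 0,
      (∀ f, IsUnivalentToDisc U p f → ε ≤ 1 - ‖f x‖ ^ 2) → z ∈ G := by
    intro z _ R hR hball x hx ε hε hbd
    refine ⟨ε / 8, by positivity, ?_⟩
    filter_upwards [ball_mem_nhds z (show 0 < R / 4 by positivity)] with w hw f hf
    have hxR : ball x (3 / 4 * R) ⊆ U := by
      refine (ball_subset_ball' ?_).trans hball
      rw [mem_ball] at hx
      linarith
    refine le_trans ?_ (hf.one_sub_norm_sq_le (by positivity) hxR (w := w) ?_)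
    · linarith [hbd f hf]
    · rw [mem_ball] at hx hw
      linarith [dist_triangle_right w x z]
  have hGo : IsOpen G := by
    rw [isOpen_iff_mem_nhds]
    rintro z ⟨ε, hε, h⟩
    filter_upwards [eventually_eventually_nhds.mpr h] with w hw
    exact ⟨ε, hε, hw⟩
  have hpG : p ∈ G := by
    obtain ⟨R, hR, hball⟩ := Metric.isOpen_iff.mp hU p hp
    exact step p hp R hR hball p (mem_ball_self (by positivity)) 1 one_pos
      fun f hf ↦ by simp [hf.map_base]
  have hUG : U ⊆ G := by
    refine hUc.subset_of_closure_inter_subset hGo ⟨p, hp, hpG⟩ ?_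
    rintro z ⟨hzG, hzU⟩
    obtain ⟨R, hR, hball⟩ := Metric.isOpen_iff.mp hU z hzU
    obtain ⟨x, hxG, hx⟩ := Metric.mem_closure_iff.mp hzG (R / 4) (by positivity)
    obtain ⟨ε, hε, h⟩ := hxG
    exact step z hzU R hR hball x (by rwa [mem_ball, dist_comm]) ε hε h.self_of_nhds
  obtain ⟨ε, hε, hεC⟩ : ∃ ε : ℝ, 0 < ε ∧
      ∀ z ∈ C, ∀ f, IsUnivalentToDisc U p f → ε ≤ 1 - ‖f z‖ ^ 2 := by
    refine hC.induction_on (p := fun s ↦ ∃ ε : ℝ, 0 < ε ∧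
      ∀ z ∈ s, ∀ f, IsUnivalentToDisc U p f → ε ≤ 1 - ‖f z‖ ^ 2) ⟨1, one_pos, by simp⟩ ?_ ?_ ?_
    · rintro s t hst ⟨ε, hε, h⟩
      exact ⟨ε, hε, fun z hz ↦ h z (hst hz)⟩
    · rintro s t ⟨ε, hε, h⟩ ⟨δ, hδ, h'⟩
      refine ⟨min ε δ, lt_min hε hδ, ?_⟩
      rintro z (hz | hz) f hf
      · exact (min_le_left _ _).trans (h z hz f hf)
      · exact (min_le_right _ _).trans (h' z hz f hf)
    · intro z hz
      obtain ⟨ε, hε, h⟩ := hUG (hCU hz)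
      exact ⟨_, mem_nhdsWithin_of_mem_nhds h, ε, hε, fun w hw ↦ hw⟩
  set δ := min ε (1 / 2) with hδ
  have hδ0 : 0 < δ := lt_min hε (by norm_num)
  have hδ1 : δ ≤ 1 / 2 := min_le_right _ _
  refine ⟨1 - δ / 4, by linarith, by linarith, fun f hf z hz ↦ ?_⟩
  have h1 : δ ≤ 1 - ‖f z‖ ^ 2 := (min_le_left _ _).trans (hεC z hz f hf)
  nlinarith [norm_nonneg (f z)]

/-- A compact subset of a simply connected plane domain lies in the preimage of a smaller
concentric disc under a homeomorphism from an open subset of the domain onto a disc. -/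
lemma IsSimplyConnected.exists_openPartialHomeomorph_ball {U : Set ℂ} (hU : IsOpen U)
    (hUs : IsSimplyConnected U) {p : ℂ} (hp : p ∈ U) {C : Set ℂ} (hC : IsCompact C)
    (hCU : C ⊆ U) :
    ∃ (Φ : OpenPartialHomeomorph ℂ ℂ) (s r : ℝ), 0 < s ∧ s < r ∧ Φ.source ⊆ U ∧ p ∈ Φ.source ∧
      Φ p = 0 ∧ C ⊆ Φ.source ∧ Φ.target = ball 0 r ∧ ∀ z ∈ C, ‖Φ z‖ < s := by
  have restrict : ∀ (Ψ : OpenPartialHomeomorph ℂ ℂ) (s r : ℝ), 0 < s → s < r →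
      Ψ.source = U → Ψ p = 0 → ball 0 r ⊆ Ψ.target → (∀ z ∈ C, ‖Ψ z‖ < s) →
      ∃ (Φ : OpenPartialHomeomorph ℂ ℂ) (s r : ℝ), 0 < s ∧ s < r ∧ Φ.source ⊆ U ∧
      p ∈ Φ.source ∧ Φ p = 0 ∧ C ⊆ Φ.source ∧ Φ.target = ball 0 r ∧ ∀ z ∈ C, ‖Φ z‖ < s := by
    intro Ψ s r hs hsr hΨs hΨp hΨt hΨC
    refine ⟨(Ψ.symm.restrOpen (ball 0 r) isOpen_ball).symm, s, r, hs, hsr, ?_, ?_, hΨp, ?_, ?_,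
      hΨC⟩
    · exact fun z hz ↦ hΨs ▸ hz.1
    · exact ⟨hΨs.ge hp, by simpa [hΨp] using hs.trans hsr⟩
    · exact fun z hz ↦ ⟨hΨs.ge (hCU hz), by simpa using (hΨC z hz).trans hsr⟩
    · simpa [inter_comm] using hΨt
  by_cases hne : U = univ
  · obtain ⟨s, hs⟩ := hC.exists_bound_of_continuousOn (f := fun z ↦ z - p) (by fun_prop)
    refine restrict (Homeomorph.subRight p).toOpenPartialHomeomorph (|s| + 1) (|s| + 2)
      (by positivity) (by linarith) (by simp [hne]) (by simp) (by simp) fun z hz ↦ ?_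
    have h1 := hs z hz
    have h2 := le_abs_self s
    simp only [Homeomorph.toOpenPartialHomeomorph_apply, Homeomorph.subRight_apply]
    linarith
  · have hUc := hUs.isPathConnected.isConnected.isPreconnected
    obtain ⟨s, hs0, hs1, hs⟩ := exists_forall_isUnivalentToDisc_norm_lt hU hUc hp hC hCU
    obtain ⟨f, hf, hfb⟩ := exists_isUnivalentToDisc_ball_subset hU hUs hne hp
      (s := (s + 1) / 2) (by linarith) (by linarith)
    obtain ⟨Ψ, hΨs, hΨt, rfl⟩ := hf.differentiableOn.exists_openPartialHomeomorph hU hUc hf.injOn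
    exact restrict Ψ s _ hs0 (by linarith) hΨs hf.map_base (hΨt ▸ hfb) (hs _ hf)

open scoped unitInterval in
/-- Pushing points of a covering of a punctured disc radially outwards. -/
lemma IsCoveringMapOn.exists_radial_retraction {X Y : Type*} [TopologicalSpace X]
    [TopologicalSpace Y] {π : X → Y} {p : Y} (Φ : OpenPartialHomeomorph Y ℂ) {ρ r : ℝ}
    (hρr : ρ < r) (hp : p ∈ Φ.source) (hΦp : Φ p = 0) (ht : Φ.target = ball 0 r)
    (hcov : IsCoveringMapOn π (Φ.source \ {p})) :
    ∃ f : π ⁻¹' (Φ.source \ {p}) → X, Continuous f ∧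
      (∀ y, π (f y) ∈ Φ.source ∧ ρ ≤ ‖Φ (π (f y))‖) ∧
      ∀ y : π ⁻¹' (Φ.source \ {p}), ρ ≤ ‖Φ (π y)‖ → f y = y := by
  set S := Φ.source \ {p} with hS
  have hc := hcov.isCoveringMap_restrictPreimage
  have hπ : Continuous (S.restrictPreimage π) := hc.continuous
  have hz : ∀ y : S, Φ y ≠ 0 := fun y h ↦
    y.2.2 (Φ.injOn y.2.1 hp (h.trans hΦp.symm))
  have hzr : ∀ y : S, ‖Φ y‖ < r := fun y ↦ by
    have := Φ.map_source y.2.1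
    rwa [ht, mem_ball_zero_iff] at this
  let k : I × S → ℝ := fun ty ↦ max 1 ((1 - ty.1) + ty.1 * (ρ / ‖Φ ty.2‖))
  let w : I × S → ℂ := fun ty ↦ k ty * Φ ty.2
  have hk0 : ∀ ty, 0 < k ty := fun ty ↦ one_pos.trans_le (le_max_left _ _)
  have hwn : ∀ ty : I × S, ‖w ty‖ = max ‖Φ ty.2‖ ((1 - ty.1) * ‖Φ ty.2‖ + ty.1 * ρ) := by
    intro ty
    have h0 : 0 < ‖Φ ty.2‖ := norm_pos_iff.mpr (hz ty.2)
    rw [norm_mul, Complex.norm_real, Real.norm_of_nonneg (hk0 ty).le, max_mul_of_nonneg _ _ h0.le,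
      one_mul]
    congr 1
    field_simp
  have hw0 : ∀ ty, w ty ≠ 0 := fun ty ↦
    mul_ne_zero (Complex.ofReal_ne_zero.mpr (hk0 ty).ne') (hz ty.2)
  have hwt : ∀ ty, w ty ∈ Φ.target := by
    intro ty
    rw [ht, mem_ball_zero_iff, hwn]
    refine max_lt (hzr _) ?_
    have h0 := ty.1.2.1
    have h1 := ty.1.2.2
    have h2 := hzr ty.2
    rcases h0.eq_or_lt with h0 | h0
    · rw [← h0]; simpa using h2
    · nlinarith
  have hΦc : Continuous fun y : S ↦ Φ y :=
    continuousOn_iff_continuous_domRestrict.mp (Φ.continuousOn.mono sdiff_subset)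
  have hwc : Continuous w := by
    have h1 : Continuous fun ty : I × S ↦ Φ ty.2 := hΦc.comp continuous_snd
    have h2 : Continuous fun ty : I × S ↦ ρ / ‖Φ ty.2‖ :=
      continuous_const.div h1.norm fun ty ↦ norm_ne_zero_iff.mpr (hz _)
    have h3 : Continuous k := by unfold k; fun_prop
    exact (Complex.continuous_ofReal.comp h3).mul h1
  have hmem : ∀ ty, Φ.symm (w ty) ∈ S := fun ty ↦ by
    refine ⟨Φ.map_target (hwt ty), fun h ↦ hw0 ty ?_⟩
    rw [← Φ.right_inv (hwt ty), mem_singleton_iff.mp h, hΦp]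
  let H₀ : C(I × S, S) := ⟨fun ty ↦ ⟨Φ.symm (w ty), hmem ty⟩,
    (Φ.continuousOn_symm.comp_continuous hwc hwt).subtype_mk _⟩
  have hH₀ : ∀ ty, k ty = 1 → H₀ ty = ty.2 := by
    intro ty h
    refine Subtype.ext ?_
    change Φ.symm (w ty) = ty.2
    simp only [w, h, Complex.ofReal_one, one_mul]
    exact Φ.left_inv ty.2.2.1
  let H : C(I × (π ⁻¹' S), S) := ⟨fun ty ↦ H₀ (ty.1, S.restrictPreimage π ty.2), by fun_prop⟩
  have hH0 : ∀ y, H (0, y) = S.restrictPreimage π (ContinuousMap.id _ y) := fun y ↦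
    hH₀ (0, S.restrictPreimage π y) (by simp [k])
  have hlift := hc.liftHomotopy_lifts H (.id _) hH0
  refine ⟨fun y ↦ hc.liftHomotopy H (.id _) hH0 (1, y), by fun_prop, fun y ↦ ?_, fun y hy ↦ ?_⟩
  · have h1 : π (hc.liftHomotopy H (.id _) hH0 (1, y)) = Φ.symm (w (1, S.restrictPreimage π y)) :=
      congrArg Subtype.val (congrFun hlift (1, y))
    rw [h1, Φ.right_inv (hwt _), hwn]
    exact ⟨Φ.map_target (hwt _), by simp⟩
  · have hH : ∀ t, H (t, y) = S.restrictPreimage π y := by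
      intro t
      refine hH₀ (t, S.restrictPreimage π y) (max_eq_left ?_)
      have h0 : 0 < ‖Φ (π y)‖ := norm_pos_iff.mpr (hz (S.restrictPreimage π y))
      have h1 : ρ / ‖Φ (π y)‖ ≤ 1 := (div_le_one h0).mpr hy
      have h2 := t.2.1
      change (1 - (t : ℝ)) + t * (ρ / ‖Φ (π y)‖) ≤ 1
      nlinarith
    have hconst := hc.const_of_comp (g := fun t ↦ hc.liftHomotopy H (.id _) hH0 (t, y))
      (by fun_prop) (fun t t' ↦ ((congrFun hlift (t, y)).trans (hH t)).trans
        ((congrFun hlift (t', y)).trans (hH t')).symm) 1 0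
    exact congrArg Subtype.val (hconst.trans (hc.liftHomotopy_zero H (.id _) hH0 y))

/-- The preimage of the complement of a set exhausted by discs is connected if the map is a
covering over the punctured set and the complement of the fibre over the puncture is connected. -/
lemma isPreconnected_preimage_compl_of_isCoveringMapOn {X Y : Type*} [TopologicalSpace X]
    [CompactSpace X] [T2Space X] [TopologicalSpace Y] [T2Space Y] {π : X → Y} (hπ : Continuous π)
    {U : Set Y} (hU : IsOpen U) {p : Y} (hpU : p ∈ U) (hcov : IsCoveringMapOn π (U \ {p}))
    (hconn : IsPreconnected (π ⁻¹' {p})ᶜ)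
    (hexh : ∀ C ⊆ U, IsCompact C → ∃ (Φ : OpenPartialHomeomorph Y ℂ) (s r : ℝ), 0 < s ∧ s < r ∧
      Φ.source ⊆ U ∧ p ∈ Φ.source ∧ Φ p = 0 ∧ C ⊆ Φ.source ∧ Φ.target = ball 0 r ∧
      ∀ z ∈ C, ‖Φ z‖ < s) :
    IsPreconnected (π ⁻¹' Uᶜ) := by
  rw [isPreconnected_iff_subset_of_fully_disjoint_closed (hU.isClosed_compl.preimage hπ)]
  intro u v hu hv huv hdisj
  by_contra! hcon
  obtain ⟨⟨b, hbK, hbu⟩, ⟨a, haK, hav⟩⟩ := And.imp not_subset.mp not_subset.mp hcon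
  have hau : a ∈ u := (huv haK).resolve_right hav
  have hbv : b ∈ v := (huv hbK).resolve_left hbu
  obtain ⟨A, B, hA, hB, huA, hvB, hAB⟩ := normal_separation hu hv hdisj
  have hCc : IsCompact (π '' (A ∪ B)ᶜ) := (hA.union hB).isClosed_compl.isCompact.image hπ
  have hCU : π '' (A ∪ B)ᶜ ⊆ U := by
    rintro _ ⟨x, hx, rfl⟩
    by_contra h
    exact hx (Or.imp (@huA x) (@hvB x) (huv h))
  obtain ⟨Φ, s, r, hs0, hsr, hΦU, hpΦ, hΦp, hCΦ, ht, hΦC⟩ := hexh _ hCU hCc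
  have hAB' : ∀ x, s ≤ ‖Φ (π x)‖ → x ∈ A ∪ B := by
    intro x hx
    by_contra h
    exact absurd hx (hΦC _ ⟨x, h, rfl⟩).not_ge
  obtain ⟨f, hfc, hf, hfid⟩ := IsCoveringMapOn.exists_radial_retraction Φ hsr hpΦ hΦp ht
    fun x hx ↦ hcov x ⟨hΦU hx.1, hx.2⟩
  have hL : IsClosed (Φ.symm '' closedBall 0 s) := by
    refine ((isCompact_closedBall 0 s).image_of_continuousOn (Φ.continuousOn_symm.mono ?_)).isClosed
    rw [ht]
    exact closedBall_subset_ball hsr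
  have hE : IsOpen (π ⁻¹' (Φ.source \ {p})) :=
    (Φ.open_source.sdiff isClosed_singleton).preimage hπ
  let P : Set X → Set X := fun O ↦
    O ∩ π ⁻¹' (Φ.symm '' closedBall 0 s)ᶜ ∪ Subtype.val '' (f ⁻¹' O)
  have hP : ∀ O, IsOpen O → IsOpen (P O) := fun O hO ↦
    (hO.inter (hL.isOpen_compl.preimage hπ)).union
      (hE.isOpenMap_subtype_val _ (hO.preimage hfc))
  have hid : ∀ y : π ⁻¹' (Φ.source \ {p}), π y ∉ Φ.symm '' closedBall 0 s → f y = y := by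
    intro y hy
    refine hfid y (le_of_not_gt fun h ↦ hy ⟨Φ (π y), ?_, Φ.left_inv y.2.1⟩)
    simpa using h.le
  have hPdisj : Disjoint (P A) (P B) := by
    rw [Set.disjoint_left] at hAB ⊢
    rintro x (⟨hx, hx'⟩ | ⟨y, hy, rfl⟩) (⟨hxB, hxB'⟩ | ⟨y', hy', hyy⟩)
    · exact hAB hx hxB
    · subst hyy
      rw [mem_preimage, hid y' hx'] at hy'
      exact hAB hx hy'
    · rw [mem_preimage, hid y hxB'] at hy
      exact hAB hy hxB
    · rw [Subtype.ext hyy] at hy'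
      exact hAB hy hy'
  have hLΦ : Φ.symm '' closedBall 0 s ⊆ Φ.source := by
    rintro _ ⟨z, hz, rfl⟩
    exact Φ.map_target (ht ▸ closedBall_subset_ball hsr hz)
  have hcover : (π ⁻¹' {p})ᶜ ⊆ P A ∪ P B := by
    intro x hx
    by_cases hxΦ : π x ∈ Φ.source
    · have := hAB' (f ⟨x, hxΦ, hx⟩) (hf _).2
      exact this.imp (fun h ↦ .inr ⟨_, h, rfl⟩) fun h ↦ .inr ⟨_, h, rfl⟩
    · have hxC : x ∈ A ∪ B := by
        by_contra h
        exact hxΦ (hCΦ ⟨x, h, rfl⟩)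
      exact hxC.imp (fun h ↦ .inl ⟨h, fun h' ↦ hxΦ (hLΦ h')⟩)
        fun h ↦ .inl ⟨h, fun h' ↦ hxΦ (hLΦ h')⟩
  have hmem : ∀ x ∈ π ⁻¹' Uᶜ, x ∈ (π ⁻¹' {p})ᶜ ∧ π x ∉ Φ.symm '' closedBall 0 s := fun x hx ↦
    ⟨fun h ↦ hx (mem_singleton_iff.mp h ▸ hpU), fun h ↦ hx (hΦU (hLΦ h))⟩
  obtain ⟨x, -, hxA, hxB⟩ := hconn (P A) (P B) (hP A hA) (hP B hB) hcover
    ⟨a, (hmem a haK).1, .inl ⟨huA hau, (hmem a haK).2⟩⟩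
    ⟨b, (hmem b hbK).1, .inl ⟨hvB hbv, (hmem b hbK).2⟩⟩
  exact Set.disjoint_left.mp hPdisj hxA hxB

/-- The complement of a countable subset of the sphere is connected. -/
lemma Sphere2.isPreconnected_compl_of_countable {S : Set Sphere2} (hS : S.Countable) :
    IsPreconnected Sᶜ := by
  have hrank : 1 < Module.rank ℝ (EuclideanSpace ℝ (Fin 3)) := by
    rw [← Module.finrank_eq_rank, finrank_euclideanSpace_fin]; norm_num
  rcases S.eq_empty_or_nonempty with rfl | ⟨v, hv⟩
  · rw [compl_empty]
    have := isPreconnected_iff_preconnectedSpace.mp (isPreconnected_sphere hrank 0 1)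
    exact isPreconnected_univ
  · have : Fact (Module.finrank ℝ (EuclideanSpace ℝ (Fin 3)) = 2 + 1) := ⟨by simp⟩
    let σ := stereographic' 2 v
    have hσt : σ.target = univ := stereographic'_target v
    have hσs : σ.source = {v}ᶜ := stereographic'_source v
    have hrank2 : 1 < Module.rank ℝ (EuclideanSpace ℝ (Fin 2)) := by
      rw [← Module.finrank_eq_rank, finrank_euclideanSpace_fin]; norm_num
    have hconn := ((hS.mono sdiff_subset).image σ).isConnected_compl_of_one_lt_rank hrank2
      (s := σ '' (S \ {v}))
    convert hconn.isPreconnected.image σ.symm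
      (σ.continuousOn_symm.mono (hσt ▸ subset_univ _)) using 1
    ext x
    constructor
    · intro hx
      have hxs : x ∈ σ.source := by
        rw [hσs]
        rintro rfl
        exact hx hv
      refine ⟨σ x, ?_, σ.left_inv hxs⟩
      rintro ⟨y, hy, hyx⟩
      exact hx (σ.injOn (hσs ▸ hy.2) hxs hyx ▸ hy.1)
    · rintro ⟨w, hw, rfl⟩ hx
      have hwt : w ∈ σ.target := hσt ▸ mem_univ w
      exact hw ⟨σ.symm w, ⟨hx, hσs.le (σ.map_target hwt)⟩, σ.right_inv hwt⟩

namespace IsBranchedCovering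

variable {d : ℕ} {π : Sphere2 → Sphere2} {F : Set Sphere2} {e : Sphere2 → ℕ}

lemma isLocalHomeomorphOn_compl (hbc : IsBranchedCovering d π F e) :
    IsLocalHomeomorphOn π (π ⁻¹' Fᶜ) := by
  have hF : IsOpen Fᶜ := hbc.finiteBranch.isClosed.isOpen_compl
  exact (IsCoveringMapOn.of_isCoveringMap_restrictPreimage _ hF (hF.preimage hbc.continuous)
    hbc.covering).isLocalHomeomorphOn

lemma isLocalHomeomorphOn (hbc : IsBranchedCovering d π F e) :
    IsLocalHomeomorphOn π {y | e y ≤ 1} := by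
  rw [isLocalHomeomorphOn_iff_isOpenEmbedding_restrict]
  intro y hy
  by_cases hyF : π y ∈ F
  · obtain ⟨he1, U, V, hUo, hVo, hyU, hyV, hmaps, h, g, -, -, hgh⟩ := hbc.ram y hyF
    refine ⟨U, hUo.mem_nhds hyU, ?_⟩
    have heq : U.domRestrict π = Subtype.val ∘ g.symm ∘ h := by
      ext1 z
      have hz : g ⟨π z, hmaps z.2⟩ = h z := Subtype.ext (by
        rw [hgh z z.2, le_antisymm hy he1, pow_one])
      simp [← hz]
    rw [heq]
    exact hVo.isOpenEmbedding_subtypeVal.comp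
      (g.symm.isOpenEmbedding.comp h.isOpenEmbedding)
  · exact (isLocalHomeomorphOn_iff_isOpenEmbedding_restrict _).mp
      hbc.isLocalHomeomorphOn_compl y hyF

lemma eventually_ne (hbc : IsBranchedCovering d π F e) (y : Sphere2) :
    ∀ᶠ z in 𝓝[≠] y, π z ≠ π y := by
  rw [eventually_nhdsWithin_iff]
  by_cases hyF : π y ∈ F
  · obtain ⟨he1, U, V, hUo, hVo, hyU, hyV, hmaps, h, g, hhy, hgy, hgh⟩ := hbc.ram y hyF
    filter_upwards [hUo.mem_nhds hyU] with z hz hzy heq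
    have h1 : (h ⟨z, hz⟩ : ℂ) ^ e y = 0 := by
      rw [← hgh z hz, ← hgy]
      congr 2
      exact Subtype.ext heq
    have h2 : h ⟨z, hz⟩ = h ⟨y, hyU⟩ := Subtype.ext (by
      rw [hhy, eq_zero_of_pow_eq_zero h1])
    exact hzy (congrArg Subtype.val (h.injective h2))
  · obtain ⟨φ, hφ, rfl⟩ := hbc.isLocalHomeomorphOn_compl y hyF
    filter_upwards [φ.open_source.mem_nhds hφ] with z hz hzy heq
    exact hzy (φ.injOn hz hφ heq)

lemma finite_preimage_singleton (hbc : IsBranchedCovering d π F e) (x : Sphere2) :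
    (π ⁻¹' {x}).Finite := by
  refine (isClosed_singleton.preimage hbc.continuous).isCompact.finite
    (isDiscrete_iff_nhdsNE.mpr fun y hy ↦ ?_)
  rw [inf_principal_eq_bot]
  filter_upwards [hbc.eventually_ne y] with z hz hzx
  exact hz (hzx.trans hy.symm)

lemma surjective (hbc : IsBranchedCovering d π F e) : Function.Surjective π := by
  have hrank : 1 < Module.rank ℝ (EuclideanSpace ℝ (Fin 3)) := by
    rw [← Module.finrank_eq_rank, finrank_euclideanSpace_fin]; norm_num
  have := isConnected_iff_connectedSpace.mp
    (isConnected_sphere hrank (0 : EuclideanSpace ℝ (Fin 3)) zero_le_one)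
  have hopen : IsOpen (range π) := by
    rw [isOpen_iff_mem_nhds]
    rintro _ ⟨y, rfl⟩
    by_cases hyF : π y ∈ F
    · obtain ⟨he1, U, V, hUo, hVo, hyU, hyV, hmaps, h, g, hhy, hgy, hgh⟩ := hbc.ram y hyF
      have he0 : e y ≠ 0 := by omega
      filter_upwards [hVo.mem_nhds hyV] with x hx
      obtain ⟨w, hw⟩ := IsAlgClosed.exists_pow_nat_eq (g ⟨x, hx⟩ : ℂ) (Nat.pos_of_ne_zero he0)
      have hw1 : w ∈ unitDisc := by
        have h1 : ‖w‖ ^ e y < 1 := by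
          rw [← norm_pow, hw]
          exact mem_ball_zero_iff.mp (g ⟨x, hx⟩).2
        simpa using (pow_lt_one_iff_of_nonneg (norm_nonneg w) he0).mp h1
      let z := h.symm ⟨w, hw1⟩
      refine ⟨z, ?_⟩
      have h2 : g ⟨π z, hmaps z.2⟩ = g ⟨x, hx⟩ := Subtype.ext (by
        rw [hgh z z.2, ← hw]; simp [z])
      exact congrArg Subtype.val (g.injective h2)
    · rw [← hbc.isLocalHomeomorphOn_compl.map_nhds_eq (x := y) hyF]
      exact range_mem_map
  rw [← range_eq_univ]
  exact IsClopen.eq_univ ⟨(isCompact_range hbc.continuous).isClosed, hopen⟩ (range_nonempty π)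

end IsBranchedCovering

/-- A compact subset of a simply connected proper open subset of the sphere lies in the preimage
of a smaller concentric disc under a chart whose image is a disc. -/
lemma Sphere2.exists_openPartialHomeomorph_ball {U : Set Sphere2} (hUo : IsOpen U)
    (hUs : IsSimplyConnected U) (hproper : U ≠ univ) {p : Sphere2} (hp : p ∈ U) {C : Set Sphere2}
    (hC : IsCompact C) (hCU : C ⊆ U) :
    ∃ (Φ : OpenPartialHomeomorph Sphere2 ℂ) (s r : ℝ), 0 < s ∧ s < r ∧ Φ.source ⊆ U ∧
      p ∈ Φ.source ∧ Φ p = 0 ∧ C ⊆ Φ.source ∧ Φ.target = ball 0 r ∧ ∀ z ∈ C, ‖Φ z‖ < s := by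
  obtain ⟨v, hv⟩ := (ne_univ_iff_exists_notMem U).mp hproper
  have : Fact (Module.finrank ℝ (EuclideanSpace ℝ (Fin 3)) = 2 + 1) := ⟨by simp⟩
  let σ : OpenPartialHomeomorph Sphere2 ℂ := (stereographic' 2 v).transHomeomorph
    Complex.orthonormalBasisOneI.repr.symm.toHomeomorph
  have hσs : σ.source = {v}ᶜ := stereographic'_source v
  have hσt : σ.target = univ := by simp [σ]
  have hUσ : U ⊆ σ.source := by
    rw [hσs]
    rintro x hx rfl
    exact hv hx
  have hUsc := hUs.simplyConnectedSpace
  have hσU : IsSimplyConnected (σ '' U) :=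
    (σ.homeomorphOfImageSubsetSource hUσ rfl).symm.toHomotopyEquiv.simplyConnectedSpace
  obtain ⟨Φ, s, r, hs0, hsr, hΦU, hpΦ, hΦp, hCΦ, ht, hΦC⟩ :=
    hσU.exists_openPartialHomeomorph_ball (σ.isOpen_image_of_subset_source hUo hUσ)
      (mem_image_of_mem σ hp) (hC.image_of_continuousOn (σ.continuousOn.mono (hCU.trans hUσ)))
      (image_mono hCU)
  refine ⟨σ.trans Φ, s, r, hs0, hsr, ?_, ⟨hUσ hp, hpΦ⟩, hΦp,
    fun z hz ↦ ⟨hUσ (hCU hz), hCΦ (mem_image_of_mem σ hz)⟩, ?_,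
    fun z hz ↦ hΦC _ (mem_image_of_mem σ hz)⟩
  · rintro z ⟨hz, hzΦ⟩
    obtain ⟨y, hy, hyz⟩ := hΦU hzΦ
    exact σ.injOn (hUσ hy) hz hyz ▸ hy
  · rw [OpenPartialHomeomorph.trans_target, hσt, preimage_univ, inter_univ, ht]

/-- If `U ⊊ 𝕊²` is an open simply connected set containing at most one critical value
of the branched covering `π`, then `π⁻¹(𝕊² ∖ U)` is nonempty and connected. -/
theorem preimage_compl_isConnected (d : ℕ) (π : Sphere2 → Sphere2) (F : Set Sphere2)
    (e : Sphere2 → ℕ) (hbc : IsBranchedCovering d π F e)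
    (U : Set Sphere2) (hUo : IsOpen U) (hsc : SimplyConnectedSpace ↥U)
    (hproper : U ≠ Set.univ)
    (hcv : (U ∩ (π '' {y : Sphere2 | 1 < e y})).Subsingleton) :
    IsConnected (π ⁻¹' Uᶜ) := by
  have hUs : IsSimplyConnected U := hsc
  obtain ⟨p, hpU, hp⟩ : ∃ p ∈ U, U ∩ π '' {y | 1 < e y} ⊆ {p} := by
    rcases (U ∩ π '' {y | 1 < e y}).eq_empty_or_nonempty with h | ⟨p, hp⟩
    · obtain ⟨p, hp⟩ := hUs.nonempty
      exact ⟨p, hp, h ▸ empty_subset _⟩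
    · exact ⟨p, hp.1, fun x hx ↦ hcv hx hp⟩
  have hcov : IsCoveringMapOn π (U \ {p}) := by
    refine .of_isLocalHomeomorphOn hbc.continuous (hbc.isLocalHomeomorphOn.mono ?_)
    intro y hy
    by_contra h
    have hlt : 1 < e y := not_le.mp h
    exact hy.2 (hp ⟨hy.1, y, hlt, rfl⟩)
  refine ⟨(nonempty_compl.mpr hproper).preimage hbc.surjective,
    isPreconnected_preimage_compl_of_isCoveringMapOn hbc.continuous hUo hpU hcov
      (Sphere2.isPreconnected_compl_of_countable (hbc.finite_preimage_singleton p).countable)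
      fun C hCU hC ↦ Sphere2.exists_openPartialHomeomorph_ball hUo hUs hproper hpU hC hCU⟩
end

section
/- Let d ≥ 2 and let l = (a_1, …, a_m) be a list of integers with 2 ≤ a_i ≤ d for every i and ∑_{i=1}^{m} (a_i − 1) = 2d − 2. Then there exists a branched covering π : 𝕊² → 𝕊² of degree d whose set of critical points consists of exactly m points y_1, …, y_m with ramification numbers e(y_i) = a_i for i = 1, …, m (Theorem C: every ramification distribution of degree d is realized by a branched covering of degree d). -/
namespace BranchedSphere

open Topology Filter Set

section Germs

variable {X Y : Type*} [TopologicalSpace X] [TopologicalSpace Y]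

/-- In suitable topological coordinates around `x` and `F x`, the map `F` is `z ↦ z ^ n`. -/
def IsPowerGerm (F : X → Y) (x : X) (n : ℕ) : Prop :=
  ∃ (i : ℂ → X) (j : ℂ → Y), IsOpenEmbedding i ∧ IsOpenEmbedding j ∧ i 0 = x ∧ j 0 = F x ∧
    ∀ᶠ z in 𝓝 (0 : ℂ), F (i z) = j (z ^ n)

theorem IsPowerGerm.congr {F G : X → Y} {x : X} {n : ℕ} (hF : IsPowerGerm F x n)
    (hFG : F =ᶠ[𝓝 x] G) : IsPowerGerm G x n := by
  obtain ⟨i, j, hi, hj, hi0, hj0, h⟩ := hF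
  refine ⟨i, j, hi, hj, hi0, hj0.trans hFG.eq_of_nhds, ?_⟩
  have hc : Tendsto i (𝓝 0) (𝓝 x) := hi0 ▸ hi.continuous.tendsto 0
  filter_upwards [h, hc.eventually hFG] with z hz hz'
  rw [← hz', hz]

theorem IsPowerGerm.conj {X' Y' : Type*} [TopologicalSpace X'] [TopologicalSpace Y']
    {F : X → Y} {n : ℕ} (σ : Y ≃ₜ Y') (τ : X' ≃ₜ X) {x : X'}
    (hF : IsPowerGerm F (τ x) n) : IsPowerGerm (σ ∘ F ∘ τ) x n := by
  obtain ⟨i, j, hi, hj, hi0, hj0, h⟩ := hF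
  refine ⟨τ.symm ∘ i, σ ∘ j, τ.symm.isOpenEmbedding.comp hi, σ.isOpenEmbedding.comp hj, ?_, ?_, ?_⟩
  · simp [hi0]
  · simp [hj0]
  · filter_upwards [h] with z hz
    simp [hz]

theorem IsPowerGerm.continuousAt {F : X → Y} {x : X} {n : ℕ} (hF : IsPowerGerm F x n)
    (hn : 1 ≤ n) : ContinuousAt F x := by
  obtain ⟨i, j, hi, hj, rfl, hj0, h⟩ := hF
  rw [← hi.continuousAt_iff, ContinuousAt]
  have h1 : Tendsto (fun z : ℂ => j (z ^ n)) (𝓝 0) (𝓝 (j (0 ^ n))) :=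
    (hj.continuous.comp (continuous_pow n)).tendsto 0
  rw [zero_pow (by lia), hj0] at h1
  exact h1.congr' (h.mono fun z hz => hz.symm)

theorem IsPowerGerm.isLocalHomeomorphOn {F : X → Y} {x : X} (hF : IsPowerGerm F x 1) :
    ∃ φ : OpenPartialHomeomorph X Y, x ∈ φ.source ∧ EqOn F φ φ.source := by
  obtain ⟨i, j, hi, hj, rfl, hj0, h⟩ := hF
  obtain ⟨s, hs, hso, h0⟩ := eventually_nhds_iff.mp h
  refine ⟨((hi.toOpenPartialHomeomorph i).symm.restrOpen (i '' s) (hi.isOpenMap s hso)).trans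
    (hj.toOpenPartialHomeomorph j), ?_, ?_⟩
  · simpa using ⟨0, h0, rfl⟩
  · intro y hy
    simp only [OpenPartialHomeomorph.trans_source, mem_inter_iff] at hy
    obtain ⟨z, hz, rfl⟩ : y ∈ i '' s := by simpa using hy.1.2
    have : (hi.toOpenPartialHomeomorph i).symm (i z) = z :=
      (hi.toOpenPartialHomeomorph i).left_inv (by simp)
    simp [this, hs z hz]

/-- A power germ admits coordinates defined on discs in which it is `z ↦ z ^ n` everywhere. -/
theorem IsPowerGerm.exists_disc {F : X → Y} {x : X} {n : ℕ} (hF : IsPowerGerm F x n)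
    (hn : 1 ≤ n) :
    ∃ (U : Set X) (V : Set Y) (_hUo : IsOpen U) (_hVo : IsOpen V) (hyU : x ∈ U)
      (hyV : F x ∈ V) (hmaps : Set.MapsTo F U V)
      (h : ↥U ≃ₜ ↥(Metric.ball (0 : ℂ) 1)) (g : ↥V ≃ₜ ↥(Metric.ball (0 : ℂ) 1)),
      (h ⟨x, hyU⟩ : ℂ) = 0 ∧ (g ⟨F x, hyV⟩ : ℂ) = 0 ∧
      ∀ z (hz : z ∈ U), (g ⟨F z, hmaps hz⟩ : ℂ) = (h ⟨z, hz⟩ : ℂ) ^ n := by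
  obtain ⟨i, j, hi, hj, hi0, hj0, h⟩ := hF
  obtain ⟨r, hr, hb⟩ := Metric.eventually_nhds_iff_ball.mp h
  have hrC : (r : ℂ) ≠ 0 := by exact_mod_cast hr.ne'
  have hrn : (r : ℂ) ^ n ≠ 0 := pow_ne_zero _ hrC
  let sc (c : ℂ) (hc : c ≠ 0) : ℂ ≃ₜ ℂ := Homeomorph.mulLeft₀ c hc
  let i' : ℂ → X := i ∘ sc r hrC
  let j' : ℂ → Y := j ∘ sc (r ^ n) hrn
  have hi' : IsOpenEmbedding i' := hi.comp (sc r hrC).isOpenEmbedding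
  have hj' : IsOpenEmbedding j' := hj.comp (sc (r ^ n) hrn).isOpenEmbedding
  have key : ∀ z ∈ Metric.ball (0 : ℂ) 1, F (i' z) = j' (z ^ n) := by
    intro z hz
    have h1 : (r : ℂ) * z ∈ Metric.ball (0 : ℂ) r := by
      rw [mem_ball_zero_iff] at hz ⊢
      rw [norm_mul, Complex.norm_real, Real.norm_of_nonneg hr.le]
      nlinarith
    simpa [i', j', sc, mul_pow] using hb _ h1
  have hpow : ∀ z ∈ Metric.ball (0 : ℂ) 1, z ^ n ∈ Metric.ball (0 : ℂ) 1 := by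
    intro z hz
    rw [mem_ball_zero_iff] at hz ⊢
    rw [norm_pow]
    exact pow_lt_one₀ (norm_nonneg _) hz (by lia)
  let B := Metric.ball (0 : ℂ) 1
  have h0B : (0 : ℂ) ∈ B := Metric.mem_ball_self one_pos
  have hx : i' 0 = x := by simp [i', sc, hi0]
  have hFx : j' 0 = F x := by simp [j', sc, hj0]
  have hmaps : MapsTo F (i' '' B) (j' '' B) := by
    rintro _ ⟨z, hz, rfl⟩
    exact ⟨z ^ n, hpow z hz, (key z hz).symm⟩
  have hsymmi : ∀ z (hz : z ∈ B) (h' : i' z ∈ i' '' B),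
      (hi'.isEmbedding.homeomorphImage B).symm ⟨i' z, h'⟩ = ⟨z, hz⟩ := by
    intro z hz h'
    rw [Homeomorph.symm_apply_eq]; rfl
  have hsymmj : ∀ z (hz : z ∈ B) (h' : j' z ∈ j' '' B),
      (hj'.isEmbedding.homeomorphImage B).symm ⟨j' z, h'⟩ = ⟨z, hz⟩ := by
    intro z hz h'
    rw [Homeomorph.symm_apply_eq]; rfl
  refine ⟨i' '' B, j' '' B, hi'.isOpenMap _ Metric.isOpen_ball, hj'.isOpenMap _ Metric.isOpen_ball,
    ⟨0, h0B, hx⟩, ⟨0, h0B, hFx⟩, hmaps, (hi'.isEmbedding.homeomorphImage B).symm,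
    (hj'.isEmbedding.homeomorphImage B).symm, ?_, ?_, ?_⟩
  · simp only [← hx, hsymmi 0 h0B]
  · simp only [← hFx, hsymmj 0 h0B]
  · rintro _ ⟨z, hz, rfl⟩
    simp only [key z hz, hsymmj _ (hpow z hz)]
    exact (congrArg (fun t : B => (t : ℂ) ^ n) (hsymmi z hz ⟨z, hz, rfl⟩)).symm

/-- `F` has a power germ of exponent `e x` at every point `x`, and all but finitely many
fibers of `F` have `d` points. -/
structure IsBranched (d : ℕ) (F : X → Y) (e : X → ℕ) : Prop where
  pos : ∀ x, 1 ≤ e x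
  germ : ∀ x, IsPowerGerm F x (e x)
  card : ∃ B : Set Y, B.Finite ∧ ∀ w ∉ B, (F ⁻¹' {w}).encard = d

theorem IsBranched.conj {X' Y' : Type*} [TopologicalSpace X'] [TopologicalSpace Y']
    {d : ℕ} {F : X → Y} {e : X → ℕ} (hF : IsBranched d F e) (σ : Y ≃ₜ Y') (τ : X' ≃ₜ X) :
    IsBranched d (σ ∘ F ∘ τ) (e ∘ τ) where
  pos x := hF.pos _
  germ x := (hF.germ _).conj σ τ
  card := by
    obtain ⟨B, hB, h⟩ := hF.card
    refine ⟨σ '' B, hB.image _, fun w hw => ?_⟩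
    have h1 : (σ ∘ F ∘ τ) ⁻¹' {w} = τ ⁻¹' (F ⁻¹' {σ.symm w}) := by
      ext x
      simp [Homeomorph.eq_symm_apply]
    rw [h1, ← τ.image_symm, τ.symm.injective.encard_image]
    exact h _ fun h' => hw ⟨_, h', by simp⟩

theorem IsBranched.continuous {d : ℕ} {F : X → Y} {e : X → ℕ} (hF : IsBranched d F e) :
    Continuous F :=
  continuous_iff_continuousAt.mpr fun x => (hF.germ x).continuousAt (hF.pos x)

end Germs

theorem IsBranched.exists_isBranchedCovering {d : ℕ} {F : Sphere2 → Sphere2} {e : Sphere2 → ℕ}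
    (hF : IsBranched d F e) (he : {x | 1 < e x}.Finite) :
    ∃ B : Set Sphere2, IsBranchedCovering d F B e := by
  obtain ⟨B, hB, hcard⟩ := hF.card
  have hone : ∀ y, F y ∉ B ∪ F '' {x | 1 < e x} → e y = 1 := by
    intro y hy
    by_contra h
    exact hy (Or.inr ⟨y, lt_of_le_of_ne (hF.pos y) (Ne.symm h), rfl⟩)
  refine ⟨B ∪ F '' {x | 1 < e x}, hF.continuous, hB.union (he.image _), ?_, ?_, hone, ?_⟩
  · have hloc : IsLocalHomeomorphOn F (F ⁻¹' (B ∪ F '' {x | 1 < e x})ᶜ) :=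
      IsLocalHomeomorphOn.mk _ _ fun x hx => by
        have := hF.germ x
        rw [hone x hx] at this
        exact this.isLocalHomeomorphOn
    exact (IsCoveringMapOn.of_isLocalHomeomorphOn hF.continuous hloc).isCoveringMap_restrictPreimage
  · intro x hx
    have := hcard x fun h => hx (Or.inl h)
    rw [Nat.card_coe_set_eq, Set.ncard, this]
    rfl
  · intro y _
    exact ⟨hF.pos y, (hF.germ y).exists_disc (hF.pos y)⟩

section Straightening

/-- A map tangent to the identity at `0` agrees near `0` with a homeomorphism of the plane
supported in a prescribed disc. -/
theorem exists_homeomorph_eq_near_zero {φ : ℂ → ℂ} (hφ : HasStrictDerivAt φ 1 0) (h0 : φ 0 = 0)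
    {ε : ℝ} (hε : 0 < ε) :
    ∃ Φ : ℂ ≃ₜ ℂ, (∀ᶠ z in 𝓝 0, Φ z = φ z) ∧ ∀ z, ε ≤ ‖z‖ → Φ z = z := by
  let K := lipschitzExtensionConstant ℂ
  have hK : 0 < K := lipschitzExtensionConstant_pos ℂ
  let η : NNReal := 1 / (2 * K)
  have hη : 0 < η := by positivity
  have hKη : K * η < 1 := by
    have : K * η = 1 / 2 := by simp only [η]; field_simp
    rw [this]
    exact NNReal.half_lt_self one_ne_zero
  have hψ : HasStrictDerivAt (fun z => φ z - z) 0 0 := by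
    have := hφ.sub (hasStrictDerivAt_id (0 : ℂ))
    rwa [sub_self] at this
  obtain ⟨s, hs, hlip⟩ := hψ.hasStrictFDerivAt.exists_lipschitzOnWith_of_nnnorm_lt η (by simpa)
  obtain ⟨δ, hδ, hball⟩ := Metric.mem_nhds_iff.mp hs
  let r := min δ (ε / 2)
  have hr : 0 < r := by positivity
  let S := Metric.ball (0 : ℂ) r
  let f : ℂ → ℂ := fun z => if ‖z‖ < r then φ z else z
  have hbound : ∀ x, ‖x‖ < r → ∀ y, 2 * r ≤ ‖y‖ → ‖φ x - x‖ ≤ η * ‖x - y‖ := by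
    intro x hx y hy
    have h1 := hlip.norm_sub_le (x := x) (hball (by simpa using hx.trans_le (min_le_left _ _)))
      (y := 0) (hball (by simpa using hδ))
    simp only [h0, sub_zero] at h1
    have h2 : ‖y‖ ≤ ‖x - y‖ + ‖x‖ := by
      have := norm_sub_le (y - x) (-x)
      simpa [norm_sub_rev] using this
    exact h1.trans (by gcongr; linarith)
  have happ : ApproximatesLinearOn f ((ContinuousLinearEquiv.refl ℝ ℂ : ℂ ≃L[ℝ] ℂ) : ℂ →L[ℝ] ℂ)
      (S ∪ {z | 2 * r ≤ ‖z‖}) η := by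
    have hout : ∀ z : ℂ, 2 * r ≤ ‖z‖ → ¬ ‖z‖ < r := fun z hz => by linarith
    rintro x (hx | hx) y (hy | hy)
    · have hx' : ‖x‖ < r := by simpa [S] using hx
      have hy' : ‖y‖ < r := by simpa [S] using hy
      have := hlip.norm_sub_le (x := x) (hball (by simpa using hx'.trans_le (min_le_left _ _)))
        (y := y) (hball (by simpa using hy'.trans_le (min_le_left _ _)))
      simp only [f, hx', hy', if_true]
      exact (congrArg norm (show φ x - φ y - (x - y) = φ x - x - (φ y - y) by ring)).trans_le this
    · have hx' : ‖x‖ < r := by simpa [S] using hx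
      have := hbound x hx' y hy
      simp only [f, hx', hout y hy, if_true, if_false]
      exact (congrArg norm (show φ x - y - (x - y) = φ x - x by ring)).trans_le this
    · have hy' : ‖y‖ < r := by simpa [S] using hy
      have := hbound y hy' x hx
      simp only [f, hy', hout x hx, if_true, if_false]
      rw [norm_sub_rev x y, ← norm_neg]
      exact (congrArg norm (show -(x - φ y - (x - y)) = φ y - y by ring)).trans_le this
    · simp only [f, hout x hx, hout y hy, if_false]
      simp
      positivity
  obtain ⟨Φ, hΦ⟩ := happ.exists_homeomorph_extension (Or.inr (by
    have : ‖((ContinuousLinearEquiv.refl ℝ ℂ).symm : ℂ →L[ℝ] ℂ)‖₊ = 1 := by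
      ext
      exact ContinuousLinearMap.norm_id
    rw [this, inv_one]
    exact hKη))
  refine ⟨Φ, ?_, ?_⟩
  · filter_upwards [Metric.ball_mem_nhds (0 : ℂ) hr] with z hz
    rw [← hΦ (Or.inl hz)]
    exact if_pos (by simpa using hz)
  · intro z hz
    have h2 : 2 * r ≤ ‖z‖ := by
      have : r ≤ ε / 2 := min_le_right _ _
      linarith
    rw [← hΦ (Or.inr h2)]
    exact if_neg (by linarith)

/-- A function vanishing to order `n` at `0` is, up to a constant, the `n`-th power of a
homeomorphism of the plane supported in a prescribed disc. -/
theorem exists_homeomorph_pow_eq {q : ℂ → ℂ} (hq : AnalyticAt ℂ q 0) (hq0 : q 0 ≠ 0)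
    {n : ℕ} (hn : 1 ≤ n) {ε : ℝ} (hε : 0 < ε) :
    ∃ Φ : ℂ ≃ₜ ℂ, Φ 0 = 0 ∧ (∀ᶠ z in 𝓝 0, z ^ n * q z = q 0 * Φ z ^ n) ∧
      ∀ z, ε ≤ ‖z‖ → Φ z = z := by
  have hnC : (n : ℂ) ≠ 0 := by exact_mod_cast (by lia : n ≠ 0)
  let ρ : ℂ → ℂ := fun z => Complex.exp (Complex.log (q z / q 0) / n)
  have hdiv : AnalyticAt ℂ (fun z => q z / q 0) 0 := hq.div analyticAt_const hq0
  have hlog : AnalyticAt ℂ (fun z => Complex.log (q z / q 0)) 0 := hdiv.clog (by simp [hq0])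
  have hρ : AnalyticAt ℂ ρ 0 := (hlog.div analyticAt_const hnC).cexp
  have hρ0 : ρ 0 = 1 := by simp [ρ, hq0]
  have hder : HasStrictDerivAt (fun z => z * ρ z) 1 0 := by
    have := (hasStrictDerivAt_id (0 : ℂ)).mul hρ.hasStrictDerivAt
    rwa [hρ0, id, one_mul, zero_mul, add_zero] at this
  obtain ⟨Φ, hΦ, hout⟩ := exists_homeomorph_eq_near_zero hder (by simp) hε
  refine ⟨Φ, by simpa using hΦ.self_of_nhds, ?_, hout⟩
  filter_upwards [hΦ, hq.continuousAt.eventually_ne hq0] with z hz hqz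
  have : ρ z ^ n = q z / q 0 := by
    rw [← Complex.exp_nat_mul, mul_div_cancel₀ _ hnC, Complex.exp_log (div_ne_zero hqz hq0)]
  rw [hz, mul_pow, this]
  field_simp

end Straightening

section RiemannSphere

open Polynomial
open scoped OnePoint

open Classical in
/-- The inversion `z ↦ z⁻¹` of the Riemann sphere. -/
noncomputable def inversion (x : OnePoint ℂ) : OnePoint ℂ :=
  x.elim ((0 : ℂ) : OnePoint ℂ) fun z => if z = 0 then ∞ else ((z⁻¹ : ℂ) : OnePoint ℂ)

@[simp] theorem inversion_infty : inversion ∞ = ((0 : ℂ) : OnePoint ℂ) := rfl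

@[simp] theorem inversion_zero : inversion ((0 : ℂ) : OnePoint ℂ) = ∞ := if_pos rfl

theorem inversion_coe {z : ℂ} (hz : z ≠ 0) : inversion z = ((z⁻¹ : ℂ) : OnePoint ℂ) := if_neg hz

theorem inversion_involutive : Function.Involutive inversion := by
  intro x
  induction x using OnePoint.rec with
  | infty => simp
  | coe z =>
    by_cases hz : z = 0
    · simp [hz]
    · rw [inversion_coe hz, inversion_coe (inv_ne_zero hz), inv_inv]

theorem continuous_inversion : Continuous inversion := by
  have hinf : Filter.coclosedCompact ℂ = Bornology.cobounded ℂ := by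
    rw [Filter.coclosedCompact_eq_cocompact, Metric.cobounded_eq_cocompact]
  have hco : Tendsto ((↑) : ℂ → OnePoint ℂ) (Bornology.cobounded ℂ) (𝓝 ∞) :=
    hinf ▸ OnePoint.tendsto_coe_infty
  rw [OnePoint.continuous_iff, hinf]
  constructor
  · have h1 : Tendsto (fun z : ℂ => ((z⁻¹ : ℂ) : OnePoint ℂ)) (Bornology.cobounded ℂ)
        (𝓝 ((0 : ℂ) : OnePoint ℂ)) :=
      (OnePoint.continuous_coe.tendsto 0).comp tendsto_inv₀_cobounded
    refine h1.congr' ?_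
    filter_upwards [Bornology.eventually_ne_cobounded 0] with z hz
    exact (inversion_coe hz).symm
  · rw [continuous_iff_continuousAt]
    intro z
    by_cases hz : z = 0
    · subst hz
      rw [continuousAt_iff_punctured_nhds, inversion_zero]
      refine (hco.comp tendsto_inv₀_nhdsNE_zero).congr' ?_
      filter_upwards [self_mem_nhdsWithin] with z hz
      exact (inversion_coe hz).symm
    · have h1 : ContinuousAt (fun z : ℂ => ((z⁻¹ : ℂ) : OnePoint ℂ)) z :=
        (OnePoint.continuous_coe.continuousAt).comp (continuousAt_inv₀ hz)
      refine h1.congr ?_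
      filter_upwards [eventually_ne_nhds hz] with z hz
      exact (inversion_coe hz).symm

/-- The inversion as a homeomorphism of the Riemann sphere. -/
noncomputable def inversionHomeomorph : OnePoint ℂ ≃ₜ OnePoint ℂ where
  toEquiv := inversion_involutive.toPerm
  continuous_toFun := continuous_inversion
  continuous_invFun := continuous_inversion

@[simp] theorem inversionHomeomorph_apply (x : OnePoint ℂ) :
    inversionHomeomorph x = inversion x := rfl

theorem isPowerGerm_of_analyticAt {F : OnePoint ℂ → OnePoint ℂ} (σ τ : OnePoint ℂ ≃ₜ OnePoint ℂ)
    {z₀ w₀ : ℂ} {q : ℂ → ℂ} {n : ℕ} (hn : 1 ≤ n) (hq : AnalyticAt ℂ q 0) (hq0 : q 0 ≠ 0)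
    (h : ∀ᶠ z in 𝓝 (0 : ℂ), σ (F (τ (z₀ + z : ℂ))) = ((w₀ + z ^ n * q z : ℂ) : OnePoint ℂ)) :
    IsPowerGerm F (τ z₀) n := by
  obtain ⟨Φ, hΦ0, hΦ, -⟩ := exists_homeomorph_pow_eq hq hq0 hn one_pos
  let A : ℂ ≃ₜ ℂ := Φ.symm.trans (Homeomorph.addLeft z₀)
  let A' : ℂ ≃ₜ ℂ := (Homeomorph.mulLeft₀ (q 0) hq0).trans (Homeomorph.addLeft w₀)
  have hs0 : Φ.symm 0 = 0 := by rw [Homeomorph.symm_apply_eq, hΦ0]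
  refine ⟨fun z => τ (A z), fun z => σ.symm (A' z),
    τ.isOpenEmbedding.comp (OnePoint.isOpenEmbedding_coe.comp A.isOpenEmbedding),
    σ.symm.isOpenEmbedding.comp (OnePoint.isOpenEmbedding_coe.comp A'.isOpenEmbedding), ?_, ?_, ?_⟩
  · simp [A, hs0]
  · have := h.self_of_nhds
    rw [Homeomorph.symm_apply_eq]
    simpa [A', (by lia : n ≠ 0)] using this.symm
  · have ht : Tendsto Φ.symm (𝓝 0) (𝓝 0) := by
      simpa [hs0] using Φ.symm.continuous.tendsto 0
    filter_upwards [ht.eventually (h.and hΦ)] with z hz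
    rw [Homeomorph.eq_symm_apply]
    have h2 := hz.2
    rw [Homeomorph.apply_symm_apply] at h2
    simpa [A, A', h2] using hz.1

open Classical in
/-- The self-map of the Riemann sphere given by `P / Q`, sending `∞` to `∞`. -/
noncomputable def ratMap (P Q : ℂ[X]) (x : OnePoint ℂ) : OnePoint ℂ :=
  x.elim ∞ fun z => if Q.eval z = 0 then ∞ else ((P.eval z / Q.eval z : ℂ) : OnePoint ℂ)

theorem ratMap_infty (P Q : ℂ[X]) : ratMap P Q ∞ = ∞ := rfl

theorem ratMap_coe {P Q : ℂ[X]} {z : ℂ} (hz : Q.eval z ≠ 0) :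
    ratMap P Q z = ((P.eval z / Q.eval z : ℂ) : OnePoint ℂ) := if_neg hz

theorem ratMap_coe_of_eval_eq_zero {P Q : ℂ[X]} {z : ℂ} (hz : Q.eval z = 0) :
    ratMap P Q z = ∞ := if_pos hz

theorem inversion_ratMap {P Q : ℂ[X]} {z : ℂ} (hz : P.eval z ≠ 0) :
    inversion (ratMap P Q z) = ((Q.eval z / P.eval z : ℂ) : OnePoint ℂ) := by
  by_cases hQ : Q.eval z = 0
  · rw [ratMap_coe_of_eval_eq_zero hQ, hQ, zero_div, inversion_infty]
  · rw [ratMap_coe hQ, inversion_coe (div_ne_zero hz hQ), inv_div]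

theorem exists_eq_pow_mul_of_wronskian {N M : ℂ[X]} {z₀ : ℂ} (hM : M.eval z₀ ≠ 0)
    (hN : N.eval z₀ = 0) (hW : wronskian N M ≠ 0) :
    ∃ R : ℂ[X], R.eval z₀ ≠ 0 ∧
      N = (X - C z₀) ^ ((wronskian N M).rootMultiplicity z₀ + 1) * R := by
  have hN0 : N ≠ 0 := by
    rintro rfl
    simp at hW
  obtain ⟨R, hR, hdvd⟩ := N.exists_eq_pow_rootMultiplicity_mul_and_not_dvd hN0 z₀
  rw [dvd_iff_isRoot, IsRoot.def] at hdvd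
  obtain ⟨k, hk⟩ : ∃ k, N.rootMultiplicity z₀ = k + 1 :=
    Nat.exists_eq_succ_of_ne_zero ((rootMultiplicity_pos hN0).mpr hN).ne'
  rw [hk] at hR
  let T : ℂ[X] := (X - C z₀) * (R * derivative M - derivative R * M) - C (k + 1 : ℂ) * R * M
  have hWT : wronskian N M = T * (X - C z₀) ^ k := by
    rw [hR, wronskian]
    simp only [derivative_mul, derivative_X_sub_C_pow, T]
    push_cast
    simp only [map_add, map_one, map_natCast]
    ring
  have hT : T.eval z₀ ≠ 0 := by
    have : (k + 1 : ℂ) ≠ 0 := by exact_mod_cast Nat.succ_ne_zero k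
    simp [T, hdvd, hM, this]
  have hT0 : T ≠ 0 := by
    rintro h
    simp [h] at hT
  refine ⟨R, hdvd, ?_⟩
  rw [hWT, rootMultiplicity_mul_X_sub_C_pow hT0, rootMultiplicity_eq_zero hT, zero_add]
  exact hR

theorem wronskian_sub_C_mul (P Q : ℂ[X]) (w : ℂ) :
    wronskian (P - C w * Q) Q = wronskian P Q := by
  simp only [wronskian, derivative_sub, derivative_C_mul]
  ring

theorem analyticAt_eval_div {R M : ℂ[X]} {z₀ : ℂ} (hM : M.eval z₀ ≠ 0) :
    AnalyticAt ℂ (fun z => R.eval (z₀ + z) / M.eval (z₀ + z)) 0 := by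
  have hadd : AnalyticAt ℂ (fun z : ℂ => z₀ + z) 0 := by fun_prop
  have h1 (T : ℂ[X]) : AnalyticAt ℂ (fun z => T.eval (z₀ + z)) 0 := by
    simpa using hadd.aeval_polynomial T
  exact (h1 R).div (h1 M) (by simpa using hM)

theorem eventually_eval_add_ne_zero {M : ℂ[X]} {z₀ : ℂ} (hM : M.eval z₀ ≠ 0) :
    ∀ᶠ z in 𝓝 (0 : ℂ), M.eval (z₀ + z) ≠ 0 := by
  have h1 : ContinuousAt (fun z : ℂ => M.eval (z₀ + z)) 0 := by fun_prop
  exact h1.eventually_ne (by simpa using hM)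

variable {P Q : ℂ[X]}

theorem ratMap_near_regular {z₀ : ℂ} (hQ : Q.eval z₀ ≠ 0) (hW : wronskian P Q ≠ 0) :
    ∃ q : ℂ → ℂ, AnalyticAt ℂ q 0 ∧ q 0 ≠ 0 ∧ ∀ᶠ z in 𝓝 (0 : ℂ), ratMap P Q (z₀ + z : ℂ) =
      ((P.eval z₀ / Q.eval z₀ + z ^ ((wronskian P Q).rootMultiplicity z₀ + 1) * q z : ℂ) :
        OnePoint ℂ) := by
  have hWN := wronskian_sub_C_mul P Q (P.eval z₀ / Q.eval z₀)
  obtain ⟨R, hR, hN⟩ := exists_eq_pow_mul_of_wronskian (N := P - C (P.eval z₀ / Q.eval z₀) * Q)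
    hQ (by simp [hQ]) (by rwa [hWN])
  rw [hWN] at hN
  refine ⟨_, analyticAt_eval_div (R := R) hQ, by simp [hR, hQ], ?_⟩
  filter_upwards [eventually_eval_add_ne_zero hQ] with z hz
  have h2 := congrArg (eval (z₀ + z)) hN
  simp only [eval_sub, eval_mul, eval_C, eval_pow, eval_X, add_sub_cancel_left] at h2
  rw [ratMap_coe hz, ← mul_div_assoc, ← h2, sub_div, mul_div_cancel_right₀ _ hz, add_sub_cancel]

theorem inversion_ratMap_near_pole {z₀ : ℂ} (hP : P.eval z₀ ≠ 0) (hQ : Q.eval z₀ = 0)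
    (hW : wronskian P Q ≠ 0) :
    ∃ q : ℂ → ℂ, AnalyticAt ℂ q 0 ∧ q 0 ≠ 0 ∧ ∀ᶠ z in 𝓝 (0 : ℂ),
      inversion (ratMap P Q (z₀ + z : ℂ)) =
        ((0 + z ^ ((wronskian P Q).rootMultiplicity z₀ + 1) * q z : ℂ) : OnePoint ℂ) := by
  have hWN : wronskian Q P = -wronskian P Q := (wronskian_neg_eq P Q).symm
  obtain ⟨R, hR, hN⟩ := exists_eq_pow_mul_of_wronskian hP hQ (by rwa [hWN, neg_ne_zero])
  have hmul : (wronskian Q P).rootMultiplicity z₀ = (wronskian P Q).rootMultiplicity z₀ := by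
    rw [hWN, ← count_roots, ← count_roots, roots_neg]
  rw [hmul] at hN
  refine ⟨_, analyticAt_eval_div (R := R) hP, by simp [hR, hP], ?_⟩
  filter_upwards [eventually_eval_add_ne_zero hP] with z hz
  have h2 := congrArg (eval (z₀ + z)) hN
  simp only [eval_sub, eval_mul, eval_C, eval_pow, eval_X, add_sub_cancel_left] at h2
  rw [inversion_ratMap hz, h2]
  ring_nf

theorem eval_inv_mul_pow (T : ℂ[X]) {z : ℂ} (hz : z ≠ 0) :
    T.eval z⁻¹ * z ^ T.natDegree = T.reverse.eval z := by
  let _ : Invertible z⁻¹ := invertibleOfNonzero (inv_ne_zero hz)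
  have h := eval₂_reverse_mul_pow (RingHom.id ℂ) z⁻¹ T
  simp only [invOf_eq_inv, inv_inv] at h
  rw [eval, ← h, mul_assoc, ← mul_pow, inv_mul_cancel₀ hz, one_pow, mul_one, eval]

theorem ratMap_near_infty (hdeg : Q.natDegree < P.natDegree) (hQ : Q ≠ 0) :
    ∃ q : ℂ → ℂ, AnalyticAt ℂ q 0 ∧ q 0 ≠ 0 ∧ ∀ᶠ z in 𝓝 (0 : ℂ),
      inversion (ratMap P Q (inversion (z : ℂ))) =
        ((z ^ (P.natDegree - Q.natDegree) * q z : ℂ) : OnePoint ℂ) := by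
  have hP : P ≠ 0 := by
    rintro rfl
    simp at hdeg
  have hrev (T : ℂ[X]) (hT : T ≠ 0) : T.reverse.eval 0 ≠ 0 := by
    rwa [← coeff_zero_eq_eval_zero, coeff_zero_reverse, Ne, leadingCoeff_eq_zero]
  refine ⟨_, analyticAt_eval_div (R := Q.reverse) (hrev P hP),
    by simp [hrev P hP, hrev Q hQ], ?_⟩
  filter_upwards [eventually_eval_add_ne_zero (hrev P hP)] with z hz
  by_cases h0 : z = 0
  · simp [h0, ratMap_infty, Nat.sub_ne_zero_of_lt hdeg]
  · simp only [zero_add] at hz ⊢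
    rw [← eval_inv_mul_pow P h0] at hz
    rw [inversion_coe h0, inversion_ratMap (left_ne_zero_of_mul hz), ← eval_inv_mul_pow P h0,
      ← eval_inv_mul_pow Q h0]
    have hpow : z ^ P.natDegree = z ^ (P.natDegree - Q.natDegree) * z ^ Q.natDegree := by
      rw [← pow_add, Nat.sub_add_cancel hdeg.le]
    have := left_ne_zero_of_mul hz
    rw [hpow]
    congr 1
    field_simp

/-- The ramification numbers of `ratMap P Q`. -/
noncomputable def ratRam (P Q : ℂ[X]) (x : OnePoint ℂ) : ℕ :=
  x.elim (P.natDegree - Q.natDegree) fun z => (wronskian P Q).rootMultiplicity z + 1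

theorem ratRam_infty : ratRam P Q ∞ = P.natDegree - Q.natDegree := rfl

theorem ratRam_coe (z : ℂ) : ratRam P Q z = (wronskian P Q).rootMultiplicity z + 1 := rfl

theorem encard_ratMap_fiber (hcop : ∀ z, Q.eval z = 0 → P.eval z ≠ 0)
    (hdeg : Q.natDegree < P.natDegree) {w : ℂ}
    (hw : ∀ z, (wronskian P Q).eval z = 0 → ratMap P Q z ≠ w) :
    (ratMap P Q ⁻¹' {(w : OnePoint ℂ)}).encard = P.natDegree := by
  classical
  let T := P - C w * Q
  have hTdeg : T.natDegree = P.natDegree :=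
    natDegree_sub_eq_left_of_natDegree_lt ((natDegree_C_mul_le w Q).trans_lt hdeg)
  have hT0 : T ≠ 0 := by
    intro h
    rw [h, natDegree_zero] at hTdeg
    lia
  have hval : ∀ z : ℂ, ratMap P Q z = w ↔ T.eval z = 0 := by
    intro z
    by_cases hz : Q.eval z = 0
    · have := hcop z hz
      simp [ratMap_coe_of_eval_eq_zero hz, T, hz, this]
    · rw [ratMap_coe hz, OnePoint.coe_eq_coe, div_eq_iff hz]
      simp [T, sub_eq_zero]
  have hfib : ratMap P Q ⁻¹' {(w : OnePoint ℂ)} = (↑) '' (T.roots.toFinset : Set ℂ) := by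
    ext x
    induction x using OnePoint.rec with
    | infty => simp [ratMap_infty]
    | coe z => simp [hval, hT0]
  have hnodup : T.roots.Nodup := by
    rw [Multiset.nodup_iff_count_le_one]
    intro z
    rw [count_roots]
    by_contra! h
    obtain ⟨h1, h2⟩ := (one_lt_rootMultiplicity_iff_isRoot hT0).mp h
    refine hw z ?_ ((hval z).mpr h1)
    rw [← wronskian_sub_C_mul P Q w, wronskian]
    change eval z (T * derivative Q - derivative T * Q) = 0
    rw [eval_sub, eval_mul, eval_mul, h1, h2, zero_mul, zero_mul, sub_zero]
  rw [hfib, OnePoint.coe_injective.encard_image, Set.encard_coe_eq_coe_finsetCard,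
    Multiset.toFinset_card_of_nodup hnodup, ← (IsAlgClosed.splits T).natDegree_eq_card_roots, hTdeg]

theorem isBranched_ratMap (hcop : ∀ z, Q.eval z = 0 → P.eval z ≠ 0)
    (hdeg : Q.natDegree < P.natDegree) (hW : wronskian P Q ≠ 0) :
    IsBranched P.natDegree (ratMap P Q) (ratRam P Q) where
  pos x := by
    induction x using OnePoint.rec with
    | infty => rw [ratRam_infty]; lia
    | coe z => rw [ratRam_coe]; lia
  germ x := by
    induction x using OnePoint.rec with
    | infty =>
      have hQ : Q ≠ 0 := by
        rintro rfl
        simp at hW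
      obtain ⟨q, hq, hq0, h⟩ := ratMap_near_infty hdeg hQ
      have := isPowerGerm_of_analyticAt (F := ratMap P Q) (z₀ := 0) (w₀ := 0)
        inversionHomeomorph inversionHomeomorph
        (Nat.sub_pos_of_lt hdeg) hq hq0 (by simpa using h)
      simpa [ratRam_infty] using this
    | coe z =>
      rw [ratRam_coe]
      by_cases hz : Q.eval z = 0
      · obtain ⟨q, hq, hq0, h⟩ := inversion_ratMap_near_pole (hcop z hz) hz hW
        exact isPowerGerm_of_analyticAt inversionHomeomorph (Homeomorph.refl _) (by lia) hq hq0 h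
      · obtain ⟨q, hq, hq0, h⟩ := ratMap_near_regular hz hW
        exact isPowerGerm_of_analyticAt (Homeomorph.refl _) (Homeomorph.refl _) (by lia) hq hq0 h
  card := by
    refine ⟨insert ∞ ((fun z : ℂ => ratMap P Q z) '' {z | (wronskian P Q).IsRoot z}),
      ((finite_setOfPred_isRoot hW).image _).insert _, fun w hw => ?_⟩
    induction w using OnePoint.rec with
    | infty => simp at hw
    | coe w =>
      exact encard_ratMap_fiber hcop hdeg fun z hz h => hw (Or.inr ⟨z, hz, h⟩)

end RiemannSphere

section ThreePoints

open Polynomial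

theorem pow_dvd_wronskian {L N M : ℂ[X]} {n : ℕ} (h : L ^ n ∣ N) :
    L ^ (n - 1) ∣ wronskian N M :=
  dvd_sub (((pow_dvd_pow L n.pred_le).trans h).mul_right _)
    ((pow_sub_one_dvd_derivative_of_pow_dvd h).mul_right _)

theorem pow_dvd_wronskian_of_dvd {L N M : ℂ[X]} {n : ℕ} (hn : 1 ≤ n) (h : L ^ n ∣ N)
    (hM : L ∣ M) : L ^ n ∣ wronskian N M := by
  refine dvd_sub (h.mul_right _) ?_
  have := mul_dvd_mul (pow_sub_one_dvd_derivative_of_pow_dvd h) hM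
  rwa [← pow_succ, Nat.sub_add_cancel hn] at this

theorem wronskian_sub_left (P Q : ℂ[X]) : wronskian (P - Q) Q = wronskian P Q := by
  simp only [wronskian, derivative_sub]
  ring

theorem coeff_X_mul_wronskian (P Q : ℂ[X]) :
    (X * wronskian P Q).coeff (P.natDegree + Q.natDegree) =
      (Q.natDegree - P.natDegree : ℂ) * (P.leadingCoeff * Q.leadingCoeff) := by
  have hdeg (T : ℂ[X]) : (X * derivative T).natDegree ≤ T.natDegree := by
    by_cases h : T.natDegree = 0
    · simp [derivative_of_natDegree_zero h]
    · have := natDegree_derivative_lt h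
      exact natDegree_mul_le.trans (by rw [natDegree_X]; lia)
  have hcoeff (T : ℂ[X]) : (X * derivative T).coeff T.natDegree = T.natDegree * T.leadingCoeff := by
    rcases hk : T.natDegree with _ | k
    · simp
    · rw [leadingCoeff, hk, coeff_X_mul, coeff_derivative]
      push_cast
      ring
  have : X * wronskian P Q = P * (X * derivative Q) - (X * derivative P) * Q := by
    rw [wronskian]
    ring
  rw [this, coeff_sub, coeff_mul_add_eq_of_natDegree_le le_rfl (hdeg Q),
    coeff_mul_add_eq_of_natDegree_le (hdeg P) le_rfl, hcoeff, hcoeff]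
  simp only [leadingCoeff]
  ring

theorem wronskian_ne_zero {P Q : ℂ[X]} (hQ : Q ≠ 0) (h : Q.natDegree < P.natDegree) :
    wronskian P Q ≠ 0 := by
  intro hW
  have hP : P ≠ 0 := by
    rintro rfl
    simp at h
  have h1 := coeff_X_mul_wronskian P Q
  rw [hW, mul_zero, coeff_zero, eq_comm, mul_eq_zero, sub_eq_zero] at h1
  rcases h1 with h1 | h1
  · exact h.ne (by exact_mod_cast h1)
  · simp [hP, hQ] at h1

theorem isCoprime_X_X_sub_C_one : IsCoprime (X : ℂ[X]) (X - C 1) :=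
  ⟨1, -1, by simp⟩

theorem exists_pow_dvd_sub {c a k : ℕ} (hka : k < a) :
    ∃ A B : ℂ[X], A ≠ 0 ∧ B ≠ 0 ∧ A.natDegree + k < a ∧ B.natDegree ≤ k ∧
      (X - C 1) ^ a ∣ X ^ c * A - B := by
  let L : ℂ[X] := (X - C 1) ^ a
  have hL : L.Monic := (monic_X_sub_C 1).pow a
  have hLdeg : L.natDegree = a := by
    rw [natDegree_pow, natDegree_X_sub_C, mul_one]
  let φ : degreeLT ℂ (a - k) × degreeLT ℂ (k + 1) →ₗ[ℂ] degreeLT ℂ a :=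
    LinearMap.codRestrict (degreeLT ℂ a)
      (modByMonicHom L ∘ₗ (LinearMap.mulLeft ℂ (X ^ c) ∘ₗ (degreeLT ℂ (a - k)).subtype ∘ₗ
        LinearMap.fst ℂ _ _ - (degreeLT ℂ (k + 1)).subtype ∘ₗ LinearMap.snd ℂ _ _))
      fun x => by
        rw [mem_degreeLT]
        refine (degree_modByMonic_lt _ hL).trans_eq ?_
        rw [degree_eq_natDegree hL.ne_zero, hLdeg]
  have hrank (n : ℕ) : Module.finrank ℂ (degreeLT ℂ n) = n := by
    simpa using (degreeLTEquiv ℂ n).finrank_eq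
  have _ (n : ℕ) : Module.Finite ℂ (degreeLT ℂ n) := Module.Finite.equiv (degreeLTEquiv ℂ n).symm
  obtain ⟨⟨⟨A, hA⟩, ⟨B, hB⟩⟩, hx, hx0⟩ := Submodule.exists_mem_ne_zero_of_ne_bot
    (LinearMap.ker_ne_bot_of_finrank_lt (f := φ) (by
      rw [Module.finrank_prod, hrank, hrank, hrank]; lia))
  have hdvd : L ∣ X ^ c * A - B := by
    rw [← mem_ker_modByMonic hL]
    exact congrArg Subtype.val hx
  rw [mem_degreeLT] at hA hB
  have hsmall {T : ℂ[X]} (h : L ∣ T) (hT : T.degree < a) : T = 0 := by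
    by_contra h0
    refine hT.not_ge ?_
    have := degree_le_of_dvd h h0
    rwa [degree_eq_natDegree hL.ne_zero, hLdeg] at this
  have hB' : B.degree < a := hB.trans_le (by exact_mod_cast hka)
  have hA' : A.degree < a := hA.trans_le (by exact_mod_cast Nat.sub_le a k)
  have hA0 : A = 0 → B = 0 := by
    rintro rfl
    exact hsmall (by simpa using hdvd) hB'
  have hB0 : B = 0 → A = 0 := by
    rintro rfl
    refine hsmall (IsCoprime.dvd_of_dvd_mul_left (y := X ^ c) ?_ (by simpa using hdvd)) hA'
    exact isCoprime_X_X_sub_C_one.symm.pow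
  have hne : ¬ (A = 0 ∧ B = 0) := by
    rintro ⟨rfl, rfl⟩
    exact hx0 rfl
  have hA1 : A ≠ 0 := fun h => hne ⟨h, hA0 h⟩
  have hB1 : B ≠ 0 := fun h => hne ⟨hB0 h, h⟩
  rw [← natDegree_lt_iff_degree_lt hA1] at hA
  rw [← natDegree_lt_iff_degree_lt hB1] at hB
  exact ⟨A, B, hA1, hB1, by lia, by lia, hdvd⟩

/-- Polynomials whose quotient is ramified exactly over the images of `0`, `1` and `∞`. -/
theorem exists_three_point_polynomials {c a k : ℕ} (hkc : k < c) (hka : k < a) :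
    ∃ P Q : ℂ[X], P.natDegree + k = c + a - 1 ∧ Q.natDegree = k ∧ P.eval 0 = 0 ∧
      (∀ z, Q.eval z = 0 → P.eval z ≠ 0) ∧ wronskian P Q ≠ 0 ∧
      (wronskian P Q).rootMultiplicity 0 = c - 1 ∧ (wronskian P Q).rootMultiplicity 1 = a - 1 ∧
      ∀ z, z ≠ 0 → z ≠ 1 → (wronskian P Q).rootMultiplicity z = 0 := by
  obtain ⟨A, Q, hA, hQ, hAdeg, hQdeg, hdvd⟩ := exists_pow_dvd_sub (c := c) hka
  let P : ℂ[X] := X ^ c * A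
  have hPdeg : P.natDegree = c + A.natDegree := by
    rw [natDegree_mul (pow_ne_zero _ X_ne_zero) hA, natDegree_X_pow]
  have hlt : Q.natDegree < P.natDegree := by lia
  have hW := wronskian_ne_zero hQ hlt
  have hXP : (X : ℂ[X]) ^ c ∣ P := dvd_mul_right _ _
  have h0 : (X : ℂ[X]) ^ (c - 1) ∣ wronskian P Q := pow_dvd_wronskian hXP
  have h1 : (X - C 1 : ℂ[X]) ^ (a - 1) ∣ wronskian P Q :=
    wronskian_sub_left P Q ▸ pow_dvd_wronskian hdvd
  obtain ⟨T, hT⟩ := isCoprime_X_X_sub_C_one.pow.mul_dvd h0 h1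
  have hT0 : T ≠ 0 := by
    rintro rfl
    exact hW (by rw [hT, mul_zero])
  have hWdeg := natDegree_wronskian_lt_add hW
  have hWdeg' : (wronskian P Q).natDegree = (c - 1) + (a - 1) + T.natDegree := by
    rw [hT, natDegree_mul (mul_ne_zero (pow_ne_zero _ X_ne_zero)
      (pow_ne_zero _ (X_sub_C_ne_zero _))) hT0, natDegree_mul
      (pow_ne_zero _ X_ne_zero) (pow_ne_zero _ (X_sub_C_ne_zero _)), natDegree_pow, natDegree_pow,
      natDegree_X, natDegree_X_sub_C, mul_one, mul_one]
  obtain ⟨κ, rfl⟩ := natDegree_eq_zero.mp (by lia : T.natDegree = 0)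
  have hκ : κ ≠ 0 := by simpa using hT0
  have hroot : ∀ z, (wronskian P Q).rootMultiplicity z =
      (if z = 0 then c - 1 else 0) + (if z = 1 then a - 1 else 0) := by
    classical
    intro z
    have h := rootMultiplicity_mul (x := z) (hT ▸ hW)
    rw [hT, h, rootMultiplicity_C, add_zero, rootMultiplicity_mul
      (mul_ne_zero (pow_ne_zero _ X_ne_zero) (pow_ne_zero _ (X_sub_C_ne_zero _)))]
    congr 1
    · rw [← sub_zero (X : ℂ[X]), ← C_0, ← count_roots, roots_pow, roots_X_sub_C]
      simp [Multiset.count_singleton]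
    · rw [← count_roots, roots_pow, roots_X_sub_C]
      simp [Multiset.count_singleton]
  refine ⟨P, Q, by lia, by lia, by simp [P, (by lia : c ≠ 0)], fun z hzQ hzP => ?_, hW, ?_, ?_, ?_⟩
  · have hroot_ge {n : ℕ} (h : (X - C z) ^ n ∣ wronskian P Q) :
        n ≤ (wronskian P Q).rootMultiplicity z := (le_rootMultiplicity_iff hW).mpr h
    have hzQ' : X - C z ∣ Q := dvd_iff_isRoot.mpr hzQ
    have hz1 := hroot_ge (pow_dvd_wronskian_of_dvd (n := 1) le_rfl
      (by simpa using dvd_iff_isRoot.mpr hzP) hzQ')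
    rw [hroot] at hz1
    by_cases hz0 : z = 0
    · subst hz0
      have := hroot_ge (pow_dvd_wronskian_of_dvd (n := c) (by lia) (by simpa using hXP) hzQ')
      rw [hroot] at this
      simp at this
      lia
    · by_cases hz1 : z = 1
      · subst hz1
        have := hroot_ge (wronskian_sub_left P Q ▸
          pow_dvd_wronskian_of_dvd (n := a) (by lia) hdvd hzQ')
        rw [hroot] at this
        simp at this
        lia
      · simp_all
  · simp [hroot]
  · simp [hroot]
  · intro z hz0 hz1
    simp [hroot, hz0, hz1]

end ThreePoints

section NormalizedMap

open scoped OnePoint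

/-- The homeomorphism `z ↦ s * z` of the Riemann sphere. -/
noncomputable def scaling {s : ℂ} (hs : s ≠ 0) : OnePoint ℂ ≃ₜ OnePoint ℂ :=
  (Homeomorph.mulLeft₀ s hs).onePointCongr

@[simp] theorem scaling_infty {s : ℂ} (hs : s ≠ 0) : scaling hs ∞ = ∞ := rfl

@[simp] theorem scaling_coe {s : ℂ} (hs : s ≠ 0) (z : ℂ) :
    scaling hs z = ((s * z : ℂ) : OnePoint ℂ) := rfl

theorem exists_homeomorph_linearize_zero {F : OnePoint ℂ → OnePoint ℂ} {q : ℂ → ℂ} {n : ℕ}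
    (hn : 1 ≤ n) (hq : AnalyticAt ℂ q 0) (hq0 : q 0 ≠ 0)
    (hF : ∀ᶠ z : ℂ in 𝓝 0, F z = ((z ^ n * q z : ℂ) : OnePoint ℂ)) :
    ∃ τ : OnePoint ℂ ≃ₜ OnePoint ℂ, τ ∞ = ∞ ∧ τ (0 : ℂ) = (0 : ℂ) ∧
      (∀ z : ℂ, 1 / 2 ≤ ‖z‖ → τ z = z) ∧
      ∀ᶠ z : ℂ in 𝓝 0, F (τ z) = ((q 0 * z ^ n : ℂ) : OnePoint ℂ) := by
  obtain ⟨Φ, hΦ0, hΦ, hΦ1⟩ := exists_homeomorph_pow_eq hq hq0 hn (ε := 1 / 2) (by norm_num)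
  have hs0 : Φ.symm 0 = 0 := by rw [Homeomorph.symm_apply_eq, hΦ0]
  have hcoe (z : ℂ) : Φ.symm.onePointCongr z = ((Φ.symm z : ℂ) : OnePoint ℂ) := rfl
  refine ⟨Φ.symm.onePointCongr, rfl, by rw [hcoe, hs0], fun z hz => ?_, ?_⟩
  · rw [hcoe, Homeomorph.symm_apply_eq _ |>.mpr (hΦ1 z hz).symm]
  · have ht : Tendsto Φ.symm (𝓝 0) (𝓝 0) := by
      simpa [hs0] using Φ.symm.continuous.tendsto 0
    filter_upwards [ht.eventually (hF.and hΦ)] with z hz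
    have h2 := hz.2
    rw [Homeomorph.apply_symm_apply] at h2
    rw [hcoe, hz.1, h2]

theorem exists_linearized_map {c a k : ℕ} (hkc : k < c) (hka : k < a) :
    ∃ (F : OnePoint ℂ → OnePoint ℂ) (e : OnePoint ℂ → ℕ) (r R κ₀ κ : ℂ),
      IsBranched (c + a - 1 - k) F e ∧ r ≠ 0 ∧ κ₀ ≠ 0 ∧ κ ≠ 0 ∧ F ∞ = ∞ ∧
      (∀ z : ℂ, ‖z‖ ≤ ‖r‖ → F z = ((κ₀ * z ^ c : ℂ) : OnePoint ℂ)) ∧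
      (∀ z : ℂ, ‖R‖ ≤ ‖z‖ → F z = ((κ * z ^ (c + a - 1 - 2 * k) : ℂ) : OnePoint ℂ)) ∧
      e (1 : ℂ) = a ∧ e ∞ = c + a - 1 - 2 * k ∧ ∀ z : ℂ, z ≠ 0 → z ≠ 1 → e z = 1 := by
  obtain ⟨P, Q, hP, hQ, hP0, hcop, hW, hW0, hW1, hWz⟩ := exists_three_point_polynomials hkc hka
  have hdeg : Q.natDegree < P.natDegree := by lia
  have hQ0 : Q.eval 0 ≠ 0 := fun h => hcop 0 h hP0
  have hbr := isBranched_ratMap hcop hdeg hW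
  obtain ⟨q, hq, hq0, hnear⟩ := ratMap_near_regular hQ0 hW
  obtain ⟨u, hu, hu0, hinf⟩ := ratMap_near_infty hdeg (by rintro rfl; simp at hQ0)
  rw [hW0, Nat.sub_add_cancel (by lia)] at hnear
  rw [(by lia : P.natDegree - Q.natDegree = c + a - 1 - 2 * k)] at hinf
  obtain ⟨τ, hτ, hτ0, hτ1, hτn⟩ := exists_homeomorph_linearize_zero (F := ratMap P Q) (n := c)
    (by lia) hq hq0 (by simpa [hP0] using hnear)
  obtain ⟨ρ, hρ, hρ0, hρ1, hρn⟩ := exists_homeomorph_linearize_zero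
    (F := fun x => inversion (ratMap P Q (inversion x))) (n := c + a - 1 - 2 * k)
    (by lia) hu hu0 hinf
  let θ : OnePoint ℂ ≃ₜ OnePoint ℂ := (inversionHomeomorph.trans ρ).trans inversionHomeomorph
  have hθ (x : OnePoint ℂ) : θ x = inversion (ρ (inversion x)) := rfl
  have hθinf : θ ∞ = ∞ := by simp [hθ, hρ0]
  have hθ1 (z : ℂ) (hz : ‖z‖ ≤ 2) : θ z = z := by
    by_cases h0 : z = 0
    · simp [h0, hθ, hρ]
    · rw [hθ, inversion_coe h0, hρ1, ← inversion_coe h0, inversion_involutive]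
      rw [norm_inv, one_div]
      exact inv_anti₀ (norm_pos_iff.mpr h0) hz
  have hτθ (z : ℂ) (hz : 2 < ‖z‖) : τ (θ z) = θ z := by
    induction h : θ z using OnePoint.rec with
    | infty => exact hτ
    | coe w =>
      refine hτ1 w ?_
      by_contra! hw
      have h1 := hθ1 w (by linarith)
      have := OnePoint.coe_injective (θ.injective (h.trans h1.symm))
      subst this
      linarith
  have hone : τ (θ (1 : ℂ)) = (1 : ℂ) := by
    rw [hθ1 1 (by norm_num), hτ1 1 (by norm_num)]
  have hzero : τ (θ (0 : ℂ)) = (0 : ℂ) := by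
    rw [hθ1 0 (by norm_num), hτ0]
  obtain ⟨r, hr, hrn⟩ := Metric.eventually_nhds_iff_ball.mp hτn
  obtain ⟨t, ht, htn⟩ := Metric.eventually_nhds_iff_ball.mp hρn
  refine ⟨ratMap P Q ∘ θ.trans τ, ratRam P Q ∘ θ.trans τ, ((min (r / 2) 1 : ℝ) : ℂ),
    ((max (2 / t) 3 : ℝ) : ℂ), q 0, (u 0)⁻¹, ?_, ?_, hq0, inv_ne_zero hu0, ?_, fun z hz => ?_,
    fun z hz => ?_, ?_, ?_, ?_⟩
  · rw [(by lia : c + a - 1 - k = P.natDegree)]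
    exact hbr.conj (Homeomorph.refl _) (θ.trans τ)
  · exact_mod_cast (lt_min (half_pos hr) one_pos).ne'
  · simp [hθinf, hτ, ratMap_infty]
  · rw [Complex.norm_real, Real.norm_of_nonneg (lt_min (half_pos hr) one_pos).le, le_min_iff] at hz
    simp only [Function.comp_apply, Homeomorph.trans_apply]
    rw [hθ1 z (by linarith)]
    exact hrn z (by simpa using by linarith)
  · rw [Complex.norm_real, Real.norm_of_nonneg (by positivity), max_le_iff] at hz
    have h0 : z ≠ 0 := norm_pos_iff.mp (by linarith)
    have h1 := htn z⁻¹ (by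
      rw [mem_ball_zero_iff, norm_inv, inv_lt_comm₀ (by linarith) ht]
      refine lt_of_lt_of_le ?_ hz.1
      rw [inv_eq_one_div]
      gcongr
      norm_num)
    simp only [Function.comp_apply, Homeomorph.trans_apply]
    rw [hτθ z (by linarith), hθ, inversion_coe h0, ← inversion_involutive (ratMap P Q _), h1,
      inversion_coe (mul_ne_zero hu0 (pow_ne_zero _ (inv_ne_zero h0)))]
    simp [mul_comm]
  · simp only [Function.comp_apply, Homeomorph.trans_apply]
    rw [hone, ratRam_coe, hW1]
    lia
  · simp only [Function.comp_apply, Homeomorph.trans_apply]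
    rw [hθinf, hτ, ratRam_infty]
    lia
  · intro z hz0 hz1
    simp only [Function.comp_apply, Homeomorph.trans_apply]
    induction h : τ (θ z) using OnePoint.rec with
    | infty =>
      rw [← hτ, ← hθinf] at h
      simpa [hθinf] using θ.injective (τ.injective h)
    | coe w =>
      rw [ratRam_coe, hWz]
      · rintro rfl
        exact hz0 (OnePoint.coe_injective (θ.injective (τ.injective (h.trans hzero.symm))))
      · rintro rfl
        exact hz1 (OnePoint.coe_injective (θ.injective (τ.injective (h.trans hone.symm))))

/-- A branched self-map of the sphere ramified at `0`, `p` and `∞`, equal to `z ^ c` near `0`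
and to a multiple of a power near `∞`. -/
theorem exists_three_point_map {c a k : ℕ} (hkc : k < c) (hka : k < a) :
    ∃ (g : OnePoint ℂ → OnePoint ℂ) (e : OnePoint ℂ → ℕ) (p κ : ℂ) (R : ℝ),
      IsBranched (c + a - 1 - k) g e ∧ κ ≠ 0 ∧ g ∞ = ∞ ∧ 2 < ‖p‖ ∧ ‖p‖ < R ∧
      (∀ z : ℂ, ‖z‖ ≤ 2 → g z = ((z ^ c : ℂ) : OnePoint ℂ)) ∧
      (∀ z : ℂ, R ≤ ‖z‖ → g z = ((κ * z ^ (c + a - 1 - 2 * k) : ℂ) : OnePoint ℂ)) ∧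
      e p = a ∧ e ∞ = c + a - 1 - 2 * k ∧ ∀ z : ℂ, z ≠ 0 → z ≠ p → e z = 1 := by
  obtain ⟨F, e, r, R, κ₀, κ, hF, hr, hκ₀, hκ, hinf, hFr, hFR, he1, heinf, he⟩ :=
    exists_linearized_map hkc hka
  have hr' := norm_pos_iff.mpr hr
  let s : ℝ := min (‖r‖ / 2) (1 / 3)
  have hs : 0 < s := by positivity
  have hsr : s ≤ ‖r‖ / 2 := min_le_left _ _
  have hs3 : s ≤ 1 / 3 := min_le_right _ _
  have hsC : (s : ℂ) ≠ 0 := by exact_mod_cast hs.ne'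
  have hnorm (z : ℂ) : ‖(s : ℂ) * z‖ = s * ‖z‖ := by
    rw [norm_mul, Complex.norm_real, Real.norm_of_nonneg hs.le]
  let t : ℂ := (κ₀ * s ^ c)⁻¹
  have ht : t ≠ 0 := inv_ne_zero (mul_ne_zero hκ₀ (pow_ne_zero _ hsC))
  have hp : ‖(s : ℂ)⁻¹‖ = s⁻¹ := by rw [norm_inv, Complex.norm_real, Real.norm_of_nonneg hs.le]
  refine ⟨scaling ht ∘ F ∘ scaling hsC, e ∘ scaling hsC, (s : ℂ)⁻¹,
    t * (κ * s ^ (c + a - 1 - 2 * k)), max (‖R‖ / s) (s⁻¹ + 1), hF.conj _ _,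
    mul_ne_zero ht (mul_ne_zero hκ (pow_ne_zero _ hsC)), ?_, ?_, ?_, fun z hz => ?_,
    fun z hz => ?_, ?_, ?_, fun z hz0 hz1 => ?_⟩
  · simp [hinf]
  · rw [hp, lt_inv_comm₀ (by norm_num) hs]
    linarith
  · rw [hp]
    exact (lt_add_one _).trans_le (le_max_right _ _)
  · simp only [Function.comp_apply, scaling_coe]
    rw [hFr _ (by rw [hnorm]; nlinarith), scaling_coe, mul_pow, ← mul_assoc, ← mul_assoc,
      mul_assoc t, inv_mul_cancel₀ (mul_ne_zero hκ₀ (pow_ne_zero _ hsC)), one_mul]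
  · simp only [Function.comp_apply, scaling_coe]
    rw [hFR _ (by rw [hnorm, mul_comm, ← div_le_iff₀ hs]; exact (le_max_left _ _).trans hz),
      scaling_coe, mul_pow]
    ring_nf
  · simp [hsC, he1]
  · simp [heinf]
  · simp only [Function.comp_apply, scaling_coe]
    refine he _ (mul_ne_zero hsC hz0) fun h => hz1 ?_
    rw [eq_inv_of_mul_eq_one_right h]

end NormalizedMap

section Gluing

open scoped OnePoint

/-- There is a branched self-map of the Riemann sphere of degree `d`, equal to `z ^ c` outside the
unit disc, whose critical points in the plane are points of the disc with ramification
numbers `a`. -/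
def IsRealizedInDisc (d c : ℕ) {n : ℕ} (a : Fin n → ℕ) : Prop :=
  ∃ (F : OnePoint ℂ → OnePoint ℂ) (e : OnePoint ℂ → ℕ) (y : Fin n → ℂ),
    IsBranched d F e ∧ Function.Injective y ∧ (∀ i, ‖y i‖ < 1) ∧ (∀ i, e (y i) = a i) ∧
    (∀ z : ℂ, z ∉ range y → e z = 1) ∧
    (∀ z : ℂ, 1 ≤ ‖z‖ → F z = ((z ^ c : ℂ) : OnePoint ℂ)) ∧ F ∞ = ∞ ∧ e ∞ = c

theorem isRealizedInDisc_one (a : Fin 0 → ℕ) : IsRealizedInDisc 1 1 a := by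
  have h := isBranched_ratMap (P := Polynomial.X) (Q := 1) (by simp) (by simp)
    (by simp [Polynomial.wronskian])
  rw [Polynomial.natDegree_X] at h
  refine ⟨_, _, fun i => i.elim0, h, fun i => i.elim0, fun i => i.elim0, fun i => i.elim0,
    fun z _ => ?_, fun z _ => ?_, ratMap_infty _ _, ?_⟩
  · simp [ratRam_coe, Polynomial.wronskian]
  · simp [ratMap_coe]
  · simp [ratRam_infty]

theorem encard_setOf_pow_eq {c : ℕ} (hc : 1 ≤ c) {w : ℂ} (hw : w ≠ 0) :
    {z : ℂ | z ^ c = w}.encard = c := by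
  classical
  have hζ := Complex.isPrimitiveRoot_exp c (by lia)
  have h : {z : ℂ | z ^ c = w} = (Polynomial.nthRoots c w).toFinset := by
    ext z
    simp [Polynomial.mem_nthRoots (by lia : 0 < c)]
  rw [h, encard_coe_eq_coe_finsetCard, Multiset.toFinset_card_of_nodup (hζ.nthRoots_nodup hw),
    hζ.card_nthRoots, if_pos (IsAlgClosed.exists_pow_nat_eq w (by lia))]

/-- Replacing a branched map outside the unit disc by one that agrees with it on an annulus. -/
theorem IsBranched.glue {c d D : ℕ} {F g : OnePoint ℂ → OnePoint ℂ} {e e' : OnePoint ℂ → ℕ}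
    (hc : 1 ≤ c) (hF : IsBranched d F e) (hg : IsBranched D g e')
    (hFc : ∀ z : ℂ, 1 ≤ ‖z‖ → F z = ((z ^ c : ℂ) : OnePoint ℂ)) (hFinf : F ∞ = ∞)
    (hgc : ∀ z : ℂ, ‖z‖ ≤ 2 → g z = ((z ^ c : ℂ) : OnePoint ℂ)) :
    ∃ (G : OnePoint ℂ → OnePoint ℂ) (ε : OnePoint ℂ → ℕ), IsBranched (d + D - c) G ε ∧
      (∀ z : ℂ, ‖z‖ ≤ 1 → ε z = e z) ∧ (∀ z : ℂ, 1 < ‖z‖ → G z = g z ∧ ε z = e' z) ∧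
      G ∞ = g ∞ ∧ ε ∞ = e' ∞ := by
  classical
  let K : Set (OnePoint ℂ) := (↑) '' Metric.closedBall (0 : ℂ) 1
  have hK : IsClosed K :=
    ((isCompact_closedBall (0 : ℂ) 1).image OnePoint.continuous_coe).isClosed
  have hmem (z : ℂ) : (z : OnePoint ℂ) ∈ K ↔ ‖z‖ ≤ 1 := by simp [K]
  have hinf : ∞ ∉ K := by simp [K]
  let G : OnePoint ℂ → OnePoint ℂ := fun x => if x ∈ K then F x else g x
  have hGF (z : ℂ) (hz : ‖z‖ < 2) : G z = F z := by
    by_cases h : ‖z‖ ≤ 1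
    · exact if_pos ((hmem z).mpr h)
    · rw [hFc z (le_of_not_ge h), ← hgc z hz.le]
      exact if_neg ((hmem z).not.mpr h)
  refine ⟨G, fun x => if x ∈ K then e x else e' x, ⟨fun x => ?_, fun x => ?_, ?_⟩,
    fun z hz => if_pos ((hmem z).mpr hz), fun z hz => ?_, if_neg hinf, if_neg hinf⟩
  · split_ifs
    exacts [hF.pos x, hg.pos x]
  · split_ifs with hx
    · refine (hF.germ x).congr ?_
      have hU : IsOpen ((↑) '' Metric.ball (0 : ℂ) 2 : Set (OnePoint ℂ)) :=
        OnePoint.isOpenEmbedding_coe.isOpenMap _ Metric.isOpen_ball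
      obtain ⟨z, hz, rfl⟩ := hx
      rw [mem_closedBall_zero_iff] at hz
      filter_upwards [hU.mem_nhds ⟨z, by simpa using by linarith, rfl⟩]
      rintro _ ⟨w, hw, rfl⟩
      exact (hGF w (by simpa using hw)).symm
    · refine (hg.germ x).congr ?_
      filter_upwards [hK.isOpen_compl.mem_nhds hx] with w hw
      exact (if_neg hw).symm
  · obtain ⟨B, hB, hBF⟩ := hF.card
    obtain ⟨B', hB', hBg⟩ := hg.card
    refine ⟨B ∪ B' ∪ {∞, ((0 : ℂ) : OnePoint ℂ)}, (hB.union hB').union (by simp), fun w hw => ?_⟩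
    simp only [mem_union, mem_insert_iff, mem_singleton_iff, not_or] at hw
    obtain ⟨⟨hwB, hwB'⟩, hwinf, hw0⟩ := hw
    induction w using OnePoint.rec with
    | infty => exact absurd rfl hwinf
    | coe w =>
      rw [OnePoint.coe_eq_coe] at hw0
      have h1 := encard_sdiff_add_encard_inter (F ⁻¹' {(w : OnePoint ℂ)}) K
      have h2 := encard_sdiff_add_encard_inter (g ⁻¹' {(w : OnePoint ℂ)}) K
      have h3 : (F ⁻¹' {(w : OnePoint ℂ)} \ K).encard + (g ⁻¹' {(w : OnePoint ℂ)} ∩ K).encard =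
          c := by
        rw [← encard_union_eq (disjoint_sdiff_left.mono_right inter_subset_right),
          ← encard_setOf_pow_eq hc hw0,
          ← OnePoint.coe_injective.encard_image {z : ℂ | z ^ c = w}]
        refine congrArg encard ?_
        ext x
        induction x using OnePoint.rec with
        | infty => simp [hFinf, hinf]
        | coe z =>
          simp only [mem_union, Set.mem_sdiff, mem_preimage, mem_singleton_iff, hmem, mem_inter_iff,
            OnePoint.coe_injective.mem_set_image, mem_ofPred_eq]
          by_cases h : ‖z‖ ≤ 1
          · simp [h, hgc z (by linarith)]
          · simp [h, hFc z (le_of_not_ge h)]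
      have h4 : (G ⁻¹' {(w : OnePoint ℂ)}).encard =
          (F ⁻¹' {(w : OnePoint ℂ)} ∩ K).encard + (g ⁻¹' {(w : OnePoint ℂ)} \ K).encard := by
        rw [← encard_union_eq (disjoint_sdiff_right.mono_left inter_subset_right)]
        refine congrArg encard ?_
        ext x
        by_cases hx : x ∈ K <;> simp [G, hx]
      rw [hBF _ hwB] at h1
      rw [hBg _ hwB'] at h2
      rw [h4]
      generalize (F ⁻¹' {(w : OnePoint ℂ)} \ K).encard = fo at *
      generalize (F ⁻¹' {(w : OnePoint ℂ)} ∩ K).encard = fi at *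
      generalize (g ⁻¹' {(w : OnePoint ℂ)} \ K).encard = go at *
      generalize (g ⁻¹' {(w : OnePoint ℂ)} ∩ K).encard = gi at *
      have hfin {u v : ℕ∞} {n : ℕ} (h : u + v = n) : u ≠ ⊤ ∧ v ≠ ⊤ :=
        WithTop.add_ne_top.mp (h ▸ ENat.natCast_ne_top n)
      obtain ⟨hfo, hfi⟩ := hfin h1
      obtain ⟨hgo, hgi⟩ := hfin h2
      lift fo to ℕ using hfo
      lift fi to ℕ using hfi
      lift go to ℕ using hgo
      lift gi to ℕ using hgi
      norm_cast at h1 h2 h3 ⊢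
      lia
  · have hz' := (hmem z).not.mpr hz.not_ge
    exact ⟨if_neg hz', if_neg hz'⟩

theorem IsRealizedInDisc.cons {d c n b k : ℕ} {a : Fin n → ℕ} (h : IsRealizedInDisc d c a)
    (hkc : k < c) (hkb : k < b) :
    IsRealizedInDisc (d + b - 1 - k) (c + b - 1 - 2 * k) (Fin.cons b a : Fin (n + 1) → ℕ) := by
  obtain ⟨F, e, y, hF, hy, hy1, hya, he, hFc, hFinf, -⟩ := h
  obtain ⟨g, e', p, κ, R, hg, hκ, hginf, hp2, hpR, hgc, hgR, hep, heinf, he'⟩ :=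
    exists_three_point_map hkc hkb
  obtain ⟨G, ε, hG, hεe, hGg, hGinf, hεinf⟩ := hF.glue (by lia) hg hFc hFinf hgc
  have hR : 0 < R := by linarith
  have hRC : (R : ℂ) ≠ 0 := by exact_mod_cast hR.ne'
  have hnorm (z : ℂ) : ‖(R : ℂ) * z‖ = R * ‖z‖ := by
    rw [norm_mul, Complex.norm_real, Real.norm_of_nonneg hR.le]
  have hnorm' (z : ℂ) : ‖z / (R : ℂ)‖ = ‖z‖ / R := by
    rw [norm_div, Complex.norm_real, Real.norm_of_nonneg hR.le]
  have hκR : κ * (R : ℂ) ^ (c + b - 1 - 2 * k) ≠ 0 := mul_ne_zero hκ (pow_ne_zero _ hRC)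
  have hpy (i : Fin n) : y i ≠ p := fun h => by linarith [h ▸ hy1 i]
  have hY (i : Fin (n + 1)) : (R : ℂ) * ((Fin.cons p y : Fin (n + 1) → ℂ) i / R) =
      (Fin.cons p y : Fin (n + 1) → ℂ) i := mul_div_cancel₀ _ hRC
  refine ⟨scaling (inv_ne_zero hκR) ∘ G ∘ scaling hRC, ε ∘ scaling hRC,
    fun i => (Fin.cons p y : Fin (n + 1) → ℂ) i / R, ?_, ?_, fun i => ?_, fun i => ?_,
    fun z hz => ?_, fun z hz => ?_, ?_, ?_⟩
  · rw [(by lia : d + b - 1 - k = d + (c + b - 1 - k) - c)]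
    exact hG.conj _ _
  · intro i j hij
    refine Fin.cons_injective_iff.mpr ⟨?_, hy⟩ ((div_left_inj' hRC).mp hij)
    rintro ⟨i, hi⟩
    exact hpy i hi
  · rw [hnorm', div_lt_one hR]
    refine Fin.cases hpR (fun i => ?_) i
    simpa using by linarith [hy1 i]
  · simp only [Function.comp_apply, scaling_coe, hY]
    refine Fin.cases ?_ (fun i => ?_) i
    · simp [(hGg p (by linarith)).2, hep]
    · simp [hεe _ (hy1 i).le, hya]
  · simp only [Function.comp_apply, scaling_coe]
    have hz' (i) : (R : ℂ) * z ≠ (Fin.cons p y : Fin (n + 1) → ℂ) i :=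
      fun h => hz ⟨i, (div_eq_iff hRC).mpr (h.symm.trans (mul_comm _ _))⟩
    by_cases h1 : ‖(R : ℂ) * z‖ ≤ 1
    · rw [hεe _ h1]
      refine he _ ?_
      rintro ⟨i, hi⟩
      exact hz' i.succ (by simpa using hi.symm)
    · push Not at h1
      rw [(hGg _ h1).2]
      exact he' _ (norm_pos_iff.mp (by linarith)) (hz' 0)
  · simp only [Function.comp_apply, scaling_coe]
    have h1 : R ≤ ‖(R : ℂ) * z‖ := by
      rw [hnorm]
      nlinarith
    rw [(hGg _ (by linarith)).1, hgR _ h1, scaling_coe, mul_pow, ← mul_assoc κ, ← mul_assoc,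
      inv_mul_cancel₀ hκR, one_mul]
  · simp [hGinf, hginf]
  · simp [hεinf, heinf]

end Gluing

theorem exists_intermediate_value {n m s : ℕ} {l : Fin n → ℕ}
    (heven : Even (s + (m + ∑ i, l i))) (hs : s ≤ m + ∑ i, l i) (hm : 2 * m ≤ s + (m + ∑ i, l i))
    (hl : ∀ i, 2 * l i ≤ s + (m + ∑ i, l i)) :
    ∃ t, Even (t + ∑ i, l i) ∧ t ≤ ∑ i, l i ∧ (∀ i, 2 * l i ≤ t + ∑ i, l i) ∧
      s ≤ t + m ∧ m ≤ t + s ∧ t ≤ s + m := by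
  rw [Nat.even_iff] at heven
  simp only [Nat.even_iff]
  by_cases h : ∀ i, 2 * l i ≤ ((s - m) + (m - s)) + ∑ i, l i
  · exact ⟨(s - m) + (m - s), by lia, by lia, h, by lia, by lia, by lia⟩
  · push Not at h
    obtain ⟨j, hj⟩ := h
    have hjS : l j ≤ ∑ i, l i := Finset.single_le_sum (fun _ _ => Nat.zero_le _) (Finset.mem_univ j)
    have hij (i) (h : i ≠ j) : l i + l j ≤ ∑ i, l i := by
      rw [← Finset.sum_pair h]
      exact Finset.sum_le_sum_of_subset (Finset.subset_univ _)
    have := hl j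
    refine ⟨2 * l j - ∑ i, l i, by lia, by lia, fun i => ?_, by lia, by lia, by lia⟩
    by_cases h : i = j
    · subst h
      lia
    · have := hij i h
      lia

theorem isRealizedInDisc_of_polygon {n : ℕ} (l : Fin n → ℕ) (s d : ℕ)
    (hs : s ≤ ∑ i, l i) (hl : ∀ i, 2 * l i ≤ s + ∑ i, l i) (hd : s + ∑ i, l i + 2 = 2 * d) :
    IsRealizedInDisc d (s + 1) (fun i => l i + 1) := by
  induction n generalizing s d with
  | zero =>
    simp only [Finset.univ_eq_empty, Finset.sum_empty] at hs hd
    obtain rfl : s = 0 := by lia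
    obtain rfl : d = 1 := by lia
    exact isRealizedInDisc_one _
  | succ n ih =>
    rw [Fin.sum_univ_succ] at hs hd
    simp only [Fin.sum_univ_succ] at hl
    obtain ⟨t, ht, htS, htl, h1, h2, h3⟩ := exists_intermediate_value (m := l 0)
      (l := fun i => l i.succ) (s := s) (by rw [Nat.even_iff]; lia) hs (hl 0) (fun i => hl i.succ)
    rw [Nat.even_iff] at ht
    have := (ih (fun i => l i.succ) t ((t + ∑ i : Fin n, l i.succ + 2) / 2) htS htl
      (by lia)).cons (b := l 0 + 1) (k := (t + l 0 - s) / 2) (by lia) (by lia)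
    convert this using 1
    · lia
    · lia
    · exact (Fin.cons_self_tail (fun i => l i + 1)).symm

theorem exists_isBranched_sphere {n d : ℕ} (c : ℕ) {a : Fin n → ℕ} (hc : 2 ≤ c) (ha : ∀ i, 2 ≤ a i)
    (h : IsRealizedInDisc d c a) :
    ∃ (F : Sphere2 → Sphere2) (e : Sphere2 → ℕ) (y : Fin (n + 1) → Sphere2),
      IsBranched d F e ∧ Function.Injective y ∧ {z | 1 < e z} = range y ∧
      ∀ i, e (y i) = (Fin.cons c a : Fin (n + 1) → ℕ) i := by
  obtain ⟨F, e, y, hF, hy, -, hya, he, -, -, hinf⟩ := h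
  let σ : OnePoint ℂ ≃ₜ Sphere2 := onePointEquivSphereOfFinrankEq (by simp)
  let Y : Fin (n + 1) → OnePoint ℂ := Fin.cons OnePoint.infty fun i => (y i : OnePoint ℂ)
  have hY : Function.Injective Y := Fin.cons_injective_iff.mpr
    ⟨by simp, OnePoint.coe_injective.comp hy⟩
  have heY (i) : e (Y i) = (Fin.cons c a : Fin (n + 1) → ℕ) i := by
    refine Fin.cases hinf (fun i => ?_) i
    simpa [Y] using hya i
  have hge (i) : 2 ≤ (Fin.cons c a : Fin (n + 1) → ℕ) i :=
    Fin.cases hc (fun i => by simpa using ha i) i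
  refine ⟨σ ∘ F ∘ σ.symm, e ∘ σ.symm, σ ∘ Y, hF.conj σ σ.symm, σ.injective.comp hY, ?_,
    fun i => by simp [heY]⟩
  ext z
  constructor
  · intro hz
    obtain ⟨x, rfl⟩ := σ.surjective z
    simp only [mem_ofPred_eq, Function.comp_apply, Homeomorph.symm_apply_apply] at hz
    induction x using OnePoint.rec with
    | infty => exact ⟨0, rfl⟩
    | coe w =>
      by_cases hw : w ∈ range y
      · obtain ⟨i, rfl⟩ := hw
        exact ⟨i.succ, by simp [Y]⟩
      · exact absurd (he w hw) hz.ne'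
  · rintro ⟨i, rfl⟩
    have := hge i
    simp only [mem_ofPred_eq, Function.comp_apply, Homeomorph.symm_apply_apply, heY]
    lia

end BranchedSphere

/-- Theorem C: every ramification distribution of degree `d` is realized as the list of
critical ramification numbers of a degree `d` branched covering of the 2-sphere. -/
theorem ramification_distribution_realized (d : ℕ) (hd : 2 ≤ d) (m : ℕ) (a : Fin m → ℕ)
    (ha : ∀ i, 2 ≤ a i ∧ a i ≤ d)
    (hsum : (Finset.univ.sum fun i => a i - 1) = 2 * d - 2) :
    ∃ (π : Sphere2 → Sphere2) (F : Set Sphere2) (e : Sphere2 → ℕ),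
      IsBranchedCovering d π F e ∧
      ∃ y : Fin m → Sphere2, Function.Injective y ∧
        {z : Sphere2 | 1 < e z} = Set.range y ∧
        ∀ i, e (y i) = a i := by
  rcases m with _ | n
  · simp only [Finset.univ_eq_empty, Finset.sum_empty] at hsum
    lia
  rw [Fin.sum_univ_succ] at hsum
  have h0 := ha 0
  have hreal := BranchedSphere.isRealizedInDisc_of_polygon (fun i : Fin n => a i.succ - 1)
    (a 0 - 1) d (by lia) (fun i => by have := ha i.succ; lia) (by lia)
  have hsucc (i : Fin n) : a i.succ - 1 + 1 = a i.succ := by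
    have := ha i.succ
    lia
  simp only [hsucc, (by lia : a 0 - 1 + 1 = a 0)] at hreal
  obtain ⟨π, e, y, hπ, hy, hcrit, hey⟩ :=
    BranchedSphere.exists_isBranched_sphere (a 0) h0.1 (fun i => (ha i.succ).1) hreal
  obtain ⟨F, hF⟩ := hπ.exists_isBranchedCovering (hcrit ▸ Set.finite_range y)
  exact ⟨π, F, e, hF, y, hy, hcrit, fun i => (hey i).trans (congrFun (Fin.cons_self_tail a) i)⟩
end
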